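/- arXiv:0706.1725 — 7 statements merged into one kernel-verified Lean document; each statement's English description precedes it below -/
import Mathlib

section
/- Let k ≥ 2 be an integer and let c ≤ (k−1)·log(k−1). Then for every k×k row-stochastic matrix A, g_c(J_k) ≥ g_c(A), where g_c(A) = −(1/k)·Σ_{i,j} a_ij·log a_ij + c·log( 1 − 2/k + (1/k²)·Σ_{i,j} a_ij² ) and J_k is the k×k matrix all of whose entries equal 1/k. -/
open Finset

/-- `g_c(A) = 𝓗(A) + c 𝓔(A)`, where `𝓗(A) = -(1/k) ∑ a_ij log a_ij` (with `0 log 0 = 0`)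
and `𝓔(A) = log (1 - 2/k + (1/k²) ∑ a_ij²)`. -/
noncomputable def gFun (k : ℕ) (c : ℝ) (A : Matrix (Fin k) (Fin k) ℝ) : ℝ :=
  -(1 / (k : ℝ)) * ∑ i, ∑ j, A i j * Real.log (A i j) +
    c * Real.log (1 - 2 / (k : ℝ) + (1 / (k : ℝ) ^ 2) * ∑ i, ∑ j, (A i j) ^ 2)

/-- The constant `1/k` matrix `J_k`. -/
noncomputable def Jmat (k : ℕ) : Matrix (Fin k) (Fin k) ℝ :=
  Matrix.of fun _ _ => 1 / (k : ℝ)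

/-- `log ((1 + y) / (1 - y)) / y` is nondecreasing in `y` on `(0, 1)`. -/
lemma log_sub_log_mul_le {y b : ℝ} (hy : 0 ≤ y) (hyb : y ≤ b) (hb : b < 1) :
    (Real.log (1 + y) - Real.log (1 - y)) * b ≤ (Real.log (1 + b) - Real.log (1 - b)) * y := by
  have h1 := (Real.hasSum_log_sub_log_of_abs_lt_one
    (x := y) (by rw [abs_of_nonneg hy]; linarith)).mul_right b
  have h2 := (Real.hasSum_log_sub_log_of_abs_lt_one
    (x := b) (by rw [abs_of_nonneg (hy.trans hyb)]; exact hb)).mul_right y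
  refine hasSum_le (fun i => ?_) h1 h2
  have hp : y ^ (2 * i) ≤ b ^ (2 * i) := by gcongr
  have hc : (0 : ℝ) ≤ 2 * (1 / (2 * i + 1)) * (y * b) :=
    mul_nonneg (by positivity) (mul_nonneg hy (hy.trans hyb))
  calc 2 * (1 / (2 * (i : ℝ) + 1)) * y ^ (2 * i + 1) * b
      = 2 * (1 / (2 * i + 1)) * (y * b) * y ^ (2 * i) := by ring
    _ ≤ 2 * (1 / (2 * i + 1)) * (y * b) * b ^ (2 * i) := by gcongr
    _ = 2 * (1 / (2 * (i : ℝ) + 1)) * b ^ (2 * i + 1) * y := by ring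

lemma two_mul_le_log_sub_log {y : ℝ} (hy : 0 ≤ y) (hy1 : y < 1) :
    2 * y ≤ Real.log (1 + y) - Real.log (1 - y) := by
  have h := Real.hasSum_log_sub_log_of_abs_lt_one
    (x := y) (by rw [abs_of_nonneg hy]; exact hy1)
  simpa using le_hasSum h 0 fun i _ => by positivity

/-- Quadratic lower bound for the symmetrized binary negentropy. -/
lemma quadratic_le_negentropy {α b : ℝ} (hb0 : 0 ≤ b) (hb1 : b < 1)
    (hbelow : ∀ y, 0 < y → y < b → Real.log (1 + y) - Real.log (1 - y) ≤ α * y)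
    (habove : ∀ y, b < y → y < 1 → α * y ≤ Real.log (1 + y) - Real.log (1 - y))
    {y : ℝ} (hy : |y| ≤ 1) :
    (1 + b) * Real.log (1 + b) + (1 - b) * Real.log (1 - b) + α / 2 * (y ^ 2 - b ^ 2) ≤
      (1 + y) * Real.log (1 + y) + (1 - y) * Real.log (1 - y) := by
  wlog hy0 : 0 ≤ y generalizing y
  · have h := this (y := -y) (by rwa [abs_neg]) (by linarith)
    rw [neg_sq, sub_neg_eq_add, ← sub_eq_add_neg] at h
    linarith
  rw [abs_of_nonneg hy0] at hy
  set R : ℝ → ℝ := fun y =>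
    (1 + y) * Real.log (1 + y) + (1 - y) * Real.log (1 - y) - α / 2 * y ^ 2 with hR
  have hcont : Continuous R := by
    have h1 : Continuous fun y : ℝ => (1 + y) * Real.log (1 + y) :=
      Real.continuous_mul_log.comp (by fun_prop : Continuous fun y : ℝ => 1 + y)
    have h2 : Continuous fun y : ℝ => (1 - y) * Real.log (1 - y) :=
      Real.continuous_mul_log.comp (by fun_prop : Continuous fun y : ℝ => 1 - y)
    exact (h1.add h2).sub (by fun_prop)
  have hderiv : ∀ z, 0 < z → z < 1 →
      HasDerivAt R (Real.log (1 + z) - Real.log (1 - z) - α * z) z := by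
    intro z hz0 hz1
    have h1 := (Real.hasDerivAt_mul_log (x := 1 + z) (by linarith)).comp z
      ((hasDerivAt_id z).const_add 1)
    have h2 := (Real.hasDerivAt_mul_log (x := 1 - z) (by linarith)).comp z
      ((hasDerivAt_id z).const_sub 1)
    have h3 := ((hasDerivAt_id z).pow 2).const_mul (α / 2)
    have h := (h1.add h2).sub h3
    refine HasDerivAt.congr_deriv h ?_
    simp
    ring
  suffices R b ≤ R y by simp only [hR] at this; linarith
  rcases le_total y b with hyb | hby
  · have hanti : AntitoneOn R (Set.Icc 0 b) := by
      refine antitoneOn_of_deriv_nonpos (convex_Icc _ _) hcont.continuousOn ?_ ?_ <;>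
        rw [interior_Icc]
      · exact fun z hz => (hderiv z hz.1 (hz.2.trans hb1)).differentiableAt.differentiableWithinAt
      · intro z hz
        rw [(hderiv z hz.1 (hz.2.trans hb1)).deriv]
        linarith [hbelow z hz.1 hz.2]
    exact hanti ⟨hy0, hyb⟩ ⟨hb0, le_rfl⟩ hyb
  · have hmono : MonotoneOn R (Set.Icc b 1) := by
      refine monotoneOn_of_deriv_nonneg (convex_Icc _ _) hcont.continuousOn ?_ ?_ <;>
        rw [interior_Icc]
      · exact fun z hz =>
          (hderiv z (hb0.trans_lt hz.1) hz.2).differentiableAt.differentiableWithinAt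
      · intro z hz
        rw [(hderiv z (hb0.trans_lt hz.1) hz.2).deriv]
        linarith [habove z hz.1 hz.2]
    exact hmono ⟨le_rfl, hb1.le⟩ ⟨hby, hy⟩ hby

lemma exists_slope {N μ : ℝ} (hN : 1 ≤ N) (hN' : N = 1 ∨ 2 ≤ N) (hμ : μ ≤ 1 / 2)
    (hμN : μ * (N ^ 2 - 1) ≤ N * Real.log N) :
    ∃ α : ℝ, α * ((N - 1) / (N + 1)) = Real.log N ∧ μ * (N + 1) ^ 2 ≤ α * N ∧
      (∀ y, 0 < y → y < (N - 1) / (N + 1) →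
        Real.log (1 + y) - Real.log (1 - y) ≤ α * y) ∧
      (∀ y, (N - 1) / (N + 1) < y → y < 1 →
        α * y ≤ Real.log (1 + y) - Real.log (1 - y)) := by
  rcases hN' with rfl | h2
  · refine ⟨2, by norm_num, by linarith, fun y h h' => ?_, fun y h h' => ?_⟩
    · norm_num at h'; linarith
    · norm_num at h; exact two_mul_le_log_sub_log h.le h'
  · set b := (N - 1) / (N + 1) with hb
    have hb0 : 0 < b := div_pos (by linarith) (by linarith)
    have hb1 : b < 1 := by rw [hb, div_lt_one (by linarith)]; linarith
    have hlog : Real.log (1 + b) - Real.log (1 - b) = Real.log N := by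
      rw [← Real.log_div (by linarith) (by linarith), hb]
      congr 1
      have : N + 1 ≠ 0 := by linarith
      field_simp
      ring
    have hα : Real.log N / b * b = Real.log N := div_mul_cancel₀ _ hb0.ne'
    refine ⟨Real.log N / b, hα, ?_, fun y h h' => ?_, fun y h h' => ?_⟩
    · have : Real.log N / b * N = (N * Real.log N) * (N + 1) / (N - 1) := by
        rw [hb]
        have : N + 1 ≠ 0 := by linarith
        have : N - 1 ≠ 0 := by linarith
        field_simp
      rw [this, le_div_iff₀ (by linarith)]
      nlinarith
    · have := log_sub_log_mul_le h.le h'.le hb1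
      rw [hlog] at this
      rw [div_mul_eq_mul_div, le_div_iff₀ hb0]
      exact this
    · have := log_sub_log_mul_le hb0.le h.le h'
      rw [hlog] at this
      rw [div_mul_eq_mul_div, div_le_iff₀ hb0]
      exact this

/-- The entropy bound for a distribution with one distinguished atom `x` and the remaining mass
spread uniformly over `N` points. -/
lemma two_level_entropy_bound {N μ x : ℝ} (hN : 1 ≤ N) (hN' : N = 1 ∨ 2 ≤ N) (hμ : μ ≤ 1 / 2)
    (hμN : μ * (N ^ 2 - 1) ≤ N * Real.log N) (hx0 : 0 ≤ x) (hx1 : x ≤ 1) :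
    μ * ((N + 1) * x - 1) ^ 2 / N ≤
      Real.log (N + 1) + x * Real.log x + (1 - x) * Real.log (1 - x)
        - (1 - x) * Real.log N := by
  obtain ⟨α, hα, hμα, hbelow, habove⟩ := exists_slope hN hN' hμ hμN
  have hN1 : N + 1 ≠ 0 := by linarith
  have hNp : 0 < N := by linarith
  have hb0 : 0 ≤ (N - 1) / (N + 1) := div_nonneg (by linarith) (by linarith)
  have hb1 : (N - 1) / (N + 1) < 1 := by rw [div_lt_one (by linarith)]; linarith
  have hq := quadratic_le_negentropy hb0 hb1 hbelow habove (y := 2 * x - 1)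
    (by rw [abs_le]; constructor <;> linarith)
  have e1 : 1 + (N - 1) / (N + 1) = 2 * N / (N + 1) := by field_simp; ring
  have e2 : 1 - (N - 1) / (N + 1) = 2 / (N + 1) := by field_simp; ring
  have l1 : Real.log (2 * N / (N + 1)) = Real.log 2 + Real.log N - Real.log (N + 1) := by
    rw [Real.log_div (by positivity) hN1, Real.log_mul two_ne_zero hNp.ne']
  have l2 : Real.log (2 / (N + 1)) = Real.log 2 - Real.log (N + 1) :=
    Real.log_div two_ne_zero hN1
  have double : ∀ z : ℝ, 2 * z * Real.log (2 * z) = 2 * z * Real.log 2 + 2 * (z * Real.log z) := by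
    intro z
    rcases eq_or_ne z 0 with rfl | hz
    · simp
    · rw [Real.log_mul two_ne_zero hz]; ring
  have e3 : 1 + (2 * x - 1) = 2 * x := by ring
  have e4 : 1 - (2 * x - 1) = 2 * (1 - x) := by ring
  rw [e1, e2, e3, e4, l1, l2, double, double] at hq
  have hquad : μ * ((N + 1) * x - 1) ^ 2 / N ≤
      α * (x - 1 / (N + 1)) ^ 2 := by
    rw [div_le_iff₀ hNp]
    have : ((N + 1) * x - 1) ^ 2 = (N + 1) ^ 2 * (x - 1 / (N + 1)) ^ 2 := by field_simp
    rw [this]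
    nlinarith [mul_le_mul_of_nonneg_right hμα (sq_nonneg (x - 1 / (N + 1)))]
  refine hquad.trans ?_
  have hb : (N - 1) / (N + 1) = 1 - 2 * (1 / (N + 1)) := by field_simp; ring
  have hc1 : 2 * N / (N + 1) = 2 - 2 * (1 / (N + 1)) := by field_simp; ring
  have hc2 : 2 / (N + 1) = 2 * (1 / (N + 1)) := by ring
  rw [hb] at hα
  rw [hb, hc1, hc2] at hq
  generalize 1 / (N + 1) = t at *
  rw [← hα] at hq ⊢
  nlinarith

/-- `x log x / (x² - 1)` decreases along the integers. -/
lemma mul_sq_sub_one_le_of_succ {n : ℕ} {μ : ℝ} (hμ0 : 0 ≤ μ)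
    (h : μ * (((n + 1 : ℕ) : ℝ) ^ 2 - 1) ≤ ((n + 1 : ℕ) : ℝ) * Real.log ((n + 1 : ℕ) : ℝ)) :
    μ * ((n : ℝ) ^ 2 - 1) ≤ n * Real.log n := by
  rcases Nat.lt_or_ge n 2 with hn | hn
  · interval_cases n <;> simp [hμ0]
  have hm : (2 : ℝ) ≤ n := by exact_mod_cast hn
  push_cast at h
  generalize (n : ℝ) = m at *
  have hlog : 2 * (m - 1) / (m + 1) ≤ Real.log m := by
    have := Real.le_log_one_add_of_nonneg (x := m - 1) (by linarith)
    rw [show m - 1 + 2 = m + 1 by ring, show 1 + (m - 1) = m by ring] at this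
    exact this
  have hsucc : Real.log (m + 1) ≤ Real.log m + 1 / m := by
    have h1 : m + 1 = m * (1 + 1 / m) := by field_simp
    rw [h1, Real.log_mul (by linarith) (by positivity)]
    linarith [Real.log_le_sub_one_of_pos (show 0 < 1 + 1 / m by positivity)]
  have hpoly : (m + 1) ^ 2 * (m - 1) * (1 / m) ≤ (m ^ 2 + m + 1) * (2 * (m - 1) / (m + 1)) := by
    rw [mul_one_div, mul_div_assoc', div_le_div_iff₀ (by linarith) (by linarith)]
    have h3 : (m + 1) ^ 3 ≤ 2 * m * (m ^ 2 + m + 1) := by nlinarith [sq_nonneg (m - 2)]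
    nlinarith [mul_le_mul_of_nonneg_right h3 (show 0 ≤ m - 1 by linarith)]
  have key : (m + 1) ^ 2 * (m - 1) * Real.log (m + 1) ≤ m ^ 2 * (m + 2) * Real.log m := by
    have a1 := mul_le_mul_of_nonneg_left hsucc
      (show 0 ≤ (m + 1) ^ 2 * (m - 1) from mul_nonneg (by positivity) (by linarith))
    have a2 := mul_le_mul_of_nonneg_left hlog (show 0 ≤ m ^ 2 + m + 1 by positivity)
    nlinarith
  have h4 := mul_le_mul_of_nonneg_right h (show 0 ≤ m ^ 2 - 1 by nlinarith)
  have hpos : 0 < m * (m + 2) := by positivity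
  refine le_of_mul_le_mul_right ?_ hpos
  nlinarith

/-- A lower bound for the relative entropy of a probability vector on `n + 1` points with respect
to the uniform distribution in terms of the `χ²`-divergence. -/
lemma chi_sq_le_entropy {ι : Type*} [DecidableEq ι] (n : ℕ) {μ : ℝ} (hμ0 : 0 ≤ μ)
    (hμ : μ ≤ 1 / 2) (hμn : μ * ((n : ℝ) ^ 2 - 1) ≤ n * Real.log n) (s : Finset ι)
    (hs : s.card = n + 1) (a : ι → ℝ) (ha : ∀ i ∈ s, 0 ≤ a i) (hsum : ∑ i ∈ s, a i = 1) :
    μ * (((n : ℝ) + 1) * ∑ i ∈ s, a i ^ 2 - 1) ≤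
      Real.log ((n : ℝ) + 1) + ∑ i ∈ s, a i * Real.log (a i) := by
  induction n generalizing s a with
  | zero =>
    obtain ⟨i, rfl⟩ := Finset.card_eq_one.mp hs
    simp only [Finset.sum_singleton] at hsum ⊢
    simp [hsum]
  | succ n ih =>
    have hIH := ih (mul_sq_sub_one_le_of_succ hμ0 hμn)
    obtain ⟨i, hi, hix⟩ : ∃ i ∈ s, 1 / ((n : ℝ) + 2) ≤ a i := by
      by_contra! hlt
      have hne : s.Nonempty := Finset.card_pos.mp (by omega)
      have := Finset.sum_lt_sum_of_nonempty hne hlt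
      rw [hsum, Finset.sum_const, hs, nsmul_eq_mul] at this
      push_cast at this
      have h2 : (n : ℝ) + 2 ≠ 0 := by positivity
      rw [show (n : ℝ) + 1 + 1 = n + 2 by ring, mul_one_div_cancel h2] at this
      exact lt_irrefl _ this
    have hcard : (s.erase i).card = n + 1 := by rw [Finset.card_erase_of_mem hi, hs]; rfl
    have hT : ∑ j ∈ s.erase i, a j = 1 - a i := by
      rw [← hsum, ← Finset.add_sum_erase s a hi]; ring
    have ha' : ∀ j ∈ s.erase i, 0 ≤ a j := fun j hj => ha j (Finset.mem_of_mem_erase hj)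
    have hT0 : 0 ≤ 1 - a i := hT ▸ Finset.sum_nonneg ha'
    rw [← Finset.add_sum_erase s (fun j => a j ^ 2) hi,
      ← Finset.add_sum_erase s (fun j => a j * Real.log (a j)) hi]
    have hN : (1 : ℝ) ≤ ((n + 1 : ℕ) : ℝ) := by push_cast; linarith [n.cast_nonneg (α := ℝ)]
    have hN' : ((n + 1 : ℕ) : ℝ) = 1 ∨ (2 : ℝ) ≤ ((n + 1 : ℕ) : ℝ) := by
      rcases n.eq_zero_or_pos with rfl | hn
      · left; simp
      · right; exact_mod_cast Nat.succ_le_succ hn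
    have h1 := two_level_entropy_bound hN hN' hμ hμn (ha i hi) (by linarith)
    have hcs : (1 - a i) ^ 2 ≤ ((n + 1 : ℕ) : ℝ) * ∑ j ∈ s.erase i, a j ^ 2 := by
      rw [← hT, ← hcard]; exact sq_sum_le_card_mul_sum_sq
    have hx : 1 ≤ (((n + 1 : ℕ) : ℝ) + 1) * a i := by
      rw [div_le_iff₀ (by positivity)] at hix
      push_cast; linarith
    rcases hT0.eq_or_lt with h0 | hpos
    · have hz : ∀ j ∈ s.erase i, a j = 0 :=
        (Finset.sum_eq_zero_iff_of_nonneg ha').mp (hT.trans h0.symm)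
      rw [Finset.sum_eq_zero (fun j hj => by rw [hz j hj]; simp),
        Finset.sum_eq_zero (fun j hj => by rw [hz j hj]; simp)]
      have hai : a i = 1 := by linarith
      rw [hai] at h1 ⊢
      have hNe : ((n + 1 : ℕ) : ℝ) ≠ 0 := by linarith
      have e : μ * ((((n + 1 : ℕ) : ℝ) + 1) * 1 - 1) ^ 2 / ((n + 1 : ℕ) : ℝ)
          = μ * ((((n + 1 : ℕ) : ℝ) + 1) * (1 ^ 2 + 0) - 1) := by field_simp; ring
      rw [e] at h1
      simpa using h1
    · set T := 1 - a i with hTdef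
      have h2 := hIH (s.erase i) hcard (fun j => a j / T)
        (fun j hj => div_nonneg (ha' j hj) hpos.le)
        (by rw [← Finset.sum_div, hT, div_self hpos.ne'])
      have hsq : ∑ j ∈ s.erase i, (a j / T) ^ 2 = (∑ j ∈ s.erase i, a j ^ 2) / T ^ 2 := by
        simp_rw [div_pow, Finset.sum_div]
      have hent : ∑ j ∈ s.erase i, a j / T * Real.log (a j / T) =
          (∑ j ∈ s.erase i, a j * Real.log (a j)) / T - Real.log T := by
        have : ∀ j, a j / T * Real.log (a j / T) =
            a j * Real.log (a j) / T - a j * (Real.log T / T) := by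
          intro j
          rcases eq_or_ne (a j) 0 with hj | hj
          · simp [hj]
          · rw [Real.log_div hj hpos.ne']; ring
        simp_rw [this, Finset.sum_sub_distrib, ← Finset.sum_div, ← Finset.sum_mul, hT]
        field_simp
      rw [hsq, hent] at h2
      have hcast : (n : ℝ) + 1 = ((n + 1 : ℕ) : ℝ) := by push_cast; ring
      rw [hcast] at h2
      generalize ((n + 1 : ℕ) : ℝ) = N at *
      generalize ∑ j ∈ s.erase i, a j ^ 2 = S at *
      generalize ∑ j ∈ s.erase i, a j * Real.log (a j) = E at *
      generalize a i = x at *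
      have hNp : 0 < N := by linarith
      have h3 := mul_le_mul_of_nonneg_left h2 hpos.le
      have h3' : T * (Real.log N + (E / T - Real.log T)) =
          T * Real.log N + E - T * Real.log T := by field_simp; ring
      have h3'' : T * (μ * (N * (S / T ^ 2) - 1)) = μ * (N * S - T ^ 2) / T := by field_simp
      rw [h3', h3''] at h3
      have h4 : μ * (N * S - T ^ 2) * ((N + 1) / N) ≤ μ * (N * S - T ^ 2) / T := by
        rw [div_eq_mul_one_div _ T]
        refine mul_le_mul_of_nonneg_left ?_ (mul_nonneg hμ0 (by linarith))
        rw [div_le_div_iff₀ hNp hpos, hTdef]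
        linarith
      have h5 : μ * ((N + 1) * (x ^ 2 + S) - 1) =
          μ * ((N + 1) * x - 1) ^ 2 / N + μ * (N * S - T ^ 2) * ((N + 1) / N) := by
        rw [hTdef]; field_simp; ring
      linarith

/-- The mean entropy deficit of a row-stochastic matrix controls its squared Frobenius norm. -/
lemma sum_sq_sub_one_le_entropy {k : ℕ} (hk : 2 ≤ k) (A : Matrix (Fin k) (Fin k) ℝ)
    (hA_nonneg : ∀ i j, 0 ≤ A i j) (hA_row : ∀ i, ∑ j, A i j = 1) :
    Real.log ((k : ℝ) - 1) / ((k : ℝ) - 1) * (∑ i, ∑ j, A i j ^ 2 - 1) ≤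
      Real.log k + 1 / (k : ℝ) * ∑ i, ∑ j, A i j * Real.log (A i j) := by
  obtain ⟨n, rfl⟩ : ∃ n, k = n + 1 := ⟨k - 1, by omega⟩
  have hn : (1 : ℝ) ≤ n := by exact_mod_cast (by omega : 1 ≤ n)
  have hlog : 0 ≤ Real.log n := Real.log_nonneg hn
  have hhalf : Real.log n / n ≤ 1 / 2 := by
    have h1 := Real.log_le_sub_one_of_pos (show (0 : ℝ) < n / 2 by positivity)
    rw [Real.log_div (by positivity) two_ne_zero] at h1
    rw [div_le_iff₀ (by positivity)]
    linarith [Real.log_two_lt_d9]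
  have hsharp : Real.log n / n * ((n : ℝ) ^ 2 - 1) ≤ n * Real.log n := by
    rw [div_mul_eq_mul_div, div_le_iff₀ (by positivity)]
    nlinarith
  have hrow : ∀ i, Real.log n / n * (((n : ℝ) + 1) * ∑ j, A i j ^ 2 - 1) ≤
      Real.log ((n : ℝ) + 1) + ∑ j, A i j * Real.log (A i j) := fun i =>
    chi_sq_le_entropy n (by positivity) hhalf hsharp univ (by simp) (A i)
      (fun j _ => hA_nonneg i j) (hA_row i)
  have hsum := Finset.sum_le_sum fun i (_ : i ∈ univ) => hrow i
  rw [← Finset.mul_sum, Finset.sum_sub_distrib, ← Finset.mul_sum, Finset.sum_add_distrib] at hsum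
  simp only [Finset.sum_const, Finset.card_univ, Fintype.card_fin, nsmul_eq_mul] at hsum
  push_cast at hsum ⊢
  rw [add_sub_cancel_right]
  have hk0 : (0 : ℝ) < n + 1 := by positivity
  refine le_of_mul_le_mul_left ?_ hk0
  rw [mul_add, ← mul_assoc ((n : ℝ) + 1) (1 / _), mul_one_div_cancel hk0.ne']
  linarith

lemma gFun_Jmat {k : ℕ} (hk : 2 ≤ k) (c : ℝ) :
    gFun k c (Jmat k) = Real.log k + c * Real.log (((k : ℝ) - 1) ^ 2 / (k : ℝ) ^ 2) := by
  have hk0 : (k : ℝ) ≠ 0 := by positivity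
  simp only [gFun, Jmat, Matrix.of_apply, Finset.sum_const, Finset.card_univ, Fintype.card_fin,
    nsmul_eq_mul, one_div, Real.log_inv]
  congr 1
  · field_simp
  · congr 2
    field_simp
    ring

/-- For `c ≤ (k-1) log (k-1)`, the function `g_c` is maximized over the `k × k`
row-stochastic matrices by the constant matrix `J_k`. -/
theorem gc_maximized_at_J (k : ℕ) (hk : 2 ≤ k) (c : ℝ)
    (hc : c ≤ ((k : ℝ) - 1) * Real.log ((k : ℝ) - 1))
    (A : Matrix (Fin k) (Fin k) ℝ)
    (hA_nonneg : ∀ i j, 0 ≤ A i j)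
    (hA_row : ∀ i, ∑ j, A i j = 1) :
    gFun k c A ≤ gFun k c (Jmat k) := by
  rw [gFun_Jmat hk]
  have hent := sum_sq_sub_one_le_entropy hk A hA_nonneg hA_row
  have hk2 : (2 : ℝ) ≤ k := by exact_mod_cast hk
  have hρ : 1 ≤ ∑ i, ∑ j, A i j ^ 2 := by
    have hrow : ∀ i, 1 / (k : ℝ) ≤ ∑ j, A i j ^ 2 := fun i => by
      have h := sq_sum_le_card_mul_sum_sq (s := univ) (f := A i)
      rw [hA_row i, Finset.card_univ, Fintype.card_fin] at h
      rw [div_le_iff₀ (by positivity)]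
      linarith
    have h := Finset.sum_le_sum fun i (_ : i ∈ univ) => hrow i
    rw [Finset.sum_const, Finset.card_univ, Fintype.card_fin, nsmul_eq_mul,
      mul_one_div_cancel (by positivity)] at h
    exact h
  unfold gFun
  generalize ∑ i, ∑ j, A i j ^ 2 = ρ at *
  generalize ∑ i, ∑ j, A i j * Real.log (A i j) = E at *
  have hk0 : (k : ℝ) ≠ 0 := by positivity
  have hn : (0 : ℝ) < (k : ℝ) - 1 := by linarith
  have hsplit : 1 - 2 / (k : ℝ) + 1 / (k : ℝ) ^ 2 * ρ =
      ((k : ℝ) - 1) ^ 2 / (k : ℝ) ^ 2 * (1 + (ρ - 1) / ((k : ℝ) - 1) ^ 2) := by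
    field_simp
    ring
  have hr : 0 ≤ (ρ - 1) / ((k : ℝ) - 1) ^ 2 := div_nonneg (by linarith) (by positivity)
  rw [hsplit, Real.log_mul (by positivity) (by positivity)]
  have hΔ0 : 0 ≤ Real.log (1 + (ρ - 1) / ((k : ℝ) - 1) ^ 2) := Real.log_nonneg (by linarith)
  have hΔ1 : Real.log (1 + (ρ - 1) / ((k : ℝ) - 1) ^ 2) ≤ (ρ - 1) / ((k : ℝ) - 1) ^ 2 := by
    linarith [Real.log_le_sub_one_of_pos
      (show 0 < 1 + (ρ - 1) / ((k : ℝ) - 1) ^ 2 by linarith)]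
  have hlog : 0 ≤ Real.log ((k : ℝ) - 1) := Real.log_nonneg (by linarith)
  have hbound : c * Real.log (1 + (ρ - 1) / ((k : ℝ) - 1) ^ 2) ≤
      Real.log ((k : ℝ) - 1) / ((k : ℝ) - 1) * (ρ - 1) :=
    calc c * Real.log (1 + (ρ - 1) / ((k : ℝ) - 1) ^ 2)
        ≤ ((k : ℝ) - 1) * Real.log ((k : ℝ) - 1) *
            Real.log (1 + (ρ - 1) / ((k : ℝ) - 1) ^ 2) := by gcongr
      _ ≤ ((k : ℝ) - 1) * Real.log ((k : ℝ) - 1) * ((ρ - 1) / ((k : ℝ) - 1) ^ 2) := by gcongr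
      _ = Real.log ((k : ℝ) - 1) / ((k : ℝ) - 1) * (ρ - 1) := by field_simp
  rw [mul_add]
  linarith
end

section
/- Let k ≥ 2 be an integer and let 0 < c < (k−1)·log(k−1). Then there exists a constant C = C(k,c) < ∞ such that for every positive multiple n of k, if Z denotes the number of balanced proper k-colorings of the random multigraph G(n, m=⌊cn⌋), then E[Z²] ≤ C·(E[Z])². -/
open Finset Filter
open scoped Classical

/-- A proper `k`-coloring of the multigraph on `Fin n` whose `m` edges are given by
`e : Fin m → Fin n × Fin n`: no edge is monochromatic. -/
def IsProperColoring {n m k : ℕ} (e : Fin m → Fin n × Fin n) (σ : Fin n → Fin k) : Prop :=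
  ∀ i : Fin m, σ (e i).1 ≠ σ (e i).2

/-- A `k`-coloring of `n` vertices is balanced if every color class has size exactly `n/k`. -/
def IsBalanced (k n : ℕ) (σ : Fin n → Fin k) : Prop :=
  ∀ c : Fin k, (Finset.univ.filter (fun v => σ v = c)).card = n / k

/-- The number of balanced proper `k`-colorings of the multigraph with edge
configuration `e`. -/
noncomputable def numBalColorings (k n m : ℕ) (e : Fin m → Fin n × Fin n) : ℕ :=
  (Finset.univ.filter
    (fun σ : Fin n → Fin k => IsBalanced k n σ ∧ IsProperColoring e σ)).card

/-- The expectation of `f` of the edge configuration of the random multigraph `G(n,m)`. -/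
noncomputable def multigraphExp (n m : ℕ) (f : (Fin m → Fin n × Fin n) → ℝ) : ℝ :=
  (∑ e : Fin m → Fin n × Fin n, f e) / ((n : ℝ) ^ 2) ^ m

lemma convexOn_log_odds : ConvexOn ℝ (Set.Ico (1 / 2 : ℝ) 1)
    (fun x => Real.log x - Real.log (1 - x)) := by
  have hd : ∀ x ∈ Set.Ioo (1 / 2 : ℝ) 1,
      HasDerivAt (fun x => Real.log x - Real.log (1 - x)) (1 / (x * (1 - x))) x := by
    intro x hx
    have hx0 : x ≠ 0 := by linarith [hx.1]
    have hx1 : 1 - x ≠ 0 := by linarith [hx.2]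
    have h := (Real.hasDerivAt_log hx0).sub
      (((hasDerivAt_id x).const_sub 1).log hx1)
    refine h.congr_deriv ?_
    simp only [id]
    field_simp
    ring
  refine MonotoneOn.convexOn_of_deriv (convex_Ico _ _) ?_ ?_ ?_
  · refine ContinuousOn.sub (ContinuousOn.log continuousOn_id ?_)
      (ContinuousOn.log (by fun_prop) ?_)
    · intro x hx; linarith [hx.1]
    · intro x hx; linarith [hx.2]
  · rw [interior_Ico]
    exact fun x hx => (hd x hx).differentiableAt.differentiableWithinAt
  · rw [interior_Ico]
    intro x hx y hy hxy
    rw [(hd x hx).deriv, (hd y hy).deriv]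
    have : 0 < y * (1 - y) := mul_pos (by linarith [hy.1]) (by linarith [hy.2])
    exact one_div_le_one_div_of_le this (by nlinarith [hx.1, hy.1])

/-- If a quadratic `C x (1 - x)` is tangent to the binary entropy at `y ≥ 1/2`, up to a constant,
then the difference of the two is maximal at `y`. -/
lemma binEntropy_sub_le_of_half_lt {C y : ℝ} (hy : 1 / 2 < y) (hy1 : y < 1)
    (hC : Real.log y - Real.log (1 - y) = C * (2 * y - 1)) {x : ℝ} (hx : 1 / 2 ≤ x)
    (hx1 : x ≤ 1) :
    Real.binEntropy x - C * (x * (1 - x)) ≤ Real.binEntropy y - C * (y * (1 - y)) := by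
  set ψ : ℝ → ℝ := fun x => Real.binEntropy x - C * (x * (1 - x)) with hψ
  have hcont : Continuous ψ := by fun_prop
  have hd : ∀ z ∈ Set.Ioo (1 / 2 : ℝ) 1,
      HasDerivAt ψ (C * (2 * z - 1) - (Real.log z - Real.log (1 - z))) z := by
    intro z hz
    have h := (Real.hasDerivAt_binEntropy (p := z) (by linarith [hz.1]) (by linarith [hz.2])).sub
      (((hasDerivAt_id z).mul ((hasDerivAt_id z).const_sub 1)).const_mul C)
    refine h.congr_deriv ?_
    simp only [id]
    ring
  have hhalf : Real.log (1 / 2 : ℝ) - Real.log (1 - 1 / 2) = 0 := by norm_num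
  have hsec : ∀ z w : ℝ, 1 / 2 < z → z ≤ w → w < 1 →
      (Real.log z - Real.log (1 - z)) / (z - 1 / 2) ≤
        (Real.log w - Real.log (1 - w)) / (w - 1 / 2) := by
    intro z w hz hzw hw
    have h := convexOn_log_odds.secant_mono (a := 1 / 2) (x := z) (y := w)
      ⟨le_refl _, by norm_num⟩ ⟨hz.le, by linarith⟩ ⟨by linarith, hw⟩ (by linarith) (by linarith) hzw
    simpa only [hhalf, sub_zero] using h
  have hCy : (Real.log y - Real.log (1 - y)) / (y - 1 / 2) = 2 * C := by
    rw [hC, div_eq_iff (by linarith)]; ring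
  rcases le_total x y with hxy | hxy
  · have hmono : MonotoneOn ψ (Set.Icc (1 / 2) y) := by
      refine monotoneOn_of_deriv_nonneg (convex_Icc _ _) hcont.continuousOn ?_ ?_
      · rw [interior_Icc]
        exact fun z hz => (hd z ⟨hz.1, by linarith [hz.2]⟩).differentiableAt.differentiableWithinAt
      · rw [interior_Icc]
        intro z hz
        rw [(hd z ⟨hz.1, by linarith [hz.2]⟩).deriv]
        have h := hsec z y hz.1 hz.2.le hy1
        rw [hCy, div_le_iff₀ (by linarith [hz.1])] at h
        linarith
    exact hmono ⟨hx, hxy⟩ ⟨hy.le, le_refl _⟩ hxy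
  · have hanti : AntitoneOn ψ (Set.Icc y 1) := by
      refine antitoneOn_of_deriv_nonpos (convex_Icc _ _) hcont.continuousOn ?_ ?_
      · rw [interior_Icc]
        exact fun z hz => (hd z ⟨by linarith [hz.1], hz.2⟩).differentiableAt.differentiableWithinAt
      · rw [interior_Icc]
        intro z hz
        rw [(hd z ⟨by linarith [hz.1], hz.2⟩).deriv]
        have h := hsec y z hy hz.1.le hz.2
        rw [hCy, le_div_iff₀ (by linarith [hz.1])] at h
        linarith
    exact hanti ⟨le_refl _, hy1.le⟩ ⟨hxy, hx1⟩ hxy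

lemma binEntropy_le_log_two_sub_sq {x : ℝ} (hx0 : 0 ≤ x) (hx1 : x ≤ 1) :
    Real.binEntropy x ≤ Real.log 2 - 2 * (x - 1 / 2) ^ 2 := by
  wlog hx : 1 / 2 ≤ x generalizing x
  · have h := this (x := 1 - x) (by linarith) (by linarith) (by linarith)
    rw [Real.binEntropy_one_sub] at h
    linarith [show (1 - x - 1 / 2) ^ 2 = (x - 1 / 2) ^ 2 by ring]
  set ψ : ℝ → ℝ := fun x => Real.binEntropy x + 2 * (x - 1 / 2) ^ 2 with hψ
  have hcont : Continuous ψ := by fun_prop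
  have hd : ∀ z ∈ Set.Ioo (1 / 2 : ℝ) 1,
      HasDerivAt ψ (4 * (z - 1 / 2) - (Real.log z - Real.log (1 - z))) z := by
    intro z hz
    have h := (Real.hasDerivAt_binEntropy (p := z) (by linarith [hz.1]) (by linarith [hz.2])).add
      ((((hasDerivAt_id z).sub_const (1 / 2)).pow 2).const_mul 2)
    refine h.congr_deriv ?_
    simp only [id]
    ring
  have hlog : MonotoneOn (fun x : ℝ => Real.log x - Real.log (1 - x) - 4 * (x - 1 / 2))
      (Set.Ico (1 / 2) 1) := by
    have hd : ∀ x ∈ Set.Ioo (1 / 2 : ℝ) 1,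
        HasDerivAt (fun x => Real.log x - Real.log (1 - x) - 4 * (x - 1 / 2))
          (1 / (x * (1 - x)) - 4) x := by
      intro x hx
      have hx0 : x ≠ 0 := by linarith [hx.1]
      have hx1 : 1 - x ≠ 0 := by linarith [hx.2]
      have h := ((Real.hasDerivAt_log hx0).sub (((hasDerivAt_id x).const_sub 1).log hx1)).sub
        (((hasDerivAt_id x).sub_const (1 / 2)).const_mul 4)
      refine h.congr_deriv ?_
      simp only [id]
      field_simp
      ring
    refine monotoneOn_of_deriv_nonneg (convex_Ico _ _) ?_ ?_ ?_
    · refine ContinuousOn.sub (ContinuousOn.sub (ContinuousOn.log continuousOn_id ?_)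
        (ContinuousOn.log (by fun_prop) ?_)) (by fun_prop)
      · intro x hx; linarith [hx.1]
      · intro x hx; linarith [hx.2]
    · rw [interior_Ico]
      exact fun x hx => (hd x hx).differentiableAt.differentiableWithinAt
    · rw [interior_Ico]
      intro x hx
      rw [(hd x hx).deriv, sub_nonneg,
        le_div_iff₀ (mul_pos (by linarith [hx.1]) (by linarith [hx.2]))]
      nlinarith [sq_nonneg (2 * x - 1)]
  have hanti : AntitoneOn ψ (Set.Icc (1 / 2) 1) := by
    refine antitoneOn_of_deriv_nonpos (convex_Icc _ _) hcont.continuousOn ?_ ?_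
    · rw [interior_Icc]
      exact fun z hz => (hd z hz).differentiableAt.differentiableWithinAt
    · rw [interior_Icc]
      intro z hz
      rw [(hd z hz).deriv]
      have h := hlog ⟨le_refl _, by norm_num⟩ ⟨hz.1.le, hz.2⟩ hz.1.le
      norm_num at h
      linarith
  have h := hanti ⟨le_refl _, by norm_num⟩ ⟨hx, hx1⟩ hx
  simp only [hψ, one_div, Real.binEntropy_two_inv] at h
  norm_num at h ⊢
  linarith

/-- The best constant in the inequality bounding the entropy deficit of a probability vector with
`k` entries from below by its squared Euclidean distance from the uniform vector. -/
noncomputable def deficitConst (k : ℕ) : ℝ :=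
  if k ≤ 2 then 1 else ((k : ℝ) - 1) * Real.log ((k : ℝ) - 1) / ((k : ℝ) - 2)

lemma deficitConst_of_three_le {k : ℕ} (hk : 3 ≤ k) :
    deficitConst k = ((k : ℝ) - 1) * Real.log ((k : ℝ) - 1) / ((k : ℝ) - 2) :=
  if_neg (by omega)

lemma deficitConst_succ_mul_le {k : ℕ} (hk : 1 ≤ k) :
    deficitConst (k + 1) * k ≤ deficitConst k * (k + 1) := by
  rcases (by omega : k = 1 ∨ k = 2 ∨ 3 ≤ k) with rfl | rfl | hk3
  · norm_num [deficitConst]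
  · have := Real.log_two_lt_d9
    norm_num [deficitConst]
    linarith
  · rw [deficitConst_of_three_le hk3, deficitConst_of_three_le (by omega)]
    obtain ⟨t, rfl⟩ : ∃ t, k = t + 1 := ⟨k - 1, by omega⟩
    have ht : (2 : ℝ) ≤ t := by exact_mod_cast (by omega : 2 ≤ t)
    push_cast
    have e1 : (t : ℝ) + 1 + 1 - 1 = t + 1 := by ring
    have e2 : (t : ℝ) + 1 + 1 - 2 = t := by ring
    have e3 : (t : ℝ) + 1 - 1 = t := by ring
    have e4 : (t : ℝ) + 1 - 2 = t - 1 := by ring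
    rw [e1, e2, e3, e4]
    have hlog : Real.log (t + 1) ≤ Real.log t + 1 / t := by
      have h := Real.log_le_sub_one_of_pos (show (0 : ℝ) < (t + 1) / t by positivity)
      rw [Real.log_div (by positivity) (by positivity)] at h
      have : ((t : ℝ) + 1) / t - 1 = 1 / t := by field_simp; ring
      linarith
    have hlow : (t : ℝ) ^ 2 - 1 ≤ Real.log t * (t ^ 2 + t / (t + 1)) := by
      rcases (by omega : t = 2 ∨ 3 ≤ t) with rfl | ht3
      · have := Real.log_two_gt_d9
        norm_num
        linarith
      · have h3 : (1 : ℝ) ≤ Real.log t := by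
          rw [Real.le_log_iff_exp_le (by positivity)]
          have : (3 : ℝ) ≤ t := by exact_mod_cast ht3
          linarith [Real.exp_one_lt_d9]
        have : 0 ≤ (t : ℝ) / (t + 1) := by positivity
        nlinarith
    rw [div_mul_eq_mul_div, div_mul_eq_mul_div, div_le_div_iff₀ (by linarith) (by linarith)]
    have key : Real.log (t + 1) * ((t + 1) ^ 2 * (t - 1)) ≤ Real.log t * (t ^ 2 * (t + 2)) := by
      calc Real.log (t + 1) * ((t + 1) ^ 2 * (t - 1))
          ≤ (Real.log t + 1 / t) * ((t + 1) ^ 2 * (t - 1)) := by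
            apply mul_le_mul_of_nonneg_right hlog
            have : (0 : ℝ) ≤ t - 1 := by linarith
            positivity
        _ = Real.log t * ((t + 1) ^ 2 * (t - 1)) + (t ^ 2 - 1) * ((t + 1) / t) := by
            field_simp
            ring
        _ ≤ Real.log t * ((t + 1) ^ 2 * (t - 1)) +
              Real.log t * (t ^ 2 + t / (t + 1)) * ((t + 1) / t) := by
            gcongr
        _ = Real.log t * (t ^ 2 * (t + 2)) := by
            field_simp
            ring
    nlinarith [key]

/-- The entropy inequality for a vector all of whose entries but one coincide. -/
lemma binEntropy_add_le {k : ℕ} (hk : 1 ≤ k) {x : ℝ} (hx0 : 0 ≤ x) (hx1 : x ≤ 1) :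
    Real.binEntropy x + (1 - x) * Real.log k ≤ Real.log (k + 1) -
      deficitConst (k + 1) * (x ^ 2 + (1 - x) ^ 2 / k - 1 / (k + 1)) := by
  rcases (by omega : k = 1 ∨ 2 ≤ k) with rfl | hk2
  · have h := binEntropy_le_log_two_sub_sq hx0 hx1
    norm_num [deficitConst]
    norm_num at h
    nlinarith
  · rw [deficitConst_of_three_le (by omega)]
    have hk2' : (2 : ℝ) ≤ k := by exact_mod_cast hk2
    push_cast
    generalize (k : ℝ) = t at hk2' ⊢
    have e1 : t + 1 - 1 = t := by ring
    have e2 : t + 1 - 2 = t - 1 := by ring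
    rw [e1, e2]
    have ht1 : 0 < t - 1 := by linarith
    have ht0 : 0 < t := by linarith
    have hy1 : 1 - t / (t + 1) = 1 / (t + 1) := by field_simp; ring
    set C : ℝ := (t + 1) * Real.log t / (t - 1) with hCdef
    have hy : 1 / 2 < t / (t + 1) := by rw [lt_div_iff₀ (by linarith)]; linarith
    have hyl : t / (t + 1) < 1 := by rw [div_lt_one (by linarith)]; linarith
    have hC : Real.log (t / (t + 1)) - Real.log (1 - t / (t + 1)) =
        C * (2 * (t / (t + 1)) - 1) := by
      rw [hy1, Real.log_div ht0.ne' (by linarith), Real.log_div one_ne_zero (by linarith), hCdef,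
        Real.log_one]
      field_simp
      ring
    have hmax : Real.binEntropy x - C * (x * (1 - x)) ≤
        Real.binEntropy (t / (t + 1)) - C * (t / (t + 1) * (1 - t / (t + 1))) := by
      rcases le_total (1 / 2) x with h | h
      · exact binEntropy_sub_le_of_half_lt hy hyl hC h hx1
      · have h' := binEntropy_sub_le_of_half_lt hy hyl hC (x := 1 - x) (by linarith) (by linarith)
        rw [Real.binEntropy_one_sub] at h'
        calc _ = Real.binEntropy x - C * ((1 - x) * (1 - (1 - x))) := by ring
          _ ≤ _ := h'
    have hent : Real.binEntropy (t / (t + 1)) =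
        Real.log (t + 1) - t / (t + 1) * Real.log t := by
      rw [Real.binEntropy_eq_negMulLog_add_negMulLog_one_sub, hy1, Real.negMulLog, Real.negMulLog,
        Real.log_div ht0.ne' (by linarith), Real.log_div one_ne_zero (by linarith), Real.log_one]
      field_simp
      ring
    rw [hent, hy1] at hmax
    have : Real.log (t + 1) - t * Real.log t / (t - 1) * (x ^ 2 + (1 - x) ^ 2 / t - 1 / (t + 1)) =
        Real.log (t + 1) - t / (t + 1) * Real.log t - C * (t / (t + 1) * (1 / (t + 1)))
          + C * (x * (1 - x)) + (1 - x) * Real.log t := by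
      rw [hCdef]
      field_simp
      ring
    rw [this]
    linarith

/-- The entropy of a probability vector with `k` entries falls short of `log k` by at least
`deficitConst k` times the squared Euclidean distance from the uniform vector. -/
lemma sum_negMulLog_le {ι : Type*} {k : ℕ} (hk : 1 ≤ k) (S : Finset ι) (hS : S.card = k)
    (p : ι → ℝ) (hp : ∀ i ∈ S, 0 ≤ p i) (hsum : ∑ i ∈ S, p i = 1) :
    ∑ i ∈ S, Real.negMulLog (p i) ≤
      Real.log k - deficitConst k * (∑ i ∈ S, p i ^ 2 - 1 / k) := by
  induction k, hk using Nat.le_induction generalizing S p with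
  | base =>
    obtain ⟨i, rfl⟩ := Finset.card_eq_one.mp hS
    simp only [sum_singleton] at hsum ⊢
    simp [hsum]
  | succ k hk ih =>
    have hk0 : (0 : ℝ) < k := by exact_mod_cast hk
    obtain ⟨i, hiS, hi⟩ : ∃ i ∈ S, (1 : ℝ) / (k + 1) ≤ p i := by
      refine Finset.exists_le_of_sum_le (Finset.card_pos.mp (by omega)) ?_
      rw [sum_const, hS, hsum, nsmul_eq_mul]
      push_cast
      rw [mul_one_div_cancel (by positivity)]
    set T := S.erase i with hT
    have hTcard : T.card = k := by rw [hT, card_erase_of_mem hiS, hS]; rfl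
    have split : ∀ f : ι → ℝ, ∑ j ∈ S, f j = f i + ∑ j ∈ T, f j :=
      fun f => (add_sum_erase S f hiS).symm
    have hpT : ∀ j ∈ T, 0 ≤ p j := fun j hj => hp j (mem_of_mem_erase hj)
    set x := p i with hx
    have hTsum : ∑ j ∈ T, p j = 1 - x := by linarith [split p]
    have hx0 : 0 ≤ x := hp i hiS
    have hx1 : x ≤ 1 := by linarith [sum_nonneg hpT]
    have hmain := binEntropy_add_le hk hx0 hx1
    rw [split, split]
    push_cast
    rcases hx1.eq_or_lt with hx1' | hx1'
    · have hz : ∀ j ∈ T, p j = 0 := by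
        rw [← sum_eq_zero_iff_of_nonneg hpT, hTsum, hx1', sub_self]
      have hz1 : ∑ j ∈ T, Real.negMulLog (p j) = 0 :=
        sum_eq_zero fun j hj => by rw [hz j hj, Real.negMulLog_zero]
      have hz2 : ∑ j ∈ T, p j ^ 2 = 0 := sum_eq_zero fun j hj => by rw [hz j hj]; norm_num
      rw [hz1, hz2, ← hx, hx1']
      rw [hx1'] at hmain
      simpa using hmain
    · have hpos : 0 < 1 - x := by linarith
      set q : ι → ℝ := fun j => p j / (1 - x) with hq
      have hpq : ∀ j, p j = (1 - x) * q j := fun j => by simp only [hq]; field_simp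
      have hqsum : ∑ j ∈ T, q j = 1 := by
        simp only [hq]
        rw [← sum_div, hTsum, div_self hpos.ne']
      have hih := ih T hTcard q (fun j hj => div_nonneg (hpT j hj) hpos.le) hqsum
      have hent : ∑ j ∈ T, Real.negMulLog (p j) =
          Real.negMulLog (1 - x) + (1 - x) * ∑ j ∈ T, Real.negMulLog (q j) := by
        rw [sum_congr rfl (fun j _ => by rw [hpq j, Real.negMulLog_mul]), sum_add_distrib,
          ← sum_mul, hqsum, one_mul, mul_sum]
      have hsq : ∑ j ∈ T, p j ^ 2 = (1 - x) ^ 2 * ∑ j ∈ T, q j ^ 2 := by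
        rw [mul_sum]
        exact sum_congr rfl (fun j _ => by rw [hpq j, mul_pow])
      set s := ∑ j ∈ T, q j ^ 2 with hs
      have hs1 : 0 ≤ s - 1 / k := by
        have h := sq_sum_le_card_mul_sum_sq (s := T) (f := q)
        rw [hqsum, hTcard, ← hs] at h
        rw [sub_nonneg, div_le_iff₀ hk0]
        linarith
      have hγ : deficitConst (k + 1) * (1 - x) ≤ deficitConst k := by
        have h := deficitConst_succ_mul_le hk
        have hnn : 0 ≤ deficitConst (k + 1) := by
          unfold deficitConst
          split_ifs
          · norm_num
          · rename_i h2
            have h3 : (2 : ℝ) ≤ k := by exact_mod_cast (by omega : 2 ≤ k)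
            push_cast
            exact div_nonneg (mul_nonneg (by linarith) (Real.log_nonneg (by linarith)))
              (by linarith)
        have h1 : 1 - x ≤ k / (k + 1) := by
          have : (k : ℝ) / (k + 1) = 1 - 1 / (k + 1) := by field_simp; ring
          linarith
        calc deficitConst (k + 1) * (1 - x) ≤ deficitConst (k + 1) * (k / (k + 1)) :=
              mul_le_mul_of_nonneg_left h1 hnn
          _ ≤ deficitConst k := by
              rw [← mul_div_assoc, div_le_iff₀ (by positivity)]
              exact h
      rw [hent, hsq, ← hx]
      have hbin := Real.binEntropy_eq_negMulLog_add_negMulLog_one_sub x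
      have h1 : (1 - x) * ∑ j ∈ T, Real.negMulLog (q j) ≤
          (1 - x) * (Real.log k - deficitConst k * (s - 1 / k)) :=
        mul_le_mul_of_nonneg_left hih hpos.le
      have h2 : deficitConst (k + 1) * (1 - x) * ((1 - x) * (s - 1 / k)) ≤
          deficitConst k * ((1 - x) * (s - 1 / k)) :=
        mul_le_mul_of_nonneg_right hγ (mul_nonneg hpos.le hs1)
      have h3 : deficitConst (k + 1) * (x ^ 2 + (1 - x) ^ 2 * s - 1 / (k + 1)) =
          deficitConst (k + 1) * (x ^ 2 + (1 - x) ^ 2 / k - 1 / (k + 1)) +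
            deficitConst (k + 1) * (1 - x) * ((1 - x) * (s - 1 / k)) := by
        ring
      rw [h3]
      linarith

lemma exists_perm_comp_eq {α ι : Type*} [Fintype α] [DecidableEq α] [Fintype ι] [DecidableEq ι] (f f₀ : α → ι)
    (h : ∀ i, (univ.filter fun v => f v = i).card = (univ.filter fun v => f₀ v = i).card) :
    ∃ g : Equiv.Perm α, f₀ ∘ g = f := by
  have e : ∀ i, Nonempty ({v // f v = i} ≃ {v // f₀ v = i}) := fun i =>
    ⟨Fintype.equivOfCardEq (by rw [Fintype.card_subtype, Fintype.card_subtype, h i])⟩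
  refine ⟨(Equiv.sigmaFiberEquiv f).symm.trans
    ((Equiv.sigmaCongrRight fun i => (e i).some).trans (Equiv.sigmaFiberEquiv f₀)), ?_⟩
  ext v
  exact ((e (f v)).some ⟨v, rfl⟩).2

/-- The number of maps with prescribed fiber cardinalities is a multinomial coefficient. -/
lemma card_filter_fiber_card_mul_prod_factorial {α ι : Type*} [Fintype α] [DecidableEq α] [Fintype ι] [DecidableEq ι]
    (a : ι → ℕ) (f₀ : α → ι) (h₀ : ∀ i, (univ.filter fun v => f₀ v = i).card = a i) :
    (univ.filter fun f : α → ι => ∀ i, (univ.filter fun v => f v = i).card = a i).card *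
      ∏ i, (a i).factorial = (Fintype.card α).factorial := by
  rw [← Fintype.card_perm, ← Finset.card_univ (α := Equiv.Perm α), ← smul_eq_mul,
    ← Finset.sum_const]
  rw [card_eq_sum_card_fiberwise (f := fun g : Equiv.Perm α => f₀ ∘ g)
    (t := univ.filter fun f : α → ι => ∀ i, (univ.filter fun v => f v = i).card = a i)]
  · refine sum_congr rfl fun f hf => ?_
    obtain ⟨g₀, rfl⟩ := exists_perm_comp_eq f f₀
      (fun i => by rw [(mem_filter.mp hf).2 i, h₀ i])
    have hstab := DomMulAct.stabilizer_card f₀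
    simp only [Fintype.card_subtype, h₀] at hstab
    rw [← hstab]
    refine card_bij (fun g _ => g * g₀) ?_ ?_ ?_
    · intro g hg
      simp only [mem_filter, mem_univ, true_and] at hg ⊢
      rw [Equiv.Perm.coe_mul, ← Function.comp_assoc, hg]
    · intro g _ g' _ h
      exact mul_right_cancel h
    · intro g hg
      simp only [mem_filter, mem_univ, true_and] at hg
      refine ⟨g * g₀⁻¹, ?_, by simp⟩
      simp only [mem_filter, mem_univ, true_and]
      rw [Equiv.Perm.coe_mul, ← Function.comp_assoc, hg, Function.comp_assoc,
        ← Equiv.Perm.coe_mul, mul_inv_cancel, Equiv.Perm.coe_one, Function.comp_id]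
  · intro g _
    simp only [coe_filter, mem_univ, true_and, Set.mem_ofPred_eq]
    intro i
    rw [← h₀ i]
    refine card_bij (fun v _ => g v) (by simp) (fun _ _ _ _ h => g.injective h) ?_
    intro v hv
    exact ⟨g⁻¹ v, by simpa using hv, by simp⟩

lemma card_filter_fiber_card_mul_prod_factorial_le {α ι : Type*} [Fintype α] [DecidableEq α] [Fintype ι] [DecidableEq ι]
    (a : ι → ℕ) :
    (univ.filter fun f : α → ι => ∀ i, (univ.filter fun v => f v = i).card = a i).card *
      ∏ i, (a i).factorial ≤ (Fintype.card α).factorial := by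
  rcases (univ.filter fun f : α → ι =>
    ∀ i, (univ.filter fun v => f v = i).card = a i).eq_empty_or_nonempty with h | ⟨f₀, h⟩
  · rw [h]; simp
  · exact (card_filter_fiber_card_mul_prod_factorial a f₀ (mem_filter.mp h).2).le

lemma card_balanced_mul (k N : ℕ) :
    (univ.filter fun σ : Fin (k * N) → Fin k =>
      ∀ c, (univ.filter fun v => σ v = c).card = N).card * N.factorial ^ k =
      (k * N).factorial := by
  have h := card_filter_fiber_card_mul_prod_factorial (α := Fin (k * N)) (fun _ : Fin k => N)
    (fun v => (finProdFinEquiv.symm v).1) ?_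
  · simp only [prod_const, card_univ, Fintype.card_fin] at h
    convert h
  · intro i
    refine Eq.trans ?_ (Finset.card_fin N)
    refine (card_bij (fun j _ => finProdFinEquiv (i, j)) ?_ ?_ ?_).symm
    · intro j _
      rw [mem_filter, Equiv.symm_apply_apply]
      exact ⟨mem_univ _, rfl⟩
    · intro j _ j' _ h
      simpa using h
    · intro v hv
      refine ⟨(finProdFinEquiv.symm v).2, mem_univ _, ?_⟩
      have hv' := (mem_filter.mp hv).2
      subst hv'
      exact finProdFinEquiv.apply_symm_apply v

lemma natCast_div_exp_one_pow (a : ℕ) :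
    ((a : ℝ) / Real.exp 1) ^ a = Real.exp (a * Real.log a - a) := by
  rcases Nat.eq_zero_or_pos a with rfl | ha
  · simp
  · have ha' : (0 : ℝ) < a := by exact_mod_cast ha
    rw [Real.exp_sub, mul_comm (a : ℝ), Real.exp_mul, Real.exp_log ha', Real.rpow_natCast, div_pow,
      ← Real.exp_nat_mul, mul_one]

lemma factorial_le_exp_mul_sqrt {n : ℕ} (hn : 1 ≤ n) :
    (n.factorial : ℝ) ≤ Real.exp 1 * √n * Real.exp (n * Real.log n - n) := by
  have h : Stirling.stirlingSeq n ≤ Stirling.stirlingSeq 1 := by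
    have := Stirling.stirlingSeq'_antitone (Nat.zero_le (n - 1))
    simpa [Nat.sub_add_cancel hn] using this
  have hn' : (0 : ℝ) < n := by exact_mod_cast hn
  rw [Stirling.stirlingSeq_one, Stirling.stirlingSeq, natCast_div_exp_one_pow,
    div_le_iff₀ (by positivity)] at h
  refine h.trans_eq ?_
  rw [Real.sqrt_mul (by norm_num)]
  field_simp

lemma sqrt_mul_exp_le_factorial (a : ℕ) :
    √((a : ℝ) + 1) * Real.exp (a * Real.log a - a) ≤ a.factorial := by
  rcases Nat.eq_zero_or_pos a with rfl | ha
  · simp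
  · have ha' : (1 : ℝ) ≤ a := by exact_mod_cast ha
    refine le_trans ?_ (Stirling.le_factorial_stirling a)
    rw [natCast_div_exp_one_pow]
    gcongr
    nlinarith [Real.pi_gt_three]

/-- A Gaussian weight of variance of order `N` compensates for a small `a`. -/
lemma exists_exp_neg_sq_mul_le {k ε : ℝ} (hk : 0 < k) (hε : 0 < ε) :
    ∃ C : ℝ, 0 < C ∧ ∀ N a : ℕ, 1 ≤ N →
      Real.exp (-ε * ((a : ℝ) - N / k) ^ 2 / N) / √((a : ℝ) + 1) ≤ C / √N := by
  set D : ℝ := 2 * k + 2 * k ^ 2 / ε with hD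
  have hDpos : 0 < D := by positivity
  refine ⟨√D, by positivity, fun N a hN => ?_⟩
  have hN' : (1 : ℝ) ≤ N := by exact_mod_cast hN
  have hN0 : (0 : ℝ) < N := by linarith
  have ha : (0 : ℝ) ≤ a := Nat.cast_nonneg a
  set u : ℝ := (a : ℝ) - N / k with hu
  have key : (N : ℝ) ≤ D * (a + 1) * Real.exp (2 * ε * u ^ 2 / N) := by
    have hexp : 1 + 2 * ε * u ^ 2 / N ≤ Real.exp (2 * ε * u ^ 2 / N) := by
      linarith [Real.add_one_le_exp (2 * ε * u ^ 2 / N)]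
    rcases le_total ((N : ℝ) / (2 * k)) a with h | h
    · rw [div_le_iff₀ (by positivity)] at h
      calc (N : ℝ) ≤ 2 * k * (a + 1) * 1 := by nlinarith
        _ ≤ D * (a + 1) * Real.exp (2 * ε * u ^ 2 / N) := by
          gcongr
          · rw [hD]; linarith [show 0 ≤ 2 * k ^ 2 / ε by positivity]
          · linarith [show 0 ≤ 2 * ε * u ^ 2 / N by positivity]
    · have hu2 : (N / (2 * k)) ^ 2 ≤ u ^ 2 := by
        have : (N : ℝ) / k = 2 * (N / (2 * k)) := by field_simp
        rw [hu, this]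
        have h0 : 0 ≤ (N : ℝ) / (2 * k) := by positivity
        nlinarith
      calc (N : ℝ) = 2 * k ^ 2 / ε * 1 * (2 * ε * (N / (2 * k)) ^ 2 / N) := by field_simp
        _ ≤ D * (a + 1) * Real.exp (2 * ε * u ^ 2 / N) := by
          gcongr
          · rw [hD]; linarith
          · linarith
          · refine le_trans ?_ (le_trans (le_add_of_nonneg_left zero_le_one) hexp)
            gcongr
  rw [div_le_div_iff₀ (by positivity) (by positivity)]
  have hsq : Real.exp (-ε * u ^ 2 / N) = 1 / √(Real.exp (2 * ε * u ^ 2 / N)) := by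
    rw [show 2 * ε * u ^ 2 / N = ε * u ^ 2 / N + ε * u ^ 2 / N by ring, Real.exp_add,
      Real.sqrt_mul_self (Real.exp_pos _).le, one_div, ← Real.exp_neg]
    congr 1
    ring
  rw [hsq, one_div_mul_eq_div, div_le_iff₀ (by positivity), ← Real.sqrt_mul hDpos.le,
    ← Real.sqrt_mul (by positivity)]
  exact Real.sqrt_le_sqrt key

/-- A discrete Gaussian sum of variance of order `N` is `O(√N)`, uniformly in the center. -/
lemma exists_sum_exp_neg_sq_le {ε : ℝ} (hε : 0 < ε) :
    ∃ C : ℝ, 0 < C ∧ ∀ (N M : ℕ) (t : ℝ), 1 ≤ N → 0 ≤ t →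
      ∑ a ∈ range M, Real.exp (-ε * ((a : ℝ) - t) ^ 2 / N) ≤ C * √N := by
  refine ⟨Real.exp ε * (2 * (1 + 1 / (2 * ε))), by positivity, fun N M t hN ht => ?_⟩
  have hs1 : 1 ≤ √(N : ℝ) := by
    rw [Real.one_le_sqrt]
    exact_mod_cast hN
  have hss : √(N : ℝ) * √N = N := Real.mul_self_sqrt (Nat.cast_nonneg N)
  set s := √(N : ℝ) with hs
  have hs0 : 0 < s := by linarith
  set r := Real.exp (-(2 * ε / s)) with hr
  have hr0 : 0 < r := Real.exp_pos _
  have hr1 : r < 1 := by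
    rw [hr, Real.exp_lt_one_iff, neg_lt_zero]
    positivity
  have hrbd : 1 / (1 - r) ≤ (1 + 1 / (2 * ε)) * s := by
    have h1 : 1 + 2 * ε / s ≤ 1 / r := by
      rw [hr, one_div, ← Real.exp_neg, neg_neg]
      linarith [Real.add_one_le_exp (2 * ε / s)]
    rw [le_div_iff₀ hr0] at h1
    have h2 : (1 + 2 * ε / s) * (1 - r) ≥ 2 * ε / s := by linarith
    have h3 : 1 / (1 - r) ≤ (1 + 2 * ε / s) / (2 * ε / s) := by
      rw [div_le_div_iff₀ (by linarith) (by positivity)]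
      linarith
    refine h3.trans ?_
    have : (1 + 2 * ε / s) / (2 * ε / s) = 1 + s / (2 * ε) := by field_simp; ring
    rw [this, add_mul, one_mul, one_div_mul_eq_div]
    linarith
  have hgeo : ∀ m, ∑ b ∈ range m, r ^ b ≤ 1 / (1 - r) := by
    intro m
    rw [one_div, ← tsum_geometric_of_lt_one hr0.le hr1]
    exact (summable_geometric_of_lt_one hr0.le hr1).sum_le_tsum _ (fun _ _ => by positivity)
  have hpt : ∀ (a b : ℕ), (b : ℝ) ≤ |(a : ℝ) - t| →
      Real.exp (-ε * ((a : ℝ) - t) ^ 2 / N) ≤ Real.exp ε * r ^ b := by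
    intro a b hb
    rw [hr, ← Real.exp_nat_mul, ← Real.exp_add, Real.exp_le_exp, ← hss, ← sq_abs]
    have hb0 : (0 : ℝ) ≤ b := Nat.cast_nonneg b
    set v := |(a : ℝ) - t|
    have : -ε * v ^ 2 / (s * s) ≤ ε - 2 * ε * (v / s) := by
      have : -ε * v ^ 2 / (s * s) = -ε * (v / s) ^ 2 := by field_simp
      rw [this]
      nlinarith [mul_nonneg hε.le (sq_nonneg (v / s - 1))]
    refine this.trans ?_
    have h2 : ε * ((b : ℝ) / s) ≤ ε * (v / s) := by gcongr
    have : (b : ℝ) * -(2 * ε / s) = -2 * (ε * (b / s)) := by ring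
    rw [this]
    linarith
  set T := ⌊t⌋₊ with hT
  have hT1 : (T : ℝ) ≤ t := Nat.floor_le ht
  have hT2 : t < T + 1 := Nat.lt_floor_add_one t
  have hlow : ∑ a ∈ range (T + 1), Real.exp (-ε * ((a : ℝ) - t) ^ 2 / N) ≤
      Real.exp ε * (1 / (1 - r)) := by
    rw [← sum_range_reflect]
    refine le_trans (sum_le_sum (g := fun b => Real.exp ε * r ^ b) fun b hb => hpt _ _ ?_) ?_
    · have hbT : b ≤ T := by simpa [Nat.lt_succ_iff] using hb
      rw [show T + 1 - 1 - b = T - b by omega, Nat.cast_sub hbT, abs_sub_comm]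
      exact le_trans (by linarith) (le_abs_self _)
    · rw [← mul_sum]
      exact mul_le_mul_of_nonneg_left (hgeo _) (Real.exp_pos _).le
  have hhigh : ∑ b ∈ range M, Real.exp (-ε * (((T + 1 + b : ℕ) : ℝ) - t) ^ 2 / N) ≤
      Real.exp ε * (1 / (1 - r)) := by
    refine le_trans (sum_le_sum (g := fun b => Real.exp ε * r ^ b) fun b _ => hpt _ _ ?_) ?_
    · push_cast
      exact le_trans (by linarith) (le_abs_self _)
    · rw [← mul_sum]
      exact mul_le_mul_of_nonneg_left (hgeo _) (Real.exp_pos _).le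
  calc ∑ a ∈ range M, Real.exp (-ε * ((a : ℝ) - t) ^ 2 / N)
      ≤ ∑ a ∈ range (T + 1 + M), Real.exp (-ε * ((a : ℝ) - t) ^ 2 / N) :=
        sum_le_sum_of_subset_of_nonneg (range_mono (by omega)) (fun _ _ _ => (Real.exp_pos _).le)
    _ ≤ Real.exp ε * (1 / (1 - r)) + Real.exp ε * (1 / (1 - r)) := by
        rw [sum_range_add]
        exact add_le_add hlow hhigh
    _ ≤ Real.exp ε * ((1 + 1 / (2 * ε)) * s) + Real.exp ε * ((1 + 1 / (2 * ε)) * s) := by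
        gcongr
    _ = Real.exp ε * (2 * (1 + 1 / (2 * ε))) * s := by ring

/-- A matrix with prescribed row and column sums is determined by its entries outside the last row
and the last column. -/
lemma sum_prod_le_pow_of_line_sums {K N : ℕ} (𝒜 : Finset (Fin (K + 1) × Fin (K + 1) → ℕ))
    (hrow : ∀ A ∈ 𝒜, ∀ i, ∑ j, A (i, j) = N) (hcol : ∀ A ∈ 𝒜, ∀ j, ∑ i, A (i, j) = N)
    (g : ℕ → ℝ) (hg0 : ∀ a, 0 ≤ g a) (hg1 : ∀ a, g a ≤ 1) :
    ∑ A ∈ 𝒜, ∏ x, g (A x) ≤ (∑ a ∈ range (N + 1), g a) ^ (K * K) := by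
  set res : (Fin (K + 1) × Fin (K + 1) → ℕ) → (Fin K × Fin K → ℕ) :=
    fun A x => A (x.1.castSucc, x.2.castSucc) with hres
  have hinj : Set.InjOn res 𝒜 := by
    intro A hA B hB hAB
    have hblock : ∀ i j : Fin K, A (i.castSucc, j.castSucc) = B (i.castSucc, j.castSucc) :=
      fun i j => congrFun hAB (i, j)
    have htop : ∀ (i : Fin K) (j : Fin (K + 1)), A (i.castSucc, j) = B (i.castSucc, j) := by
      intro i j
      refine Fin.lastCases ?_ (fun j => hblock i j) j
      have h1 := hrow A hA i.castSucc
      have h2 := hrow B hB i.castSucc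
      rw [Fin.sum_univ_castSucc] at h1 h2
      rw [sum_congr rfl fun j _ => hblock i j] at h1
      omega
    ext ⟨i, j⟩
    refine Fin.lastCases ?_ (fun i => htop i j) i
    have h1 := hcol A hA j
    have h2 := hcol B hB j
    rw [Fin.sum_univ_castSucc] at h1 h2
    rw [sum_congr rfl fun i _ => htop i j] at h1
    omega
  have hemb : Function.Injective
      (fun x : Fin K × Fin K => ((x.1.castSucc, x.2.castSucc) : Fin (K + 1) × Fin (K + 1))) := by
    rintro ⟨a, b⟩ ⟨c, d⟩ h
    simpa using h
  calc ∑ A ∈ 𝒜, ∏ x, g (A x) ≤ ∑ A ∈ 𝒜, ∏ x, g (res A x) := by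
        refine sum_le_sum fun A _ => ?_
        have h := prod_image (s := univ) (f := fun x => g (A x)) (hemb.injOn)
        rw [← h]
        exact prod_le_prod_of_subset_of_le_one (subset_univ _) (fun _ _ => hg0 _)
          (fun _ _ _ => hg1 _)
    _ = ∑ B ∈ 𝒜.image res, ∏ x, g (B x) := by
        rw [sum_image hinj]
    _ ≤ ∑ B ∈ Fintype.piFinset fun _ : Fin K × Fin K => range (N + 1), ∏ x, g (B x) := by
        refine sum_le_sum_of_subset_of_nonneg ?_ fun _ _ _ => prod_nonneg fun _ _ => hg0 _
        intro B hB
        obtain ⟨A, hA, rfl⟩ := mem_image.mp hB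
        rw [Fintype.mem_piFinset]
        intro x
        rw [mem_range, Nat.lt_succ_iff, ← hrow A hA x.1.castSucc]
        exact single_le_sum (f := fun j => A (x.1.castSucc, j)) (fun _ _ => Nat.zero_le _)
          (mem_univ _)
    _ = (∑ a ∈ range (N + 1), g a) ^ (K * K) := by
        rw [sum_prod_piFinset]
        simp

/-- The squared Euclidean distance of the overlap matrix `A / N` from the uniform one. -/
noncomputable def overlapDist (k N : ℕ) (A : Fin k × Fin k → ℕ) : ℝ :=
  ∑ x, ((A x : ℝ) / N - 1 / k) ^ 2

lemma overlapDist_nonneg (k N : ℕ) (A : Fin k × Fin k → ℕ) : 0 ≤ overlapDist k N A :=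
  sum_nonneg fun _ _ => sq_nonneg _

lemma neg_sum_mul_log_le {k N : ℕ} (hk : 1 ≤ k) (hN : 1 ≤ N) (A : Fin k × Fin k → ℕ)
    (hrow : ∀ i, ∑ j, A (i, j) = N) :
    -∑ x, (A x : ℝ) * Real.log (A x) ≤
      k * N * (Real.log k - Real.log N) - deficitConst k * N * overlapDist k N A := by
  have hk0 : (0 : ℝ) < k := by exact_mod_cast hk
  have hN0 : (0 : ℝ) < N := by exact_mod_cast hN
  have hper : ∀ i, -∑ j, (A (i, j) : ℝ) * Real.log (A (i, j)) ≤
      N * (Real.log k - Real.log N) -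
        deficitConst k * N * ∑ j, ((A (i, j) : ℝ) / N - 1 / k) ^ 2 := by
    intro i
    have hrow' : ∑ j, (A (i, j) : ℝ) = N := by exact_mod_cast hrow i
    have hsum : ∑ j, (A (i, j) : ℝ) / N = 1 := by rw [← sum_div, hrow', div_self hN0.ne']
    have h := sum_negMulLog_le hk univ (Finset.card_fin k) (fun j => (A (i, j) : ℝ) / N)
      (fun j _ => by positivity) hsum
    have hsq : ∑ j, ((A (i, j) : ℝ) / N - 1 / k) ^ 2 = ∑ j, ((A (i, j) : ℝ) / N) ^ 2 - 1 / k := by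
      simp only [sub_sq, sum_add_distrib, sum_sub_distrib, ← sum_mul, ← mul_sum, hsum, sum_const,
        Finset.card_fin, nsmul_eq_mul]
      field_simp
      ring
    have hlog : ∀ j, (A (i, j) : ℝ) * Real.log (A (i, j)) =
        A (i, j) * Real.log N - N * Real.negMulLog ((A (i, j) : ℝ) / N) := by
      intro j
      rcases Nat.eq_zero_or_pos (A (i, j)) with h0 | h0
      · simp [h0]
      · have h0' : (A (i, j) : ℝ) ≠ 0 := by exact_mod_cast h0.ne'
        rw [Real.negMulLog, Real.log_div h0' hN0.ne']
        field_simp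
        ring
    rw [sum_congr rfl fun j _ => hlog j, sum_sub_distrib, ← sum_mul, ← mul_sum, hrow', hsq]
    nlinarith [mul_le_mul_of_nonneg_left h hN0.le]
  rw [overlapDist, Fintype.sum_prod_type, Fintype.sum_prod_type]
  calc -∑ i, ∑ j, (A (i, j) : ℝ) * Real.log (A (i, j))
      = ∑ i, -∑ j, (A (i, j) : ℝ) * Real.log (A (i, j)) := by rw [sum_neg_distrib]
    _ ≤ ∑ i, (N * (Real.log k - Real.log N) -
        deficitConst k * N * ∑ j, ((A (i, j) : ℝ) / N - 1 / k) ^ 2) :=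
        sum_le_sum fun i _ => hper i
    _ = _ := by
        rw [sum_sub_distrib, sum_const, Finset.card_fin, nsmul_eq_mul, ← mul_sum]
        ring

lemma factorial_div_prod_factorial_le {k N : ℕ} (hk : 1 ≤ k) (hN : 1 ≤ N)
    (A : Fin k × Fin k → ℕ) (hrow : ∀ i, ∑ j, A (i, j) = N) :
    ((k * N).factorial : ℝ) / ∏ x, ((A x).factorial : ℝ) ≤
      Real.exp 1 * √(k * N) * (k : ℝ) ^ (2 * (k * N)) *
        (Real.exp (-deficitConst k * N * overlapDist k N A) * ∏ x, (1 / √((A x : ℝ) + 1))) := by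
  have hk0 : (0 : ℝ) < k := by exact_mod_cast hk
  have hN0 : (0 : ℝ) < N := by exact_mod_cast hN
  have hupper := factorial_le_exp_mul_sqrt (n := k * N) (Nat.mul_pos hk hN)
  have hlower : (∏ x, √((A x : ℝ) + 1)) * Real.exp (∑ x, (A x * Real.log (A x) - A x)) ≤
      ∏ x, ((A x).factorial : ℝ) := by
    rw [Real.exp_sum, ← prod_mul_distrib]
    exact prod_le_prod (fun _ _ => by positivity) fun x _ => sqrt_mul_exp_le_factorial (A x)
  have htotal : ∑ x, (A x : ℝ) = k * N := by
    have : ∑ x, A x = k * N := by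
      rw [Fintype.sum_prod_type, sum_congr rfl fun i _ => hrow i]
      simp
    exact_mod_cast this
  have hent := neg_sum_mul_log_le hk hN A hrow
  have hprod : 0 < ∏ x, √((A x : ℝ) + 1) := prod_pos fun _ _ => by positivity
  push_cast at hupper
  calc ((k * N).factorial : ℝ) / ∏ x, ((A x).factorial : ℝ)
      ≤ (Real.exp 1 * √(k * N) * Real.exp (k * N * Real.log (k * N) - k * N)) /
          ((∏ x, √((A x : ℝ) + 1)) * Real.exp (∑ x, (A x * Real.log (A x) - A x))) := by
        gcongr
    _ = Real.exp 1 * √(k * N) * (Real.exp (k * N * (Real.log k + Real.log N) +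
          -∑ x, (A x : ℝ) * Real.log (A x)) * ∏ x, (1 / √((A x : ℝ) + 1))) := by
        rw [sum_sub_distrib, htotal, Real.log_mul hk0.ne' hN0.ne', prod_div_distrib,
          prod_const_one]
        have hexp : Real.exp (k * N * (Real.log k + Real.log N) +
            -∑ x, (A x : ℝ) * Real.log (A x)) =
            Real.exp (k * N * (Real.log k + Real.log N) - k * N) /
              Real.exp (∑ x, (A x : ℝ) * Real.log (A x) - k * N) := by
          rw [← Real.exp_sub]
          congr 1
          ring
        rw [hexp]
        ring
    _ ≤ Real.exp 1 * √(k * N) * (Real.exp (2 * (k * N) * Real.log k +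
          -deficitConst k * N * overlapDist k N A) * ∏ x, (1 / √((A x : ℝ) + 1))) := by
        gcongr ?_ * (Real.exp ?_ * ?_)
        linarith
    _ = _ := by
        rw [Real.exp_add, show (2 : ℝ) * (k * N) * Real.log k =
          ((2 * (k * N) : ℕ) : ℝ) * Real.log k by push_cast; ring, Real.exp_nat_mul,
          Real.exp_log hk0]
        ring

lemma exists_factorial_term_le {k : ℕ} (hk : 1 ≤ k) {κ : ℝ} (hκ : κ < deficitConst k) :
    ∃ C ε : ℝ, 0 < C ∧ 0 < ε ∧ ∀ (N : ℕ) (A : Fin k × Fin k → ℕ), 1 ≤ N →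
      (∀ i, ∑ j, A (i, j) = N) →
      ((k * N).factorial : ℝ) / (∏ x, ((A x).factorial : ℝ)) *
          Real.exp (κ * N * overlapDist k N A) ≤
        C * (k : ℝ) ^ (2 * (k * N)) * (√N / √N ^ (k * k)) *
          ∏ x, Real.exp (-ε * ((A x : ℝ) - N / k) ^ 2 / N) := by
  have hk0 : (0 : ℝ) < k := by exact_mod_cast hk
  set ε : ℝ := (deficitConst k - κ) / 2 with hε
  have hε0 : 0 < ε := by rw [hε]; linarith
  obtain ⟨C₁, hC₁, hcoord⟩ := exists_exp_neg_sq_mul_le hk0 hε0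
  refine ⟨Real.exp 1 * √k * C₁ ^ (k * k), ε, by positivity, hε0, fun N A hN hrow => ?_⟩
  have hN0 : (0 : ℝ) < N := by exact_mod_cast hN
  set g : Fin k × Fin k → ℝ := fun x => Real.exp (-ε * ((A x : ℝ) - N / k) ^ 2 / N) with hg
  have hgprod : Real.exp (-ε * N * overlapDist k N A) = ∏ x, g x := by
    rw [overlapDist, mul_sum, Real.exp_sum]
    refine prod_congr rfl fun x _ => ?_
    rw [hg]
    congr 1
    field_simp
  calc ((k * N).factorial : ℝ) / (∏ x, ((A x).factorial : ℝ)) *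
          Real.exp (κ * N * overlapDist k N A)
      ≤ (Real.exp 1 * √(k * N) * (k : ℝ) ^ (2 * (k * N)) *
        (Real.exp (-deficitConst k * N * overlapDist k N A) * ∏ x, (1 / √((A x : ℝ) + 1)))) *
          Real.exp (κ * N * overlapDist k N A) := by
        gcongr
        exact factorial_div_prod_factorial_le hk hN A hrow
    _ = Real.exp 1 * √(k * N) * (k : ℝ) ^ (2 * (k * N)) *
        ((∏ x, g x / √((A x : ℝ) + 1)) * ∏ x, g x) := by
        have : Real.exp (-deficitConst k * N * overlapDist k N A) *
            Real.exp (κ * N * overlapDist k N A) = (∏ x, g x) * ∏ x, g x := by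
          rw [← hgprod, ← Real.exp_add, ← Real.exp_add]
          congr 1
          rw [hε]
          ring
        rw [prod_div_distrib, prod_div_distrib, prod_const_one]
        linear_combination (Real.exp 1 * √(k * N) * (k : ℝ) ^ (2 * (k * N)) *
          (1 / ∏ x, √((A x : ℝ) + 1))) * this
    _ ≤ Real.exp 1 * √(k * N) * (k : ℝ) ^ (2 * (k * N)) *
        ((∏ _x : Fin k × Fin k, C₁ / √N) * ∏ x, g x) := by
        refine mul_le_mul_of_nonneg_left (mul_le_mul_of_nonneg_right
          (prod_le_prod (fun _ _ => by positivity) fun x _ => hcoord N (A x) hN)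
          (prod_nonneg fun _ _ => (Real.exp_pos _).le)) (by positivity)
    _ = _ := by
        rw [prod_const, card_univ, Fintype.card_prod, Fintype.card_fin, div_pow,
          Real.sqrt_mul hk0.le]
        ring

/-- The number of balanced maps is of order `k ^ n / n ^ ((k - 1) / 2)`. -/
lemma le_card_balanced {k N : ℕ} (hk : 1 ≤ k) (hN : 1 ≤ N) :
    Real.exp (-k) * (k : ℝ) ^ (k * N) / √N ^ (k - 1) ≤
      ((univ.filter fun σ : Fin (k * N) → Fin k =>
        ∀ c, (univ.filter fun v => σ v = c).card = N).card : ℝ) := by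
  have hk0 : (0 : ℝ) < k := by exact_mod_cast hk
  have hk1 : (1 : ℝ) ≤ k := by exact_mod_cast hk
  have hN0 : (0 : ℝ) < N := by exact_mod_cast hN
  have hs : 0 < √(N : ℝ) := by positivity
  have hcard := card_balanced_mul k N
  generalize (univ.filter fun σ : Fin (k * N) → Fin k =>
    ∀ c, (univ.filter fun v => σ v = c).card = N).card = B at hcard ⊢
  have hcard' : (B : ℝ) * (N.factorial : ℝ) ^ k = (k * N).factorial := by exact_mod_cast hcard
  have hlow := sqrt_mul_exp_le_factorial (k * N)
  have hup := factorial_le_exp_mul_sqrt hN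
  have hf : (0 : ℝ) < N.factorial := by exact_mod_cast N.factorial_pos
  refine le_of_mul_le_mul_right ?_ (pow_pos hf k)
  rw [hcard']
  refine le_trans ?_ hlow
  calc Real.exp (-k) * (k : ℝ) ^ (k * N) / √N ^ (k - 1) * (N.factorial : ℝ) ^ k
      ≤ Real.exp (-k) * (k : ℝ) ^ (k * N) / √N ^ (k - 1) *
          (Real.exp 1 * √N * Real.exp (N * Real.log N - N)) ^ k := by gcongr
    _ = √N * Real.exp ((k * N : ℕ) * Real.log (k * N : ℕ) - (k * N : ℕ)) := by
        have hpow : √(N : ℝ) ^ k = √N ^ (k - 1) * √N := by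
          rw [← pow_succ, Nat.sub_add_cancel hk]
        have hkpow : Real.exp (((k * N : ℕ) : ℝ) * Real.log k) = (k : ℝ) ^ (k * N) := by
          rw [Real.exp_nat_mul, Real.exp_log hk0]
        rw [mul_pow, mul_pow, ← Real.exp_nat_mul, ← Real.exp_nat_mul, hpow]
        push_cast
        rw [Real.log_mul hk0.ne' hN0.ne',
          show (k : ℝ) * N * (Real.log k + Real.log N) - k * N =
            -k + ((k * N : ℕ) : ℝ) * Real.log k + k * 1 + k * (N * Real.log N - N) by
              push_cast; ring, Real.exp_add, Real.exp_add, Real.exp_add, hkpow]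
        field_simp
    _ ≤ _ := by
        gcongr
        push_cast
        nlinarith

/-- The maps from `k * N` points to `k` colors that use each color exactly `N` times. -/
noncomputable def balancedMaps (k N : ℕ) : Finset (Fin (k * N) → Fin k) :=
  univ.filter fun σ => ∀ c, (univ.filter fun v => σ v = c).card = N

lemma mem_balancedMaps {k N : ℕ} {σ : Fin (k * N) → Fin k} :
    σ ∈ balancedMaps k N ↔ ∀ c, (univ.filter fun v => σ v = c).card = N := by
  simp [balancedMaps]

/-- The number of points to which `σ` and `τ` assign a given pair of colors. -/
noncomputable def overlap {n k : ℕ} (σ τ : Fin n → Fin k) (x : Fin k × Fin k) : ℕ :=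
  (univ.filter fun v => (σ v, τ v) = x).card

lemma sum_overlap_right {n k : ℕ} (σ τ : Fin n → Fin k) (i : Fin k) :
    ∑ j, overlap σ τ (i, j) = (univ.filter fun v => σ v = i).card := by
  rw [card_eq_sum_card_fiberwise (f := τ) (t := univ) (fun _ _ => by simp)]
  refine sum_congr rfl fun j _ => ?_
  simp only [overlap, filter_filter, Prod.mk.injEq]

lemma sum_overlap_left {n k : ℕ} (σ τ : Fin n → Fin k) (j : Fin k) :
    ∑ i, overlap σ τ (i, j) = (univ.filter fun v => τ v = j).card := by
  rw [card_eq_sum_card_fiberwise (f := σ) (t := univ) (fun _ _ => by simp)]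
  refine sum_congr rfl fun i _ => ?_
  simp only [overlap, filter_filter, Prod.mk.injEq, and_comm]

lemma card_overlap_eq_le {n k : ℕ} (S : Finset ((Fin n → Fin k) × (Fin n → Fin k)))
    (A : Fin k × Fin k → ℕ) :
    ((S.filter fun p => overlap p.1 p.2 = A).card : ℝ) ≤
      (n.factorial : ℝ) / ∏ x, ((A x).factorial : ℝ) := by
  have h := card_filter_fiber_card_mul_prod_factorial_le (α := Fin n) A
  rw [Fintype.card_fin] at h
  have hle : (S.filter fun p => overlap p.1 p.2 = A).card ≤
      (univ.filter fun f : Fin n → Fin k × Fin k =>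
        ∀ x, (univ.filter fun v => f v = x).card = A x).card := by
    refine card_le_card_of_injOn (fun p v => (p.1 v, p.2 v)) ?_ ?_
    · intro p hp
      have hp' := (mem_filter.mp hp).2
      simp only [coe_filter, mem_univ, true_and, Set.mem_ofPred_eq]
      exact fun x => congrFun hp' x
    · rintro ⟨σ, τ⟩ _ ⟨σ', τ'⟩ _ heq
      have h' : ∀ v, σ v = σ' v ∧ τ v = τ' v := fun v => Prod.mk.inj (congrFun heq v)
      exact Prod.ext (funext fun v => (h' v).1) (funext fun v => (h' v).2)
  have hpos : (0 : ℝ) < ∏ x, ((A x).factorial : ℝ) :=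
    prod_pos fun x _ => by exact_mod_cast (A x).factorial_pos
  rw [le_div_iff₀ hpos]
  exact_mod_cast (Nat.mul_le_mul_right _ hle).trans h

lemma exists_sum_exp_overlapDist_le {k : ℕ} (hk : 1 ≤ k) {κ : ℝ} (hκ : κ < deficitConst k) :
    ∃ C : ℝ, 0 < C ∧ ∀ N : ℕ, 1 ≤ N →
      ∑ p ∈ balancedMaps k N ×ˢ balancedMaps k N,
          Real.exp (κ * N * overlapDist k N (overlap p.1 p.2)) ≤
        C * ((balancedMaps k N).card : ℝ) ^ 2 := by
  obtain ⟨C₁, ε, hC₁, hε, hterm⟩ := exists_factorial_term_le hk hκ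
  obtain ⟨C₂, hC₂, hgauss⟩ := exists_sum_exp_neg_sq_le hε
  obtain ⟨K, rfl⟩ : ∃ K, k = K + 1 := ⟨k - 1, by omega⟩
  refine ⟨C₁ * C₂ ^ (K * K) * Real.exp (K + 1) ^ 2, by positivity, fun N hN => ?_⟩
  have hN0 : (0 : ℝ) < N := by exact_mod_cast hN
  have hs : 0 < √(N : ℝ) := by positivity
  set S := balancedMaps (K + 1) N ×ˢ balancedMaps (K + 1) N with hS
  set 𝒜 := S.image fun p => overlap p.1 p.2 with h𝒜
  set g : ℕ → ℝ := fun a => Real.exp (-ε * ((a : ℝ) - N / (K + 1 : ℕ)) ^ 2 / N) with hg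
  have hrow : ∀ A ∈ 𝒜, ∀ i, ∑ j, A (i, j) = N := by
    intro A hA i
    obtain ⟨p, hp, rfl⟩ := mem_image.mp hA
    rw [sum_overlap_right]
    exact mem_balancedMaps.mp (mem_product.mp hp).1 i
  have hcol : ∀ A ∈ 𝒜, ∀ j, ∑ i, A (i, j) = N := by
    intro A hA j
    obtain ⟨p, hp, rfl⟩ := mem_image.mp hA
    rw [sum_overlap_left]
    exact mem_balancedMaps.mp (mem_product.mp hp).2 j
  have hg1 : ∀ a, g a ≤ 1 := by
    intro a
    rw [hg, Real.exp_le_one_iff, neg_mul, neg_div, neg_nonpos]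
    positivity
  set P : ℝ := C₁ * ((K + 1 : ℕ) : ℝ) ^ (2 * ((K + 1) * N)) *
    (√N / √N ^ ((K + 1) * (K + 1))) with hP
  have hP0 : 0 ≤ P := by positivity
  have hB := le_card_balanced (k := K + 1) (by omega) hN
  change _ ≤ ((balancedMaps (K + 1) N).card : ℝ) at hB
  rw [Nat.add_sub_cancel] at hB
  calc ∑ p ∈ S, Real.exp (κ * N * overlapDist (K + 1) N (overlap p.1 p.2))
      = ∑ A ∈ 𝒜, ((S.filter fun p => overlap p.1 p.2 = A).card : ℝ) *
          Real.exp (κ * N * overlapDist (K + 1) N A) := by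
        rw [sum_comp (fun A => Real.exp (κ * N * overlapDist (K + 1) N A))
          (fun p : (Fin ((K + 1) * N) → Fin (K + 1)) × (Fin ((K + 1) * N) → Fin (K + 1)) =>
            overlap p.1 p.2)]
        simp only [nsmul_eq_mul]
        rfl
    _ ≤ ∑ A ∈ 𝒜, P * ∏ x, g (A x) := by
        refine sum_le_sum fun A hA => le_trans ?_ (hterm N A hN (hrow A hA))
        exact mul_le_mul_of_nonneg_right (card_overlap_eq_le S A) (Real.exp_pos _).le
    _ ≤ P * (C₂ * √N) ^ (K * K) := by
        rw [← mul_sum]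
        refine mul_le_mul_of_nonneg_left ?_ hP0
        refine (sum_prod_le_pow_of_line_sums 𝒜 hrow hcol g (fun _ => (Real.exp_pos _).le)
          hg1).trans ?_
        exact pow_le_pow_left₀ (sum_nonneg fun _ _ => (Real.exp_pos _).le)
          (hgauss N (N + 1) _ hN (by positivity)) _
    _ = C₁ * C₂ ^ (K * K) * Real.exp (K + 1) ^ 2 *
        (Real.exp (-(K + 1 : ℕ)) * ((K + 1 : ℕ) : ℝ) ^ ((K + 1) * N) / √N ^ K) ^ 2 := by
        have he : Real.exp (-(K + 1 : ℕ)) = 1 / Real.exp (K + 1) := by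
          rw [Real.exp_neg, one_div]
          push_cast
          rfl
        have hpow : √(N : ℝ) ^ ((K + 1) * (K + 1)) = √N ^ (K * K) * √N * √N ^ K * √N ^ K := by
          rw [← pow_succ, ← pow_add, ← pow_add]
          congr 1
          ring
        have hpow' : ((K + 1 : ℕ) : ℝ) ^ (2 * ((K + 1) * N)) =
            (((K + 1 : ℕ) : ℝ) ^ ((K + 1) * N)) ^ 2 := by
          rw [← pow_mul, mul_comm 2]
        rw [hP, he, hpow, hpow', mul_pow]
        field_simp
    _ ≤ _ := by gcongr

lemma card_filter_forall_apply {β : Type*} [Fintype β] (m : ℕ) (P : β → Prop)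
    [DecidablePred P] :
    (univ.filter fun e : Fin m → β => ∀ i, P (e i)).card = (univ.filter P).card ^ m := by
  rw [← Fintype.card_piFinset_const]
  congr 1
  ext e
  simp

lemma card_filter_apply_eq_apply {n : ℕ} {ι : Type*} [Fintype ι] [DecidableEq ι]
    (f : Fin n → ι) :
    (univ.filter fun p : Fin n × Fin n => f p.1 = f p.2).card =
      ∑ c, (univ.filter fun v => f v = c).card ^ 2 := by
  rw [card_eq_sum_card_fiberwise (f := fun p : Fin n × Fin n => f p.1) (t := univ)
    (fun _ _ => by simp)]
  refine sum_congr rfl fun c _ => ?_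
  rw [sq, ← card_product]
  congr 1
  ext p
  simp only [mem_filter, mem_univ, true_and, mem_product]
  constructor
  · rintro ⟨h1, h2⟩
    exact ⟨h2, h1 ▸ h2⟩
  · rintro ⟨h1, h2⟩
    exact ⟨h1.trans h2.symm, h1⟩

lemma card_filter_apply_eq_of_mem_balancedMaps {k N : ℕ} {σ : Fin (k * N) → Fin k}
    (hσ : σ ∈ balancedMaps k N) :
    (univ.filter fun p : Fin (k * N) × Fin (k * N) => σ p.1 = σ p.2).card = k * N ^ 2 := by
  rw [card_filter_apply_eq_apply, sum_congr rfl fun c _ => by rw [mem_balancedMaps.mp hσ c]]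
  simp

lemma card_bichromatic {k N : ℕ} (hk : 1 ≤ k) {σ : Fin (k * N) → Fin k}
    (hσ : σ ∈ balancedMaps k N) :
    ((univ.filter fun p : Fin (k * N) × Fin (k * N) => σ p.1 ≠ σ p.2).card : ℝ) =
      ((k * N : ℕ) : ℝ) ^ 2 * (1 - 1 / k) := by
  have hk0 : (0 : ℝ) < k := by exact_mod_cast hk
  have h := card_filter_add_card_filter_not (s := univ)
    (fun p : Fin (k * N) × Fin (k * N) => σ p.1 = σ p.2)
  rw [card_filter_apply_eq_of_mem_balancedMaps hσ, card_univ, Fintype.card_prod,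
    Fintype.card_fin] at h
  have h' : (k : ℝ) * N ^ 2 +
      ((univ.filter fun p : Fin (k * N) × Fin (k * N) => ¬ σ p.1 = σ p.2).card : ℝ) =
      (k * N) * (k * N) := by exact_mod_cast h
  push_cast
  have : ((k : ℝ) * N) ^ 2 * (1 - 1 / k) = k * N * (k * N) - k * N ^ 2 := by field_simp
  rw [this, ← h']
  ring

lemma card_bichromatic_both {k N : ℕ} (hk : 1 ≤ k) (hN : 1 ≤ N) {σ τ : Fin (k * N) → Fin k}
    (hσ : σ ∈ balancedMaps k N) (hτ : τ ∈ balancedMaps k N) :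
    ((univ.filter fun p : Fin (k * N) × Fin (k * N) =>
        σ p.1 ≠ σ p.2 ∧ τ p.1 ≠ τ p.2).card : ℝ) =
      ((k * N : ℕ) : ℝ) ^ 2 *
        ((1 - 1 / k) ^ 2 + overlapDist k N (overlap σ τ) / k ^ 2) := by
  have hk0 : (0 : ℝ) < k := by exact_mod_cast hk
  have hN0 : (0 : ℝ) < N := by exact_mod_cast hN
  have hie : ((univ.filter fun p : Fin (k * N) × Fin (k * N) =>
        σ p.1 ≠ σ p.2 ∧ τ p.1 ≠ τ p.2).card : ℝ) =
      (univ : Finset (Fin (k * N) × Fin (k * N))).card -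
        (univ.filter fun p : Fin (k * N) × Fin (k * N) => σ p.1 = σ p.2).card -
        (univ.filter fun p : Fin (k * N) × Fin (k * N) => τ p.1 = τ p.2).card +
        (univ.filter fun p : Fin (k * N) × Fin (k * N) =>
          (σ p.1, τ p.1) = (σ p.2, τ p.2)).card := by
    rw [natCast_card_filter, natCast_card_filter, natCast_card_filter, natCast_card_filter,
      Finset.card_eq_sum_ones, Nat.cast_sum, ← sum_sub_distrib, ← sum_sub_distrib,
      ← sum_add_distrib]
    refine sum_congr rfl fun p _ => ?_
    by_cases h1 : σ p.1 = σ p.2 <;> by_cases h2 : τ p.1 = τ p.2 <;> simp [h1, h2]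
  rw [hie, card_filter_apply_eq_of_mem_balancedMaps hσ, card_filter_apply_eq_of_mem_balancedMaps hτ,
    card_filter_apply_eq_apply fun v => (σ v, τ v)]
  have htot : ∑ x, (overlap σ τ x : ℝ) = k * N := by
    have : ∑ x, overlap σ τ x = k * N := by
      rw [Fintype.sum_prod_type, sum_congr rfl fun i _ => (sum_overlap_right σ τ i).trans
        (mem_balancedMaps.mp hσ i)]
      simp
    exact_mod_cast this
  have hdist : overlapDist k N (overlap σ τ) = (∑ x, (overlap σ τ x : ℝ) ^ 2) / N ^ 2 - 1 := by
    rw [overlapDist]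
    simp only [sub_sq, sum_add_distrib, sum_sub_distrib, ← sum_mul, ← mul_sum, sum_const,
      card_univ, Fintype.card_prod, Fintype.card_fin, nsmul_eq_mul, div_pow, ← sum_div, htot]
    push_cast
    field_simp
    ring
  have hcast : ((∑ x, (univ.filter fun v => (σ v, τ v) = x).card ^ 2 : ℕ) : ℝ) =
      ∑ x, (overlap σ τ x : ℝ) ^ 2 := by
    push_cast
    rfl
  rw [hdist, hcast, card_univ, Fintype.card_prod, Fintype.card_fin]
  push_cast
  field_simp
  ring

lemma numBalColorings_eq_sum {k N m : ℕ} (hk : 1 ≤ k)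
    (e : Fin m → Fin (k * N) × Fin (k * N)) :
    (numBalColorings k (k * N) m e : ℝ) =
      ∑ σ ∈ balancedMaps k N, if IsProperColoring e σ then (1 : ℝ) else 0 := by
  rw [← natCast_card_filter, numBalColorings, balancedMaps, filter_filter]
  simp only [IsBalanced, Nat.mul_div_cancel_left N hk]

lemma multigraphExp_numBalColorings {k N m : ℕ} (hk : 1 ≤ k) (hN : 1 ≤ N) :
    multigraphExp (k * N) m (fun e => (numBalColorings k (k * N) m e : ℝ)) =
      (balancedMaps k N).card * (1 - 1 / (k : ℝ)) ^ m := by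
  have hn : (0 : ℝ) < ((k * N : ℕ) : ℝ) := by exact_mod_cast Nat.mul_pos hk hN
  have hσ : ∀ σ ∈ balancedMaps k N,
      ∑ e : Fin m → Fin (k * N) × Fin (k * N), (if IsProperColoring e σ then (1 : ℝ) else 0) =
        (((k * N : ℕ) : ℝ) ^ 2) ^ m * (1 - 1 / k) ^ m := by
    intro σ hσ
    rw [← natCast_card_filter, ← mul_pow, ← card_bichromatic hk hσ, ← Nat.cast_pow,
      ← card_filter_forall_apply]
    congr!
  simp only [multigraphExp, numBalColorings_eq_sum hk]
  rw [sum_comm, sum_congr rfl hσ, sum_const, nsmul_eq_mul]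
  field_simp

lemma multigraphExp_numBalColorings_sq {k N m : ℕ} (hk : 1 ≤ k) (hN : 1 ≤ N) :
    multigraphExp (k * N) m (fun e => (numBalColorings k (k * N) m e : ℝ) ^ 2) =
      ∑ p ∈ balancedMaps k N ×ˢ balancedMaps k N,
        ((1 - 1 / (k : ℝ)) ^ 2 + overlapDist k N (overlap p.1 p.2) / k ^ 2) ^ m := by
  have hn : (0 : ℝ) < ((k * N : ℕ) : ℝ) := by exact_mod_cast Nat.mul_pos hk hN
  have hp : ∀ p ∈ balancedMaps k N ×ˢ balancedMaps k N,
      ∑ e : Fin m → Fin (k * N) × Fin (k * N), (if IsProperColoring e p.1 then (1 : ℝ) else 0) *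
          (if IsProperColoring e p.2 then (1 : ℝ) else 0) =
        (((k * N : ℕ) : ℝ) ^ 2) ^ m *
          ((1 - 1 / (k : ℝ)) ^ 2 + overlapDist k N (overlap p.1 p.2) / k ^ 2) ^ m := by
    intro p hp
    rw [← mul_pow, ← card_bichromatic_both hk hN (mem_product.mp hp).1 (mem_product.mp hp).2,
      ← Nat.cast_pow, ← card_filter_forall_apply, natCast_card_filter]
    refine sum_congr rfl fun e _ => ?_
    rw [ite_zero_mul_ite_zero, one_mul]
    simp only [IsProperColoring, forall_and]
    congr
  have hsq : ∀ e : Fin m → Fin (k * N) × Fin (k * N),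
      (∑ σ ∈ balancedMaps k N, if IsProperColoring e σ then (1 : ℝ) else 0) ^ 2 =
        ∑ p ∈ balancedMaps k N ×ˢ balancedMaps k N,
          (if IsProperColoring e p.1 then (1 : ℝ) else 0) *
            (if IsProperColoring e p.2 then (1 : ℝ) else 0) := fun e => by
    rw [sq, sum_mul_sum, ← sum_product']
  simp only [multigraphExp, numBalColorings_eq_sum hk, hsq]
  rw [sum_comm, sum_congr rfl hp, ← mul_sum]
  field_simp

/-- For `0 < c < (k-1) log (k-1)` there is a constant `C = C(k,c)` such that for every
positive multiple `n` of `k`, letting `Z` be the number of balanced proper `k`-colorings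
of `G(n, ⌊cn⌋)`, one has `E[Z²] ≤ C (E[Z])²`. -/
theorem second_moment_bound (k : ℕ) (hk : 2 ≤ k) (c : ℝ) (hc₀ : 0 < c)
    (hc : c < ((k : ℝ) - 1) * Real.log ((k : ℝ) - 1)) :
    ∃ C : ℝ, ∀ n : ℕ, 0 < n → k ∣ n →
      multigraphExp n ⌊c * n⌋₊ (fun e => (numBalColorings k n ⌊c * n⌋₊ e : ℝ) ^ 2) ≤
        C * (multigraphExp n ⌊c * n⌋₊ (fun e => (numBalColorings k n ⌊c * n⌋₊ e : ℝ))) ^ 2 := by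
  have hk3 : 3 ≤ k := by
    by_contra h
    obtain rfl : k = 2 := by omega
    norm_num at hc
    linarith
  have hk3' : (3 : ℝ) ≤ k := by exact_mod_cast hk3
  have hκ : c * k / ((k : ℝ) - 1) ^ 2 < deficitConst k := by
    rw [deficitConst_of_three_le hk3, div_lt_div_iff₀ (by nlinarith) (by linarith)]
    have h1 : 0 < (k : ℝ) * (k - 2) := by nlinarith
    calc c * k * ((k : ℝ) - 2) = c * (k * (k - 2)) := by ring
      _ ≤ c * ((k : ℝ) - 1) ^ 2 := by
          gcongr
          linarith
      _ < ((k : ℝ) - 1) * Real.log (k - 1) * ((k : ℝ) - 1) ^ 2 := by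
          have : 0 < ((k : ℝ) - 1) ^ 2 := by nlinarith
          gcongr
  obtain ⟨C, hC, hsum⟩ := exists_sum_exp_overlapDist_le (by omega) hκ
  refine ⟨C, ?_⟩
  rintro n hn ⟨N, rfl⟩
  have hN : 1 ≤ N := Nat.pos_of_mul_pos_left hn
  set m := ⌊c * (k * N : ℕ)⌋₊ with hm
  rw [multigraphExp_numBalColorings (by omega) hN, multigraphExp_numBalColorings_sq (by omega) hN]
  have hmle : (m : ℝ) ≤ c * (k * N : ℕ) := Nat.floor_le (by positivity)
  have hterm : ∀ p ∈ balancedMaps k N ×ˢ balancedMaps k N,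
      ((1 - 1 / (k : ℝ)) ^ 2 + overlapDist k N (overlap p.1 p.2) / k ^ 2) ^ m ≤
        ((1 - 1 / (k : ℝ)) ^ m) ^ 2 *
          Real.exp (c * k / ((k : ℝ) - 1) ^ 2 * N * overlapDist k N (overlap p.1 p.2)) := by
    intro p _
    have hQ := overlapDist_nonneg k N (overlap p.1 p.2)
    generalize overlapDist k N (overlap p.1 p.2) = Q at hQ
    have hk1 : (0 : ℝ) < k - 1 := by linarith
    have hbase : (1 - 1 / (k : ℝ)) ^ 2 + Q / k ^ 2 ≤
        (1 - 1 / (k : ℝ)) ^ 2 * Real.exp (Q / ((k : ℝ) - 1) ^ 2) := by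
      calc (1 - 1 / (k : ℝ)) ^ 2 + Q / k ^ 2
          = (1 - 1 / (k : ℝ)) ^ 2 * (Q / ((k : ℝ) - 1) ^ 2 + 1) := by
            field_simp
            ring
        _ ≤ _ := mul_le_mul_of_nonneg_left (Real.add_one_le_exp _) (sq_nonneg _)
    calc ((1 - 1 / (k : ℝ)) ^ 2 + Q / k ^ 2) ^ m
        ≤ ((1 - 1 / (k : ℝ)) ^ 2 * Real.exp (Q / ((k : ℝ) - 1) ^ 2)) ^ m :=
          pow_le_pow_left₀ (by positivity) hbase m
      _ = ((1 - 1 / (k : ℝ)) ^ m) ^ 2 * Real.exp (m * (Q / ((k : ℝ) - 1) ^ 2)) := by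
          rw [mul_pow, ← Real.exp_nat_mul, ← pow_mul, ← pow_mul, mul_comm 2 m]
      _ ≤ ((1 - 1 / (k : ℝ)) ^ m) ^ 2 *
            Real.exp (c * (k * N : ℕ) * (Q / ((k : ℝ) - 1) ^ 2)) := by gcongr
      _ = _ := by
          push_cast
          congr 2
          ring
  calc _ ≤ ∑ p ∈ balancedMaps k N ×ˢ balancedMaps k N, ((1 - 1 / (k : ℝ)) ^ m) ^ 2 *
          Real.exp (c * k / ((k : ℝ) - 1) ^ 2 * N * overlapDist k N (overlap p.1 p.2)) :=
        sum_le_sum hterm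
    _ = ((1 - 1 / (k : ℝ)) ^ m) ^ 2 * ∑ p ∈ balancedMaps k N ×ˢ balancedMaps k N,
          Real.exp (c * k / ((k : ℝ) - 1) ^ 2 * N * overlapDist k N (overlap p.1 p.2)) := by
        rw [mul_sum]
    _ ≤ ((1 - 1 / (k : ℝ)) ^ m) ^ 2 * (C * ((balancedMaps k N).card : ℝ) ^ 2) :=
        mul_le_mul_of_nonneg_left (hsum N hN) (sq_nonneg _)
    _ = _ := by ring
end

section
/- Fix an integer k > 1 and let h : [0,1] → ℝ be continuous, strictly concave, six times differentiable on (0,1), and satisfy h'(0⁺) = +∞, h'(1⁻) > −∞, h''' > 0, h⁗ < 0, and h⁽⁶⁾ < 0 pointwise on (0,1). For 1 ≤ ρ ≤ k and any k×k row-stochastic matrix A with Σ_{i,j} a_ij² = ρ, define H(A) = Σ_{i,j} h(a_ij). Then H(A) ≤ max{ m·k·h(1/k) + (k−m)·f( (kρ−m)/(k(k−m)) ) : m real, 0 ≤ m ≤ k(k−ρ)/(k−1) }, where f(r) = h(x_r) + (k−1)·h(y_r) with x_r = (1 + √((k−1)(kr−1)))/k and y_r = (1 − x_r)/(k−1). 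-/
open Set Finset Filter

/-- `x_r = (1 + √((k-1)(kr-1)))/k`. -/
noncomputable def xR (k : ℕ) (r : ℝ) : ℝ :=
  (1 + Real.sqrt (((k : ℝ) - 1) * ((k : ℝ) * r - 1))) / (k : ℝ)

/-- `y_r = (1 - x_r)/(k-1)`. -/
noncomputable def yR (k : ℕ) (r : ℝ) : ℝ := (1 - xR k r) / ((k : ℝ) - 1)

/-- `f(r) = h(x_r) + (k-1) h(y_r)`, the value of `∑ h(s_i)` at the vector
`s*(r) = (x_r, y_r, …, y_r)`. -/
noncomputable def fFun (h : ℝ → ℝ) (k : ℕ) (r : ℝ) : ℝ :=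
  h (xR k r) + ((k : ℝ) - 1) * h (yR k r)

/-- A function with convex derivative lies below the quadratic that is tangent to it at `y` and
meets it again at `x > y`, everywhere to the left of `x`. -/
theorem exists_quadratic_majorant {h h' : ℝ → ℝ} (hcont : ContinuousOn h (Icc 0 1))
    (hd : ∀ t ∈ Ioo (0 : ℝ) 1, HasDerivAt h (h' t) t) (hconv : ConvexOn ℝ (Ioo 0 1) h')
    {x y : ℝ} (hy : 0 < y) (hyx : y < x) (hx : x < 1) :
    ∃ α β γ : ℝ, h y = α + β * y + γ * y ^ 2 ∧ h x = α + β * x + γ * x ^ 2 ∧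
      ∀ t ∈ Icc 0 x, h t ≤ α + β * t + γ * t ^ 2 := by
  obtain ⟨γ, hγ⟩ : ∃ γ, h x = h y + h' y * (x - y) + γ * (x - y) ^ 2 :=
    ⟨(h x - h y - h' y * (x - y)) / (x - y) ^ 2, by
      have : x - y ≠ 0 := by linarith
      field_simp
      ring⟩
  set D : ℝ → ℝ := fun t => h t - (h y + h' y * (t - y) + γ * (t - y) ^ 2) with hD
  set D' : ℝ → ℝ := fun t => h' t - (h' y + 2 * γ * (t - y)) with hD'
  have hDd : ∀ t ∈ Ioo (0 : ℝ) 1, HasDerivAt D (D' t) t := by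
    intro t ht
    have e := (((hasDerivAt_id t).sub_const y).const_mul (h' y)).add
      ((((hasDerivAt_id t).sub_const y).pow 2).const_mul γ)
    refine ((hd t ht).sub (e.const_add (h y))).congr_deriv ?_ |>.congr_of_eventuallyEq
      (Eventually.of_forall fun s => ?_)
    · simp [hD']
      ring
    · simp [hD]
      ring
  have hDc : ContinuousOn D (Icc 0 1) := hcont.sub (by fun_prop)
  have hDy : D y = 0 := by simp [hD]
  have hDx : D x = 0 := by simp only [hD]; linarith
  have hD'y : D' y = 0 := by simp [hD']
  have hD'c : ConvexOn ℝ (Ioo 0 1) D' := by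
    refine ⟨convex_Ioo 0 1, fun s hs t ht a b ha hb hab => ?_⟩
    have e := hconv.2 hs ht ha hb hab
    simp only [hD', smul_eq_mul] at e ⊢
    have : b = 1 - a := by linarith
    subst this
    linarith
  obtain ⟨ξ, hξ, hξ0⟩ := exists_hasDerivAt_eq_zero hyx
    (hDc.mono (Icc_subset_Icc hy.le hx.le)) (hDy.trans hDx.symm)
    (fun t ht => hDd t ⟨hy.trans ht.1, ht.2.trans hx⟩)
  have hyI : y ∈ Ioo (0 : ℝ) 1 := ⟨hy, hyx.trans hx⟩
  have hξI : ξ ∈ Ioo (0 : ℝ) 1 := ⟨hy.trans hξ.1, hξ.2.trans hx⟩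
  have left : ∀ t ∈ Ioo 0 y, 0 ≤ D' t := by
    intro t ht
    have := hD'c.secant_mono_aux2 (x := t) (y := y) (z := ξ) ⟨ht.1, ht.2.trans hyI.2⟩ hξI
      ht.2 hξ.1
    rw [hD'y, hξ0] at this
    have h1 : 0 < ξ - t := by linarith [ht.2, hξ.1]
    have h2 : 0 < y - t := by linarith [ht.2]
    rw [div_le_div_iff₀ h2 h1] at this
    nlinarith [hξ.1]
  have mid : ∀ t ∈ Ioo y ξ, D' t ≤ 0 := by
    intro t ht
    have := hD'c.secant_mono_aux2 (x := y) (y := t) (z := ξ) hyI hξI ht.1 ht.2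
    rw [hD'y, hξ0] at this
    have h2 : 0 < t - y := by linarith [ht.1]
    simp only [sub_self, zero_div, sub_zero] at this
    by_contra hc
    push Not at hc
    linarith [div_pos hc h2]
  have right : ∀ t ∈ Ioo ξ x, 0 ≤ D' t := by
    intro t ht
    have := hD'c.secant_mono_aux2 (x := y) (y := ξ) (z := t) hyI ⟨hξI.1.trans ht.1, ht.2.trans hx⟩
      hξ.1 ht.1
    rw [hD'y, hξ0] at this
    have h2 : 0 < t - y := by linarith [ht.1, hξ.1]
    simp only [sub_self, zero_div, sub_zero] at this
    by_contra hc
    push Not at hc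
    linarith [div_neg_of_neg_of_pos hc h2]
  have hmono1 : MonotoneOn D (Icc 0 y) := by
    refine monotoneOn_of_deriv_nonneg (convex_Icc _ _)
      (hDc.mono (Icc_subset_Icc le_rfl hyI.2.le)) ?_ ?_ <;> rw [interior_Icc]
    · exact fun t ht => (hDd t ⟨ht.1, ht.2.trans hyI.2⟩).differentiableAt.differentiableWithinAt
    · intro t ht
      rw [(hDd t ⟨ht.1, ht.2.trans hyI.2⟩).deriv]
      exact left t ht
  have hanti : AntitoneOn D (Icc y ξ) := by
    refine antitoneOn_of_deriv_nonpos (convex_Icc _ _)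
      (hDc.mono (Icc_subset_Icc hy.le hξI.2.le)) ?_ ?_ <;> rw [interior_Icc]
    · exact fun t ht => (hDd t ⟨hy.trans ht.1,
        ht.2.trans hξI.2⟩).differentiableAt.differentiableWithinAt
    · intro t ht
      rw [(hDd t ⟨hy.trans ht.1, ht.2.trans hξI.2⟩).deriv]
      exact mid t ht
  have hmono2 : MonotoneOn D (Icc ξ x) := by
    refine monotoneOn_of_deriv_nonneg (convex_Icc _ _)
      (hDc.mono (Icc_subset_Icc hξI.1.le hx.le)) ?_ ?_ <;> rw [interior_Icc]
    · exact fun t ht => (hDd t ⟨hξI.1.trans ht.1,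
        ht.2.trans hx⟩).differentiableAt.differentiableWithinAt
    · intro t ht
      rw [(hDd t ⟨hξI.1.trans ht.1, ht.2.trans hx⟩).deriv]
      exact right t ht
  have hneg : ∀ t ∈ Icc 0 x, D t ≤ 0 := by
    intro t ht
    rcases le_total t y with hty | hty
    · exact (hmono1 ⟨ht.1, hty⟩ ⟨hy.le, le_rfl⟩ hty).trans hDy.le
    · rcases le_total t ξ with htξ | htξ
      · exact (hanti ⟨le_rfl, hξ.1.le⟩ ⟨hty, htξ⟩ hty).trans hDy.le
      · exact (hmono2 ⟨htξ, ht.2⟩ ⟨hξ.2.le, le_rfl⟩ ht.2).trans hDx.le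
  refine ⟨h y - h' y * y + γ * y ^ 2, h' y - 2 * γ * y, γ, by ring, by rw [hγ]; ring, ?_⟩
  intro t ht
  have := hneg t ht
  simp only [hD] at this
  linarith

/-- A concave function on an open interval is first increasing and then decreasing. -/
theorem ConcaveOn.exists_monotoneOn_antitoneOn {g : ℝ → ℝ} {a b : ℝ} (hab : a ≤ b)
    (hg : ConcaveOn ℝ (Ioo a b) g) :
    ∃ c ∈ Icc a b, MonotoneOn g (Ioo a c) ∧ AntitoneOn g (Ioo c b) := by
  set S : Set ℝ := {u | u ∈ Icc a b ∧ MonotoneOn g (Ioo a u)} with hS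
  have haS : a ∈ S := ⟨⟨le_rfl, hab⟩, by simp [MonotoneOn]⟩
  have hbdd : BddAbove S := ⟨b, fun u hu => hu.1.2⟩
  refine ⟨sSup S, ⟨le_csSup hbdd haS, csSup_le ⟨a, haS⟩ fun u hu => hu.1.2⟩, ?_, ?_⟩
  · intro u hu v hv huv
    obtain ⟨w, hw, hvw⟩ := exists_lt_of_lt_csSup ⟨a, haS⟩ hv.2
    exact hw.2 ⟨hu.1, huv.trans_lt hvw⟩ ⟨hv.1, hvw⟩ huv
  · intro u hu v hv huv
    have hau : a < u := (le_csSup hbdd haS).trans_lt hu.1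
    have hnot : ¬ MonotoneOn g (Ioo a u) := fun hm =>
      hu.1.not_ge (le_csSup hbdd ⟨⟨hau.le, hu.2.le⟩, hm⟩)
    simp only [MonotoneOn, not_forall, not_le] at hnot
    obtain ⟨p, hp, q, hq, hpq, hgpq⟩ := hnot
    have hpq' : p < q := lt_of_le_of_ne hpq (by rintro rfl; exact lt_irrefl _ hgpq)
    rcases huv.eq_or_lt with rfl | huv
    · exact le_rfl
    have hpI : p ∈ Ioo a b := ⟨hp.1, hp.2.trans hu.2⟩
    have hqI : q ∈ Ioo a b := ⟨hq.1, hq.2.trans hu.2⟩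
    have huI : u ∈ Ioo a b := ⟨hau, hu.2⟩
    have hvI : v ∈ Ioo a b := ⟨hau.trans huv, hv.2⟩
    have s1 := hg.slope_anti_adjacent hpI huI hpq' hq.2
    have s2 := hg.slope_anti_adjacent hqI hvI hq.2 huv
    have s3 : (g q - g p) / (q - p) < 0 := div_neg_of_neg_of_pos (by linarith) (by linarith)
    by_contra hc
    push Not at hc
    have : 0 < (g v - g u) / (v - u) := div_pos (by linarith) (by linarith)
    linarith

/-- The mean of a function that is convex on `[a, c]` and concave on `[c, b]` over points with
mean `s` is at most the value at `s` of a chord from the left endpoint `a` to some `r ≥ s`. -/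
theorem exists_chord_ge_of_convexOn_concaveOn {ι : Type*} [Fintype ι] {f f' : ℝ → ℝ} {a b c s : ℝ}
    (hac : a ≤ c) (hcb : c ≤ b)
    (hcont : ContinuousOn f (Icc a b)) (hd : ∀ r ∈ Ioo a b, HasDerivAt f (f' r) r)
    (hconv : ConvexOn ℝ (Icc a c) f) (hconc : ConcaveOn ℝ (Icc c b) f)
    (r : ι → ℝ) (hr : ∀ i, r i ∈ Icc a b) (hs : ∑ i, r i = Fintype.card ι * s) (hsa : a < s)
    (hsb : s ≤ b) :
    ∃ θ ∈ Icc (0 : ℝ) 1, ∃ q ∈ Icc a b, s = θ * a + (1 - θ) * q ∧ θ < 1 ∧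
      ∑ i, f (r i) ≤ Fintype.card ι * (θ * f a + (1 - θ) * f q) := by
  rcases hsb.eq_or_lt with rfl | hsb
  · have hz : ∑ i, (s - r i) = 0 := by
      rw [Finset.sum_sub_distrib, hs]
      simp
    have hrs : ∀ i, r i = s := fun i => by
      have := (Finset.sum_eq_zero_iff_of_nonneg fun i _ => sub_nonneg.2 (hr i).2).1 hz i
        (Finset.mem_univ i)
      linarith
    exact ⟨0, by simp, s, ⟨hsa.le, le_rfl⟩, by ring, by norm_num, by simp [hrs]⟩
  have key : ∀ σ v : ℝ, (∀ t ∈ Icc a b, f t ≤ v + σ * (t - s)) →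
      ∑ i, f (r i) ≤ Fintype.card ι * v := by
    intro σ v hv
    calc ∑ i, f (r i) ≤ ∑ i, (v + σ * (r i - s)) := Finset.sum_le_sum fun i _ => hv _ (hr i)
      _ = Fintype.card ι * v := by
        rw [Finset.sum_add_distrib, ← Finset.mul_sum, Finset.sum_sub_distrib, hs]
        simp
  suffices H : (∃ σ, ∀ t ∈ Icc a b, f t ≤ f s + σ * (t - s)) ∨
      ∃ q ∈ Icc s b, ∀ t ∈ Icc a b, f t ≤ f a + (f q - f a) / (q - a) * (t - a) by
    rcases H with ⟨σ, hσ⟩ | ⟨q, hq, hσ⟩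
    · refine ⟨0, by simp, s, ⟨hsa.le, hsb.le⟩, by ring, by norm_num, ?_⟩
      simpa using key σ (f s) hσ
    · have hqa : 0 < q - a := by linarith [hq.1]
      refine ⟨(q - s) / (q - a), ⟨div_nonneg (by linarith [hq.1]) hqa.le, ?_⟩, q,
        ⟨by linarith, hq.2⟩, ?_, ?_, key ((f q - f a) / (q - a)) _ fun t ht => ?_⟩
      · rw [div_le_one hqa]; linarith
      · field_simp; ring
      · rw [div_lt_one hqa]; linarith
      · refine (hσ t ht).trans_eq ?_
        field_simp
        ring
  have tangent : ∀ p ∈ Ico a s, ConcaveOn ℝ (Icc p b) f → ∀ t ∈ Icc p b,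
      f t ≤ f s + f' s * (t - s) := by
    intro p hp hpc t ht
    have hsI : s ∈ Icc p b := ⟨hp.2.le, hsb.le⟩
    rcases lt_trichotomy t s with hts | rfl | hts
    · have := hpc.le_slope_of_hasDerivAt ht hsI hts (hd s ⟨hsa, hsb⟩)
      rw [slope_def_field, le_div_iff₀ (by linarith)] at this
      linarith
    · simp
    · have := hpc.slope_le_of_hasDerivAt hsI ht hts (hd s ⟨hsa, hsb⟩)
      rw [slope_def_field, div_le_iff₀ (by linarith)] at this
      linarith
  rcases hac.eq_or_lt with rfl | hac
  · exact Or.inl ⟨f' s, tangent a ⟨le_rfl, hsa⟩ hconc⟩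
  obtain ⟨q, hq, hqmax⟩ := isCompact_Icc.exists_isMaxOn (nonempty_Icc.2 hcb)
    (f := fun t => (f t - f a) / (t - a))
    (((hcont.mono (Icc_subset_Icc hac.le le_rfl)).sub continuousOn_const).div (by fun_prop)
      fun t ht => by linarith [ht.1])
  set σ := (f q - f a) / (q - a) with hσ
  have above : ∀ t ∈ Icc a b, f t ≤ f a + σ * (t - a) := by
    have aboveR : ∀ t ∈ Icc c b, f t ≤ f a + σ * (t - a) := by
      intro t ht
      have : (f t - f a) / (t - a) ≤ σ := hqmax ht
      rw [div_le_iff₀ (by linarith [ht.1])] at this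
      linarith
    intro t ht
    rcases le_total c t with hct | htc
    · exact aboveR t ⟨hct, ht.2⟩
    · have e1 := aboveR c ⟨le_rfl, hcb⟩
      rcases ht.1.eq_or_lt with rfl | hat
      · simp
      rcases htc.eq_or_lt with rfl | htc
      · exact e1
      have e2 := hconv.secant_mono_aux2 (x := a) (y := t) (z := c) ⟨le_rfl, hac.le⟩
        ⟨hac.le, le_rfl⟩ hat htc
      have e3 : (f c - f a) / (c - a) ≤ σ := by
        rw [div_le_iff₀ (by linarith)]; linarith
      have e4 := e2.trans e3
      rw [div_le_iff₀ (by linarith)] at e4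
      linarith
  have hqa : 0 < q - a := by linarith [hq.1]
  rcases le_or_gt s q with hsq | hqs
  · exact Or.inr ⟨q, ⟨hsq, hq.2⟩, above⟩
  refine Or.inl ⟨f' s, fun t ht => ?_⟩
  have hT := tangent q ⟨by linarith, hqs⟩ (hconc.subset (Icc_subset_Icc hq.1 le_rfl)
    (convex_Icc _ _))
  rcases le_total q t with hqt | htq
  · exact hT t ⟨hqt, ht.2⟩
  have e1 := above t ht
  have e2 := hT q ⟨le_rfl, hq.2⟩
  have e3 : f q = f a + σ * (q - a) := by rw [hσ]; field_simp; ring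
  have e4 := above s ⟨hsa.le, hsb.le⟩
  have e5 : f' s ≤ σ := by
    by_contra hc
    push Not at hc
    nlinarith
  nlinarith

/-- Averages of a concave function over intervals `[e - u, e + (n - 1) u]` are concave in `u`. -/
theorem concaveOn_integral_dilation {g : ℝ → ℝ} (hg : ConcaveOn ℝ (Ioo 0 1) g)
    (hgc : ContinuousOn g (Ioo 0 1)) {n : ℝ} (hn : 1 < n) :
    ConcaveOn ℝ (Ioo 0 (1 / n)) fun u => ∫ t in (0 : ℝ)..1, g (1 / n + u * (n * t - 1)) := by
  have hn0 : 0 < n := by linarith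
  have mem : ∀ u ∈ Ioo 0 (1 / n), ∀ t ∈ Icc (0 : ℝ) 1, 1 / n + u * (n * t - 1) ∈ Ioo (0 : ℝ) 1 := by
    intro u hu t ht
    have h1 : u * n < 1 := (lt_div_iff₀ hn0).1 hu.2
    have h2 : 1 / n * n = 1 := by field_simp
    have h3 : 0 ≤ u * (n * t) := mul_nonneg hu.1.le (mul_nonneg hn0.le ht.1)
    have h4 : u * (n * t) ≤ u * n :=
      mul_le_mul_of_nonneg_left (mul_le_of_le_one_right hn0.le ht.2) hu.1.le
    constructor
    · linarith [hu.2]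
    · have : (1 / n - u) * (n - 1) > 0 := mul_pos (by linarith [hu.2]) (by linarith)
      nlinarith
  have hint : ∀ u ∈ Ioo 0 (1 / n),
      IntervalIntegrable (fun t => g (1 / n + u * (n * t - 1))) MeasureTheory.volume 0 1 := by
    intro u hu
    apply ContinuousOn.intervalIntegrable
    rw [Set.uIcc_of_le zero_le_one]
    exact hgc.comp (by fun_prop) fun t ht => mem u hu t ht
  refine ⟨convex_Ioo _ _, fun u hu v hv α β hα hβ hαβ => ?_⟩
  have hw : α • u + β • v ∈ Ioo 0 (1 / n) := convex_Ioo _ _ hu hv hα hβ hαβ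
  simp only [smul_eq_mul]
  rw [← intervalIntegral.integral_const_mul, ← intervalIntegral.integral_const_mul,
    ← intervalIntegral.integral_add ((hint u hu).const_mul α) ((hint v hv).const_mul β)]
  refine intervalIntegral.integral_mono_on zero_le_one
    (((hint u hu).const_mul α).add ((hint v hv).const_mul β)) (hint _ hw) fun t ht => ?_
  have e := hg.2 (mem u hu t ht) (mem v hv t ht) hα hβ hαβ
  simp only [smul_eq_mul] at e
  refine e.trans_eq (congrArg g ?_)
  have : β = 1 - α := by linarith
  subst this
  ring

/-- The divided difference of a function with concave derivative, over the interval
`[1/n - u, 1/n + (n - 1) u]`, is concave in `u`. -/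
theorem concaveOn_divided_difference {g g' : ℝ → ℝ} (hg : ∀ t ∈ Ioo (0 : ℝ) 1, HasDerivAt g (g' t) t)
    (hg' : ConcaveOn ℝ (Ioo 0 1) g') (hgc : ContinuousOn g' (Ioo 0 1)) {n : ℝ} (hn : 1 < n) :
    ConcaveOn ℝ (Ioo 0 (1 / n)) fun u => (g (1 / n + (n - 1) * u) - g (1 / n - u)) / (n * u) := by
  refine (concaveOn_integral_dilation hg' hgc hn).congr fun u hu => ?_
  have hn0 : 0 < n := by linarith
  have hu0 : 0 < u := hu.1
  have hy : 0 < 1 / n - u := by linarith [hu.2]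
  have hx : 1 / n + (n - 1) * u < 1 := by
    have h2 : 1 / n * n = 1 := by field_simp
    have : (1 / n - u) * (n - 1) > 0 := mul_pos hy (by linarith)
    nlinarith
  have hxy : 1 / n - u ≤ 1 / n + (n - 1) * u := by nlinarith
  have hsub : Icc (1 / n - u) (1 / n + (n - 1) * u) ⊆ Ioo (0 : ℝ) 1 :=
    fun t ht => ⟨hy.trans_le ht.1, ht.2.trans_lt hx⟩
  have ftc : ∫ t in (1 / n - u)..(1 / n + (n - 1) * u), g' t =
      g (1 / n + (n - 1) * u) - g (1 / n - u) := by
    apply intervalIntegral.integral_eq_sub_of_hasDerivAt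
    · rw [Set.uIcc_of_le hxy]
      exact fun t ht => hg t (hsub ht)
    · apply ContinuousOn.intervalIntegrable
      rw [Set.uIcc_of_le hxy]
      exact hgc.mono hsub
  have e : ∀ t, 1 / n + u * (n * t - 1) = (n * u) * t + (1 / n - u) := fun t => by ring
  simp only [e]
  rw [intervalIntegral.integral_comp_mul_add _ (by positivity), smul_eq_mul]
  rw [show n * u * 0 + (1 / n - u) = 1 / n - u by ring,
    show n * u * 1 + (1 / n - u) = 1 / n + (n - 1) * u by ring, ftc]
  field_simp

/-- The parametrization of `s*(r)` by the deviation `u` of its small coordinates from `1/k`. -/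
theorem exists_xR_yR_eq {k : ℕ} (hk : 1 < k) {r : ℝ} (hr : r ∈ Icc (1 / (k : ℝ)) 1) :
    ∃ u ∈ Icc 0 (1 / (k : ℝ)), xR k r = 1 / k + (k - 1) * u ∧ yR k r = 1 / k - u ∧
      r = 1 / k + k * (k - 1) * u ^ 2 ∧ √(((k : ℝ) - 1) * (k * r - 1)) = k * (k - 1) * u := by
  have hK : (1 : ℝ) < k := by exact_mod_cast hk
  have hK1 : (0 : ℝ) < k - 1 := by linarith
  have hK0 : (0 : ℝ) < k := by linarith
  have hkr : 0 ≤ k * r - 1 := by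
    have := (div_le_iff₀ hK0).1 hr.1
    linarith
  have hsq := Real.sq_sqrt (mul_nonneg hK1.le hkr)
  have hle : √(((k : ℝ) - 1) * (k * r - 1)) ≤ k - 1 := by
    rw [Real.sqrt_le_left hK1.le, sq]
    exact mul_le_mul_of_nonneg_left (by nlinarith [hr.2]) hK1.le
  have h0 := Real.sqrt_nonneg (((k : ℝ) - 1) * (k * r - 1))
  unfold yR xR
  generalize √(((k : ℝ) - 1) * (k * r - 1)) = w at *
  refine ⟨w / (k * (k - 1)), ⟨by positivity, ?_⟩, by field_simp, by field_simp; ring, ?_,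
    by field_simp⟩
  · rw [div_le_div_iff₀ (by positivity) hK0]
    nlinarith
  · rw [div_pow, hsq]
    field_simp
    ring

theorem card_sub_one_mul_sum_sq_ge {k : ℕ} {v : Fin k → ℝ} (hv : ∑ j, v j = 1) (i : Fin k) :
    (1 - v i) ^ 2 ≤ ((k : ℝ) - 1) * (∑ j, v j ^ 2 - v i ^ 2) := by
  have h1 := Finset.add_sum_erase Finset.univ v (Finset.mem_univ i)
  have h2 := Finset.add_sum_erase Finset.univ (fun j => v j ^ 2) (Finset.mem_univ i)
  have h3 := sq_sum_le_card_mul_sum_sq (s := Finset.univ.erase i) (f := v)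
  rw [Finset.card_erase_of_mem (Finset.mem_univ i), Finset.card_univ, Fintype.card_fin,
    Nat.cast_sub (by have := i.2; omega), Nat.cast_one] at h3
  rwa [eq_sub_of_add_eq' h1, eq_sub_of_add_eq' h2, hv] at h3

theorem sum_sq_mem_Icc {k : ℕ} (hk : 1 < k) {v : Fin k → ℝ} (hv0 : ∀ j, 0 ≤ v j)
    (hv : ∑ j, v j = 1) : ∑ j, v j ^ 2 ∈ Icc (1 / (k : ℝ)) 1 := by
  have hK : (1 : ℝ) < k := by exact_mod_cast hk
  constructor
  · have := sq_sum_le_card_mul_sum_sq (s := Finset.univ) (f := v)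
    rw [hv, Finset.card_univ, Fintype.card_fin] at this
    rw [div_le_iff₀ (by linarith)]
    linarith
  · rw [← hv]
    refine Finset.sum_le_sum fun j _ => ?_
    have : v j ≤ 1 := hv ▸ Finset.single_le_sum (fun j _ => hv0 j) (Finset.mem_univ j)
    nlinarith [hv0 j]

/-- Among probability vectors of given Euclidean norm, `s*(r)` maximizes `∑ h(v_i)`. -/
theorem sum_le_fFun {k : ℕ} (hk : 1 < k) {h h' : ℝ → ℝ} (hcont : ContinuousOn h (Icc 0 1))
    (hd : ∀ t ∈ Ioo (0 : ℝ) 1, HasDerivAt h (h' t) t) (hconv : ConvexOn ℝ (Ioo 0 1) h')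
    {v : Fin k → ℝ} (hv0 : ∀ j, 0 ≤ v j) (hv : ∑ j, v j = 1) :
    ∑ j, h (v j) ≤ fFun h k (∑ j, v j ^ 2) := by
  have hK : (1 : ℝ) < k := by exact_mod_cast hk
  have hK1 : (0 : ℝ) < k - 1 := by linarith
  have hK0 : (0 : ℝ) < k := by linarith
  have hr := sum_sq_mem_Icc hk hv0 hv
  have hle : ∀ i, v i ≤ xR k (∑ j, v j ^ 2) := by
    intro i
    have h1 := card_sub_one_mul_sum_sq_ge hv i
    have h2 : k * v i - 1 ≤ √(((k : ℝ) - 1) * (k * ∑ j, v j ^ 2 - 1)) := by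
      refine Real.le_sqrt_of_sq_le ?_
      nlinarith
    rw [xR, le_div_iff₀ hK0]
    linarith
  obtain ⟨u, hu, hx, hy, hru, -⟩ := exists_xR_yR_eq hk hr
  set r := ∑ j, v j ^ 2 with hrdef
  rw [fFun]
  rw [hx] at hle
  have hKK : 1 / (k : ℝ) * k = 1 := by field_simp
  rcases hu.1.eq_or_lt with rfl | hu0
  · have hz : ∑ j, (1 / (k : ℝ) - v j) = 0 := by
      rw [Finset.sum_sub_distrib, hv]
      simp [hK0.ne']
    have hall : ∀ j, v j = 1 / k := fun j => by
      have := (Finset.sum_eq_zero_iff_of_nonneg fun j _ => by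
        have := hle j; simp only [mul_zero, add_zero] at this; linarith).1 hz j (Finset.mem_univ j)
      linarith
    rw [hx, hy]
    simp only [hall, Finset.sum_const, Finset.card_univ, Fintype.card_fin, nsmul_eq_mul, mul_zero,
      add_zero, sub_zero]
    linarith
  rcases hu.2.eq_or_lt with rfl | hu1
  · have hx1 : 1 / (k : ℝ) + (k - 1) * (1 / k) = 1 := by linarith
    rw [hx, hy, hx1, sub_self]
    rw [hx1] at hle
    have hr1 : r = 1 := by rw [hru]; field_simp; ring
    have hz : ∑ j, (v j - v j ^ 2) = 0 := by
      rw [Finset.sum_sub_distrib, hv, ← hrdef, hr1, sub_self]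
    have hall : ∀ j, h (v j) = h 0 + (h 1 - h 0) * v j := fun j => by
      have := (Finset.sum_eq_zero_iff_of_nonneg fun j _ => by
        have := hle j; nlinarith [hv0 j]).1 hz j (Finset.mem_univ j)
      have : v j * (1 - v j) = 0 := by linarith
      rcases mul_eq_zero.1 this with h0 | h1
      · rw [h0]; ring
      · rw [show v j = 1 by linarith]; ring
    simp only [hall, Finset.sum_add_distrib, ← Finset.mul_sum, hv, Finset.sum_const,
      Finset.card_univ, Fintype.card_fin, nsmul_eq_mul]
    linarith
  obtain ⟨α, β, γ, ey, ex, hq⟩ := exists_quadratic_majorant hcont hd hconv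
    (x := 1 / k + (k - 1) * u) (y := 1 / k - u) (by linarith) (by nlinarith) (by nlinarith)
  rw [hx, hy, ex, ey]
  calc ∑ j, h (v j) ≤ ∑ j, (α + β * v j + γ * v j ^ 2) :=
        Finset.sum_le_sum fun j _ => hq _ ⟨hv0 j, hle j⟩
    _ = k * α + β + γ * r := by
        simp only [Finset.sum_add_distrib, ← Finset.mul_sum, hv, Finset.sum_const,
          Finset.card_univ, Fintype.card_fin, nsmul_eq_mul, ← hrdef, mul_one]
    _ ≤ _ := by
        rw [hru]
        apply le_of_eq
        field_simp
        ring

/-- `fFun` is continuous on the range of squared norms. -/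
theorem continuousOn_fFun {k : ℕ} (hk : 1 < k) {h : ℝ → ℝ} (hcont : ContinuousOn h (Icc 0 1)) :
    ContinuousOn (fFun h k) (Icc (1 / (k : ℝ)) 1) := by
  have hK : (1 : ℝ) < k := by exact_mod_cast hk
  have hKK : 1 / (k : ℝ) * k = 1 := by field_simp
  unfold fFun
  refine (hcont.comp ?_ ?_).add (continuousOn_const.mul (hcont.comp ?_ ?_))
  · unfold xR
    fun_prop
  · intro r hr
    obtain ⟨u, hu, hx, -⟩ := exists_xR_yR_eq hk hr
    rw [hx]
    constructor <;> nlinarith [hu.1, hu.2]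
  · unfold yR xR
    fun_prop
  · intro r hr
    obtain ⟨u, hu, -, hy, -⟩ := exists_xR_yR_eq hk hr
    rw [hy]
    constructor <;> nlinarith [hu.1, hu.2]

/-- The derivative of `fFun` is half the divided difference of the derivative of `h` over `[y_r, x_r]`. -/
theorem hasDerivAt_fFun {k : ℕ} (hk : 1 < k) {h h' : ℝ → ℝ}
    (hd : ∀ t ∈ Ioo (0 : ℝ) 1, HasDerivAt h (h' t) t) {r u : ℝ} (hu : u ∈ Ioo 0 (1 / (k : ℝ)))
    (hx : xR k r = 1 / k + (k - 1) * u) (hy : yR k r = 1 / k - u)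
    (hs : √(((k : ℝ) - 1) * (k * r - 1)) = k * (k - 1) * u) :
    HasDerivAt (fFun h k)
      ((h' (1 / k + (k - 1) * u) - h' (1 / k - u)) / (k * u) / 2) r := by
  have hK : (1 : ℝ) < k := by exact_mod_cast hk
  have hK1 : (0 : ℝ) < k - 1 := by linarith
  have hK0 : (0 : ℝ) < k := by linarith
  have hKK : 1 / (k : ℝ) * k = 1 := by field_simp
  have hu0 := hu.1
  have hu1 := hu.2
  have hne : ((k : ℝ) - 1) * (k * r - 1) ≠ 0 := by
    intro h0
    rw [h0, Real.sqrt_zero] at hs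
    have : 0 < k * (k - 1) * u := by positivity
    linarith
  have hin : HasDerivAt (fun r : ℝ => ((k : ℝ) - 1) * (k * r - 1)) (((k : ℝ) - 1) * k) r := by
    simpa using (((hasDerivAt_id r).const_mul (k : ℝ)).sub_const 1).const_mul ((k : ℝ) - 1)
  have hxd : HasDerivAt (xR k) (1 / (2 * k * u)) r := by
    refine (((hin.sqrt hne).const_add 1).div_const (k : ℝ)).congr_deriv ?_
    rw [hs]
    field_simp
  have hyd : HasDerivAt (yR k) (-(1 / (2 * k * u)) / (k - 1)) r :=
    (hxd.const_sub 1).div_const _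
  have hdx := hd (xR k r) (by rw [hx]; constructor <;> nlinarith)
  have hdy := hd (yR k r) (by rw [hy]; constructor <;> nlinarith)
  refine ((hdx.comp r hxd).add ((hdy.comp r hyd).const_mul ((k : ℝ) - 1))).congr_deriv ?_
  rw [hx, hy]
  field_simp
  ring

/-- As a function of the squared norm, `fFun` is first convex and then concave. -/
theorem exists_convexOn_concaveOn_fFun {k : ℕ} (hk : 1 < k) {h h1 h2 : ℝ → ℝ}
    (hcont : ContinuousOn h (Icc 0 1))
    (hd1 : ∀ t ∈ Ioo (0 : ℝ) 1, HasDerivAt h (h1 t) t)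
    (hd2 : ∀ t ∈ Ioo (0 : ℝ) 1, HasDerivAt h1 (h2 t) t)
    (h2c : ContinuousOn h2 (Ioo 0 1)) (h2conc : ConcaveOn ℝ (Ioo 0 1) h2) :
    ∃ c ∈ Icc (1 / (k : ℝ)) 1, ConvexOn ℝ (Icc (1 / (k : ℝ)) c) (fFun h k) ∧
      ConcaveOn ℝ (Icc c 1) (fFun h k) := by
  have hK : (1 : ℝ) < k := by exact_mod_cast hk
  have hK1 : (0 : ℝ) < k - 1 := by linarith
  have hK0 : (0 : ℝ) < k := by linarith
  have hKK : 1 / (k : ℝ) * k = 1 := by field_simp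
  obtain ⟨c, hc, hmono, hanti⟩ :=
    (concaveOn_divided_difference hd2 h2conc h2c hK).exists_monotoneOn_antitoneOn (by positivity)
  set R : ℝ → ℝ := fun u => 1 / k + k * (k - 1) * u ^ 2 with hR
  have hKK1 : (0 : ℝ) < k * (k - 1) := by positivity
  have hRlt : ∀ {u v : ℝ}, 0 ≤ u → 0 ≤ v → (R u < R v ↔ u < v) := by
    intro u v hu hv
    simp only [hR, add_lt_add_iff_left, mul_lt_mul_iff_right₀ hKK1]
    exact sq_lt_sq₀ hu hv
  have hR0 : R 0 = 1 / k := by simp [hR]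
  have hR1 : R (1 / k) = 1 := by simp only [hR]; field_simp; ring
  have hRle : ∀ {u v : ℝ}, 0 ≤ u → 0 ≤ v → (R u ≤ R v ↔ u ≤ v) := fun hu hv =>
    le_iff_le_iff_lt_iff_lt.2 (hRlt hv hu)
  have hb : (0 : ℝ) ≤ 1 / k := by positivity
  have hRc : R c ∈ Icc (1 / (k : ℝ)) 1 := by
    exact ⟨hR0 ▸ (hRle le_rfl hc.1).2 hc.1, hR1 ▸ (hRle hc.1 hb).2 hc.2⟩
  have param : ∀ p ∈ Icc 0 (1 / (k : ℝ)), ∀ q ∈ Icc 0 (1 / (k : ℝ)), ∀ r ∈ Ioo (R p) (R q),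
      ∃ u ∈ Ioo p q, r = R u ∧ HasDerivAt (fFun h k)
        ((h1 (1 / k + (k - 1) * u) - h1 (1 / k - u)) / (k * u) / 2) r := by
    intro p hp q hq r hr
    have e0 := (hRle le_rfl hp.1).2 hp.1
    have e1 := (hRle hq.1 hb).2 hq.2
    rw [hR0] at e0
    rw [hR1] at e1
    obtain ⟨u, hu, hx, hy, hru, hs⟩ :=
      exists_xR_yR_eq hk (r := r) ⟨e0.trans hr.1.le, hr.2.le.trans e1⟩
    have hru' : r = R u := hru
    rw [hru'] at hr
    have hup := (hRlt hp.1 hu.1).1 hr.1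
    have huq := (hRlt hu.1 hq.1).1 hr.2
    exact ⟨u, ⟨hup, huq⟩, hru',
      hasDerivAt_fFun hk hd1 ⟨hp.1.trans_lt hup, huq.trans_le hq.2⟩ hx hy hs⟩
  have hfc := continuousOn_fFun hk hcont
  have h0I : (0 : ℝ) ∈ Icc 0 (1 / (k : ℝ)) := ⟨le_rfl, hb⟩
  have h1I : 1 / (k : ℝ) ∈ Icc 0 (1 / (k : ℝ)) := ⟨hb, le_rfl⟩
  refine ⟨R c, hRc, ?_, ?_⟩
  · rw [← hR0]
    refine MonotoneOn.convexOn_of_deriv (convex_Icc _ _)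
      (hfc.mono (Icc_subset_Icc hR0.ge hRc.2)) ?_ ?_ <;> rw [interior_Icc]
    · intro r hr
      obtain ⟨u, -, -, hd⟩ := param 0 h0I c hc r hr
      exact hd.differentiableAt.differentiableWithinAt
    · intro r hr s hs hrs
      obtain ⟨u, hu, hru, hdu⟩ := param 0 h0I c hc r hr
      obtain ⟨v, hv, hsv, hdv⟩ := param 0 h0I c hc s hs
      rw [hdu.deriv, hdv.deriv]
      rw [hru, hsv, hRle hu.1.le hv.1.le] at hrs
      linarith [hmono hu hv hrs]
  · rw [← hR1]
    refine AntitoneOn.concaveOn_of_deriv (convex_Icc _ _)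
      (hfc.mono (Icc_subset_Icc hRc.1 hR1.le)) ?_ ?_ <;> rw [interior_Icc]
    · intro r hr
      obtain ⟨u, -, -, hd⟩ := param c hc _ h1I r hr
      exact hd.differentiableAt.differentiableWithinAt
    · intro r hr s hs hrs
      obtain ⟨u, hu, hru, hdu⟩ := param c hc _ h1I r hr
      obtain ⟨v, hv, hsv, hdv⟩ := param c hc _ h1I s hs
      rw [hdu.deriv, hdv.deriv]
      rw [hru, hsv, hRle (hc.1.trans hu.1.le) (hc.1.trans hv.1.le)] at hrs
      linarith [hanti hu hv hrs]

theorem fFun_one_div {k : ℕ} (hk : 1 < k) (h : ℝ → ℝ) :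
    fFun h k (1 / (k : ℝ)) = k * h (1 / (k : ℝ)) := by
  have hK : (1 : ℝ) < k := by exact_mod_cast hk
  have hK1 : (k : ℝ) - 1 ≠ 0 := by linarith
  have hK0 : (k : ℝ) ≠ 0 := by linarith
  have hx : xR k (1 / (k : ℝ)) = 1 / k := by simp [xR, hK0]
  have hy : yR k (1 / (k : ℝ)) = 1 / k := by
    rw [yR, hx]
    field_simp
  rw [fFun, hx, hy]
  ring

/-- Main optimization principle: for a suitable entropy-like `h`, and any `k × k`
row-stochastic matrix `A` with `∑ a_ij² = ρ`,
`H(A) = ∑ h(a_ij) ≤ max { m k h(1/k) + (k-m) f((kρ-m)/(k(k-m))) : 0 ≤ m ≤ k(k-ρ)/(k-1) }`. -/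
theorem stochastic_matrix_bound (k : ℕ) (hk : 1 < k) (h h1 h2 h3 h4 h5 h6 : ℝ → ℝ)
    (hcont : ContinuousOn h (Icc 0 1))
    (hconc : StrictConcaveOn ℝ (Icc (0 : ℝ) 1) h)
    (hd1 : ∀ x ∈ Ioo (0 : ℝ) 1, HasDerivAt h (h1 x) x)
    (hd2 : ∀ x ∈ Ioo (0 : ℝ) 1, HasDerivAt h1 (h2 x) x)
    (hd3 : ∀ x ∈ Ioo (0 : ℝ) 1, HasDerivAt h2 (h3 x) x)
    (hd4 : ∀ x ∈ Ioo (0 : ℝ) 1, HasDerivAt h3 (h4 x) x)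
    (hd5 : ∀ x ∈ Ioo (0 : ℝ) 1, HasDerivAt h4 (h5 x) x)
    (hd6 : ∀ x ∈ Ioo (0 : ℝ) 1, HasDerivAt h5 (h6 x) x)
    (h1top : Tendsto h1 (nhdsWithin 0 (Ioi 0)) atTop)
    (h1bdd : ∃ M : ℝ, ∀ x ∈ Ioo (0 : ℝ) 1, M ≤ h1 x)
    (h3pos : ∀ x ∈ Ioo (0 : ℝ) 1, 0 < h3 x)
    (h4neg : ∀ x ∈ Ioo (0 : ℝ) 1, h4 x < 0)
    (h6neg : ∀ x ∈ Ioo (0 : ℝ) 1, h6 x < 0)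
    (ρ : ℝ) (hρ₁ : 1 ≤ ρ) (hρ₂ : ρ ≤ k)
    (A : Matrix (Fin k) (Fin k) ℝ)
    (hA_nonneg : ∀ i j, 0 ≤ A i j)
    (hA_row : ∀ i, ∑ j, A i j = 1)
    (hA_norm : ∑ i, ∑ j, (A i j) ^ 2 = ρ) :
    ∃ m : ℝ, 0 ≤ m ∧ m ≤ (k : ℝ) * ((k : ℝ) - ρ) / ((k : ℝ) - 1) ∧
      ∑ i, ∑ j, h (A i j) ≤
        m * (k : ℝ) * h (1 / (k : ℝ)) +
          ((k : ℝ) - m) * fFun h k (((k : ℝ) * ρ - m) / ((k : ℝ) * ((k : ℝ) - m))) := by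
  have hK : (1 : ℝ) < k := by exact_mod_cast hk
  have hK1 : (0 : ℝ) < k - 1 := by linarith
  have hK0 : (0 : ℝ) < k := by linarith
  have hKK : 1 / (k : ℝ) * k = 1 := by field_simp
  have h1conv : ConvexOn ℝ (Ioo 0 1) h1 := by
    refine MonotoneOn.convexOn_of_deriv (convex_Ioo 0 1)
      (fun x hx => (hd2 x hx).continuousAt.continuousWithinAt) ?_ ?_ <;> rw [interior_Ioo]
    · exact fun x hx => (hd2 x hx).differentiableAt.differentiableWithinAt
    · refine MonotoneOn.congr (f₁ := h2) ?_ fun x hx => (hd2 x hx).deriv.symm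
      refine monotoneOn_of_deriv_nonneg (convex_Ioo 0 1)
        (fun x hx => (hd3 x hx).continuousAt.continuousWithinAt) ?_ ?_ <;> rw [interior_Ioo]
      · exact fun x hx => (hd3 x hx).differentiableAt.differentiableWithinAt
      · exact fun x hx => (hd3 x hx).deriv ▸ (h3pos x hx).le
  have h2conc : ConcaveOn ℝ (Ioo 0 1) h2 := by
    refine AntitoneOn.concaveOn_of_deriv (convex_Ioo 0 1)
      (fun x hx => (hd3 x hx).continuousAt.continuousWithinAt) ?_ ?_ <;> rw [interior_Ioo]
    · exact fun x hx => (hd3 x hx).differentiableAt.differentiableWithinAt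
    · refine AntitoneOn.congr (f₁ := h3) ?_ fun x hx => (hd3 x hx).deriv.symm
      refine antitoneOn_of_deriv_nonpos (convex_Ioo 0 1)
        (fun x hx => (hd4 x hx).continuousAt.continuousWithinAt) ?_ ?_ <;> rw [interior_Ioo]
      · exact fun x hx => (hd4 x hx).differentiableAt.differentiableWithinAt
      · exact fun x hx => (hd4 x hx).deriv ▸ (h4neg x hx).le
  have hrow : ∑ i, ∑ j, h (A i j) ≤ ∑ i, fFun h k (∑ j, A i j ^ 2) :=
    Finset.sum_le_sum fun i _ => sum_le_fFun hk hcont hd1 h1conv (hA_nonneg i) (hA_row i)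
  have hr : ∀ i, ∑ j, A i j ^ 2 ∈ Icc (1 / (k : ℝ)) 1 := fun i =>
    sum_sq_mem_Icc hk (hA_nonneg i) (hA_row i)
  rcases hρ₁.eq_or_lt with rfl | hρ
  · refine ⟨k, hK0.le, le_of_eq (by field_simp), hrow.trans (le_of_eq ?_)⟩
    have hz : ∑ i, (∑ j, A i j ^ 2 - 1 / (k : ℝ)) = 0 := by
      rw [Finset.sum_sub_distrib, hA_norm]
      simp [hK0.ne']
    have hall : ∀ i, ∑ j, A i j ^ 2 = 1 / (k : ℝ) := fun i => by
      have := (Finset.sum_eq_zero_iff_of_nonneg fun i _ => sub_nonneg.2 (hr i).1).1 hz i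
        (Finset.mem_univ i)
      linarith
    simp only [hall, fFun_one_div hk, Finset.sum_const, Finset.card_univ, Fintype.card_fin,
      nsmul_eq_mul, sub_self, zero_mul, add_zero]
    ring
  obtain ⟨c, hc, hconvex, hconcave⟩ := exists_convexOn_concaveOn_fFun hk hcont hd1 hd2
    (fun x hx => (hd3 x hx).continuousAt.continuousWithinAt) h2conc
  have hder : ∀ r ∈ Ioo (1 / (k : ℝ)) 1, HasDerivAt (fFun h k) (deriv (fFun h k) r) r := by
    intro r hr
    obtain ⟨u, hu, hx, hy, hru, hs⟩ := exists_xR_yR_eq hk ⟨hr.1.le, hr.2.le⟩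
    refine (hasDerivAt_fFun hk hd1 ⟨hu.1.lt_of_ne ?_, hu.2.lt_of_ne ?_⟩ hx hy
      hs).differentiableAt.hasDerivAt
    · rintro rfl
      simp at hru
      exact absurd hr.1 (by simp [hru])
    · rintro rfl
      have : r = 1 := by rw [hru]; field_simp; ring
      exact hr.2.ne this
  obtain ⟨θ, hθ, q, hq, hsq, hθ1, hsum⟩ := exists_chord_ge_of_convexOn_concaveOn
    (s := ρ / k) hc.1 hc.2 (continuousOn_fFun hk hcont) hder hconvex hconcave
    (fun i => ∑ j, A i j ^ 2) hr (by rw [hA_norm, Fintype.card_fin]; field_simp)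
    (by gcongr) ((div_le_one hK0).2 hρ₂)
  have hθ1' : 0 < 1 - θ := by linarith
  have hρq : ρ = θ + (1 - θ) * q * k := by
    field_simp at hsq
    linarith
  have hqeq : ((k : ℝ) * ρ - k * θ) / (k * (k - k * θ)) = q := by
    rw [div_eq_iff (by
      rw [show (k : ℝ) * (k - k * θ) = k * k * (1 - θ) by ring]
      positivity), hρq]
    ring
  refine ⟨k * θ, mul_nonneg hK0.le hθ.1, ?_, (hrow.trans hsum).trans (le_of_eq ?_)⟩
  · rw [le_div_iff₀ hK1, mul_assoc]
    refine mul_le_mul_of_nonneg_left ?_ hK0.le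
    have : (1 - θ) * k * (1 - q) ≥ 0 :=
      mul_nonneg (mul_nonneg hθ1'.le hK0.le) (by linarith [hq.2])
    linarith
  · rw [hqeq, fFun_one_div hk, Fintype.card_fin]
    ring
end

section
/- Fix an integer k ≥ 1 and let h : [0,1] → ℝ be continuous, strictly concave, three times differentiable on (0,1), with h'(0⁺) = +∞ and h''' > 0 pointwise on (0,1). Fix 1/k ≤ r ≤ 1 and suppose s = (s_1,…,s_k) maximizes Σ_{i=1}^k h(t_i) over all t = (t_1,…,t_k) in Δ_k with Σ t_i² = r. Then, up to a permutation of coordinates, s = s*(r), i.e. s has one coordinate equal to x_r = (1 + √((k−1)(kr−1)))/k and the remaining k−1 coordinates equal to y_r = (1 − x_r)/(k−1). -/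
open Set Finset Filter

/-- Error of the quadratic Hermite interpolant of `h` at a point `A` and a double point `B`:
if the third derivative of `h` is positive on `(0,1)`, the interpolant lies strictly above `h` at every other point left of
`A`. -/
lemma lt_hermite_interpolant {h h1 h2 h3 : ℝ → ℝ}
    (hcont : ContinuousOn h (Icc 0 1))
    (hd1 : ∀ x ∈ Ioo (0 : ℝ) 1, HasDerivAt h (h1 x) x)
    (hd2 : ∀ x ∈ Ioo (0 : ℝ) 1, HasDerivAt h1 (h2 x) x)
    (hd3 : ∀ x ∈ Ioo (0 : ℝ) 1, HasDerivAt h2 (h3 x) x)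
    (h3pos : ∀ x ∈ Ioo (0 : ℝ) 1, 0 < h3 x)
    {A B t M : ℝ} (hB : 0 < B) (hBA : B < A) (hA : A ≤ 1)
    (hM : h A = h B + h1 B * (A - B) + M * (A - B) ^ 2)
    (ht : 0 ≤ t) (htA : t < A) (htB : t ≠ B) :
    h t < h B + h1 B * (t - B) + M * (t - B) ^ 2 := by
  have hneg : (t - A) * (t - B) ^ 2 < 0 :=
    mul_neg_of_neg_of_pos (by linarith) (by have := sub_ne_zero.2 htB; positivity)
  obtain ⟨K, hK⟩ : ∃ K, h t - (h B + h1 B * (t - B) + M * (t - B) ^ 2)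
      = K * ((t - A) * (t - B) ^ 2) :=
    ⟨_, (div_mul_cancel₀ _ hneg.ne).symm⟩
  set u : ℝ → ℝ := fun x => h x - (h B + h1 B * (x - B) + M * (x - B) ^ 2)
    - K * ((x - A) * (x - B) ^ 2) with hu
  set u1 : ℝ → ℝ := fun x => h1 x - (h1 B + 2 * M * (x - B))
    - K * ((x - B) ^ 2 + 2 * (x - A) * (x - B)) with hu1
  set u2 : ℝ → ℝ := fun x => h2 x - 2 * M - K * (4 * (x - B) + 2 * (x - A)) with hu2
  have du : ∀ x ∈ Ioo (0 : ℝ) 1, HasDerivAt u (u1 x) x := by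
    intro x hx
    have e (c : ℝ) : HasDerivAt (fun y : ℝ => y - c) 1 x := (hasDerivAt_id x).sub_const c
    have := ((hd1 x hx).sub ((((e B).const_mul (h1 B)).const_add (h B)).add
      (((e B).pow 2).const_mul M))).sub ((((e A).mul ((e B).pow 2))).const_mul K)
    exact this.congr_deriv (by simp [hu1]; ring)
  have du1 : ∀ x ∈ Ioo (0 : ℝ) 1, HasDerivAt u1 (u2 x) x := by
    intro x hx
    have e (c : ℝ) : HasDerivAt (fun y : ℝ => y - c) 1 x := (hasDerivAt_id x).sub_const c
    have := ((hd2 x hx).sub (((e B).const_mul (2 * M)).const_add (h1 B))).sub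
      ((((e B).pow 2).add (((e A).const_mul 2).mul (e B))).const_mul K)
    exact this.congr_deriv (by simp only [hu2]; push_cast; ring)
  have du2 : ∀ x ∈ Ioo (0 : ℝ) 1, HasDerivAt u2 (h3 x - 6 * K) x := by
    intro x hx
    have e (c : ℝ) : HasDerivAt (fun y : ℝ => y - c) 1 x := (hasDerivAt_id x).sub_const c
    have := ((hd3 x hx).sub_const (2 * M)).sub
      ((((e B).const_mul 4).add ((e A).const_mul 2)).const_mul K)
    exact this.congr_deriv (by ring)
  have rolle : ∀ f f' : ℝ → ℝ, (∀ x ∈ Ioo (0 : ℝ) 1, HasDerivAt f (f' x) x) →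
      ∀ x y, 0 < x → x < y → y < 1 → f x = 0 → f y = 0 →
      ∃ z, x < z ∧ z < y ∧ f' z = 0 := by
    intro f f' hf x y hx hxy hy fx fy
    obtain ⟨z, hz, hz'⟩ := exists_hasDerivAt_eq_zero hxy
      (fun w hw => (hf w ⟨hx.trans_le hw.1, hw.2.trans_lt hy⟩).continuousAt.continuousWithinAt)
      (fx.trans fy.symm) (fun w hw => hf w ⟨hx.trans hw.1, hw.2.trans hy⟩)
    exact ⟨z, hz.1, hz.2, hz'⟩
  have ucont : ContinuousOn u (Icc 0 1) := by
    have : Continuous fun x : ℝ => h B + h1 B * (x - B) + M * (x - B) ^ 2 := by fun_prop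
    have h' : Continuous fun x : ℝ => K * ((x - A) * (x - B) ^ 2) := by fun_prop
    exact (hcont.sub this.continuousOn).sub h'.continuousOn
  have rolle0 : ∀ x y, 0 ≤ x → x < y → y ≤ 1 → u x = 0 → u y = 0 →
      ∃ z, x < z ∧ z < y ∧ u1 z = 0 := by
    intro x y hx hxy hy fx fy
    obtain ⟨z, hz, hz'⟩ := exists_hasDerivAt_eq_zero hxy (ucont.mono (Icc_subset_Icc hx hy))
      (fx.trans fy.symm) (fun w hw => du w ⟨hx.trans_lt hw.1, hw.2.trans_le hy⟩)
    exact ⟨z, hz.1, hz.2, hz'⟩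
  have uB : u B = 0 := by simp [hu]
  have u1B : u1 B = 0 := by simp [hu1]
  have uA : u A = 0 := by simp [hu]; linarith
  have ut : u t = 0 := by simp only [hu]; linarith
  obtain ⟨x, y, z, hx, hxy, hyz, hz, ux, uy, uz⟩ : ∃ x y z, 0 < x ∧ x < y ∧ y < z ∧ z < 1 ∧
      u1 x = 0 ∧ u1 y = 0 ∧ u1 z = 0 := by
    rcases htB.lt_or_gt with hlt | hgt
    · obtain ⟨p, hp, hp', up⟩ := rolle0 t B ht hlt (by linarith) ut uB
      obtain ⟨q, hq, hq', uq⟩ := rolle0 B A hB.le hBA hA uB uA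
      exact ⟨p, B, q, by linarith, hp', hq, by linarith, up, u1B, uq⟩
    · obtain ⟨p, hp, hp', up⟩ := rolle0 B t hB.le hgt (by linarith) uB ut
      obtain ⟨q, hq, hq', uq⟩ := rolle0 t A ht htA hA ut uA
      exact ⟨B, p, q, hB, hp, by linarith, by linarith, u1B, up, uq⟩
  obtain ⟨p, hp, hp', up⟩ := rolle u1 u2 du1 x y hx hxy (by linarith) ux uy
  obtain ⟨q, hq, hq', uq⟩ := rolle u1 u2 du1 y z (by linarith) hyz hz uy uz
  obtain ⟨w, hw, hw', uw⟩ := rolle u2 _ du2 p q (by linarith) (by linarith) (by linarith) up uq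
  have := h3pos w ⟨by linarith, by linarith⟩
  have hKpos : 0 < K := by linarith
  have := mul_neg_of_pos_of_neg hKpos hneg
  linarith

/-- A triple whose two smaller entries differ can be replaced by a triple `(A, B, B)` with the same
sum and sum of squares and a strictly larger value of `∑ h`. -/
lemma exists_triple_sum_lt {h h1 h2 h3 : ℝ → ℝ}
    (hcont : ContinuousOn h (Icc 0 1))
    (hd1 : ∀ x ∈ Ioo (0 : ℝ) 1, HasDerivAt h (h1 x) x)
    (hd2 : ∀ x ∈ Ioo (0 : ℝ) 1, HasDerivAt h1 (h2 x) x)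
    (hd3 : ∀ x ∈ Ioo (0 : ℝ) 1, HasDerivAt h2 (h3 x) x)
    (h3pos : ∀ x ∈ Ioo (0 : ℝ) 1, 0 < h3 x)
    {a b c : ℝ} (hb : 0 ≤ b) (hc : 0 ≤ c) (hba : b ≤ a) (hca : c ≤ a) (hbc : b ≠ c)
    (hsum : a + b + c ≤ 1) :
    ∃ A B : ℝ, A ∈ Icc (0 : ℝ) 1 ∧ B ∈ Icc (0 : ℝ) 1 ∧ A + B + B = a + b + c ∧
      A ^ 2 + B ^ 2 + B ^ 2 = a ^ 2 + b ^ 2 + c ^ 2 ∧ h a + h b + h c < h A + h B + h B := by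
  have hbc2 : 0 < (b - c) ^ 2 := by have := sub_ne_zero.2 hbc; positivity
  have hE : 0 < a * b + b * c + c * a := by
    rcases hbc.lt_or_gt with hlt | hlt
    · have : 0 < c * a := mul_pos (by linarith) (by linarith)
      have : 0 ≤ a * b := mul_nonneg (by linarith) hb
      have := mul_nonneg hb hc
      linarith
    · have : 0 < a * b := mul_pos (by linarith) (by linarith)
      have : 0 ≤ c * a := mul_nonneg hc (by linarith)
      have := mul_nonneg hb hc
      linarith
  have hD : 0 < a ^ 2 + b ^ 2 + c ^ 2 - (a * b + b * c + c * a) := by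
    nlinarith [sq_nonneg (a - b), sq_nonneg (a - c)]
  obtain ⟨d, hd, hd2'⟩ : ∃ d : ℝ, 0 < d ∧
      d ^ 2 = a ^ 2 + b ^ 2 + c ^ 2 - (a * b + b * c + c * a) :=
    ⟨_, Real.sqrt_pos.2 hD, Real.sq_sqrt hD.le⟩
  have hds : d < a + b + c := lt_of_pow_lt_pow_left₀ 2 (by linarith) (by nlinarith)
  have had : 2 * a - b - c < 2 * d := lt_of_pow_lt_pow_left₀ 2 (by linarith) (by nlinarith)
  obtain ⟨A, hA⟩ : ∃ A, A = (a + b + c + 2 * d) / 3 := ⟨_, rfl⟩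
  obtain ⟨B, hB⟩ : ∃ B, B = (a + b + c - d) / 3 := ⟨_, rfl⟩
  have hB0 : 0 < B := by linarith
  have hBA : B < A := by linarith
  have hA1 : A ≤ 1 := by linarith
  have hAB1 : A + B + B = a + b + c := by linarith
  have hAB2 : A ^ 2 + B ^ 2 + B ^ 2 = a ^ 2 + b ^ 2 + c ^ 2 := by
    rw [hA, hB]; linear_combination (2 / 3) * hd2'
  refine ⟨A, B, ⟨by linarith, hA1⟩, ⟨by linarith, by linarith⟩, hAB1, hAB2, ?_⟩
  obtain ⟨M, hM⟩ : ∃ M, h A = h B + h1 B * (A - B) + M * (A - B) ^ 2 := by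
    have : (A - B) ^ 2 ≠ 0 := by have := sub_pos.2 hBA; positivity
    exact ⟨(h A - h B - h1 B * (A - B)) / (A - B) ^ 2, by rw [div_mul_cancel₀ _ this]; ring⟩
  have key : ∀ t, 0 ≤ t → t < A → t ≠ B → h t < h B + h1 B * (t - B) + M * (t - B) ^ 2 :=
    fun t ht htA htB => lt_hermite_interpolant hcont hd1 hd2 hd3 h3pos hB0 hBA hA1 hM ht htA htB
  have key' : ∀ t, 0 ≤ t → t < A → h t ≤ h B + h1 B * (t - B) + M * (t - B) ^ 2 := by
    intro t ht htA
    rcases eq_or_ne t B with rfl | htB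
    · simp
    · exact (key t ht htA htB).le
  have haA : a < A := by linarith
  have hlt : h a + h b + h c < (h B + h1 B * (a - B) + M * (a - B) ^ 2)
      + (h B + h1 B * (b - B) + M * (b - B) ^ 2) + (h B + h1 B * (c - B) + M * (c - B) ^ 2) := by
    have ka := key' a (by linarith) haA
    rcases eq_or_ne b B with hbB | hbB
    · linarith [key' b hb (by linarith), key c hc (by linarith) (hbB ▸ hbc.symm)]
    · linarith [key b hb (by linarith) hbB, key' c hc (by linarith)]
  refine hlt.trans_eq ?_
  rw [hM]
  linear_combination (-h1 B + 2 * M * B) * hAB1 - M * hAB2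

lemma sum_comp_update {ι : Type*} [Fintype ι] [DecidableEq ι] (F : ℝ → ℝ) (s : ι → ℝ) (i : ι)
    (x : ℝ) : ∑ m, F (Function.update s i x m) = ∑ m, F (s m) - F (s i) + F x := by
  rw [← Finset.add_sum_erase _ _ (Finset.mem_univ i),
    ← Finset.add_sum_erase _ (fun m => F (s m)) (Finset.mem_univ i),
    Finset.sum_congr rfl (g := fun m => F (s m))
      fun m hm => by rw [Function.update_of_ne (Finset.ne_of_mem_erase hm)]]
  simp only [Function.update_self]
  ring

/-- Proposition: the maximizer of `∑ h(t_i)` over the intersection of the simplex `Δ_k`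
with the sphere of radius `√r` is, up to permutation of coordinates, the vector
`s*(r) = (x_r, y_r, …, y_r)` with `x_r = (1 + √((k-1)(kr-1)))/k`, `y_r = (1-x_r)/(k-1)`. -/
theorem simplex_sphere_maximizer (k : ℕ) (hk : 1 ≤ k) (h h1 h2 h3 : ℝ → ℝ)
    (hcont : ContinuousOn h (Icc 0 1))
    (hconc : StrictConcaveOn ℝ (Icc (0 : ℝ) 1) h)
    (hd1 : ∀ x ∈ Ioo (0 : ℝ) 1, HasDerivAt h (h1 x) x)
    (hd2 : ∀ x ∈ Ioo (0 : ℝ) 1, HasDerivAt h1 (h2 x) x)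
    (hd3 : ∀ x ∈ Ioo (0 : ℝ) 1, HasDerivAt h2 (h3 x) x)
    (h0 : Tendsto h1 (nhdsWithin 0 (Ioi 0)) atTop)
    (h3pos : ∀ x ∈ Ioo (0 : ℝ) 1, 0 < h3 x)
    (r : ℝ) (hr₁ : 1 / (k : ℝ) ≤ r) (hr₂ : r ≤ 1)
    (s : Fin k → ℝ)
    (hs_mem : ∀ i, s i ∈ Icc (0 : ℝ) 1) (hs_sum : ∑ i, s i = 1)
    (hs_norm : ∑ i, (s i) ^ 2 = r)
    (hs_max : ∀ t : Fin k → ℝ, (∀ i, t i ∈ Icc (0 : ℝ) 1) → ∑ i, t i = 1 →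
      ∑ i, (t i) ^ 2 = r → ∑ i, h (t i) ≤ ∑ i, h (s i)) :
    ∃ i : Fin k,
      s i = (1 + Real.sqrt (((k : ℝ) - 1) * ((k : ℝ) * r - 1))) / (k : ℝ) ∧
      ∀ j, j ≠ i →
        s j = (1 - (1 + Real.sqrt (((k : ℝ) - 1) * ((k : ℝ) * r - 1))) / (k : ℝ)) /
          ((k : ℝ) - 1) := by
  have : Nonempty (Fin k) := ⟨⟨0, hk⟩⟩
  obtain ⟨i, hi⟩ := Finite.exists_max s
  have hEq : ∀ j l, j ≠ i → l ≠ i → s j = s l := by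
    intro j l hj hl
    by_contra hne
    have hjl : j ≠ l := fun e => hne (e ▸ rfl)
    have hle : s i + s j + s l ≤ 1 := by
      rw [← hs_sum]
      have := Finset.sum_le_univ_sum_of_nonneg (s := {i, j, l}) fun m => (hs_mem m).1
      rwa [Finset.sum_insert (by simp [hj.symm, hl.symm]), Finset.sum_pair hjl, ← add_assoc] at this
    obtain ⟨A, B, hA, hB, hAB1, hAB2, hlt⟩ := exists_triple_sum_lt hcont hd1 hd2 hd3 h3pos
      (hs_mem j).1 (hs_mem l).1 (hi j) (hi l) hne hle
    set t := Function.update (Function.update (Function.update s i A) j B) l B with ht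
    have hsumt : ∀ F : ℝ → ℝ, ∑ m, F (t m)
        = ∑ m, F (s m) - (F (s i) + F (s j) + F (s l)) + (F A + F B + F B) := by
      intro F
      rw [ht, sum_comp_update, sum_comp_update, sum_comp_update, Function.update_of_ne hjl.symm,
        Function.update_of_ne hl, Function.update_of_ne hj]
      ring
    have htmem : ∀ m, t m ∈ Icc (0 : ℝ) 1 := by
      intro m
      simp only [ht, Function.update_apply]
      split_ifs
      exacts [hB, hB, hA, hs_mem m]
    have h1' := hsumt fun x => x
    have h2' := hsumt fun x => x ^ 2
    have h3' := hsumt h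
    have := hs_max t htmem (by linarith) (by linarith)
    linarith
  have hk0 : (0 : ℝ) < k := by exact_mod_cast hk
  have hkx : 1 ≤ k * s i := by
    rw [← hs_sum]
    simpa using Finset.sum_le_card_nsmul Finset.univ s (s i) fun m _ => hi m
  have hrest : ∀ j, j ≠ i → ∀ F : ℝ → ℝ, ∑ m, F (s m) = F (s i) + (k - 1) * F (s j) := by
    intro j hj F
    rw [← Finset.add_sum_erase _ _ (Finset.mem_univ i),
      Finset.sum_congr rfl (g := fun _ => F (s j))
        fun m hm => by rw [hEq m j (Finset.ne_of_mem_erase hm) hj]]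
    simp [Nat.cast_sub hk]
  have hsq : ((k : ℝ) - 1) * (k * r - 1) = (k * s i - 1) ^ 2 := by
    by_cases hex : ∃ j, j ≠ i
    · obtain ⟨j, hj⟩ := hex
      have e1 := hrest j hj fun x => x
      have e2 := hrest j hj fun x => x ^ 2
      simp only [hs_sum, hs_norm] at e1 e2
      have e3 : ((k : ℝ) - 1) * s j = 1 - s i := by linarith
      rw [e2]
      linear_combination (k * ((k - 1) * s j + (1 - s i))) * e3
    · push Not at hex
      have huniv : (Finset.univ : Finset (Fin k)) = {i} := by ext m; simp [hex m]
      have hcard : k = 1 := by simpa using congrArg Finset.card huniv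
      have hsi : s i = 1 := by simpa [huniv] using hs_sum
      rw [hsi, hcard]
      simp
  have hx : (1 + Real.sqrt (((k : ℝ) - 1) * ((k : ℝ) * r - 1))) / (k : ℝ) = s i := by
    rw [hsq, Real.sqrt_sq (by linarith)]
    field_simp
    ring
  refine ⟨i, hx.symm, fun j hj => ?_⟩
  rw [hx]
  have e1 := hrest j hj fun x => x
  simp only [hs_sum] at e1
  have hk1 : (k : ℝ) - 1 ≠ 0 := by
    intro hk1
    have : k = 1 := by exact_mod_cast sub_eq_zero.1 hk1
    subst this
    exact hj (Subsingleton.elim _ _)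
  rw [eq_div_iff hk1]
  linarith
end

section
/- Fix an integer k > 1 and let h : [0,1] → ℝ be six times differentiable on (0,1) with h''' > 0, h⁗ < 0, and h⁽⁶⁾ < 0 pointwise on (0,1). Then the function f : [1/k, 1] → ℝ defined by f(r) = h(x_r) + (k−1)·h(y_r), where x_r = (1 + √((k−1)(kr−1)))/k and y_r = (1 − x_r)/(k−1), satisfies f''' < 0 pointwise on (1/k, 1). -/
open Set Finset

theorem le_of_hasDerivAt_nonneg {F F' : ℝ → ℝ} {p q : ℝ} (hpq : p ≤ q)
    (hF : ∀ u ∈ Icc p q, HasDerivAt F (F' u) u) (hF' : ∀ u ∈ Ioo p q, 0 ≤ F' u) :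
    F p ≤ F q := by
  refine monotoneOn_of_deriv_nonneg (convex_Icc p q)
    (fun u hu => (hF u hu).continuousAt.continuousWithinAt) (fun u hu => ?_) (fun u hu => ?_)
    (left_mem_Icc.2 hpq) (right_mem_Icc.2 hpq) hpq
  · exact (hF u (interior_subset hu)).differentiableAt.differentiableWithinAt
  · rw [(hF u (interior_subset hu)).deriv]
    exact hF' u (by rwa [interior_Icc] at hu)

theorem lt_of_hasDerivAt_pos {F F' : ℝ → ℝ} {p q : ℝ} (hpq : p < q)
    (hF : ∀ u ∈ Icc p q, HasDerivAt F (F' u) u) (hF' : ∀ u ∈ Ioo p q, 0 < F' u) :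
    F p < F q := by
  refine strictMonoOn_of_deriv_pos (convex_Icc p q)
    (fun u hu => (hF u hu).continuousAt.continuousWithinAt) (fun u hu => ?_)
    (left_mem_Icc.2 hpq.le) (right_mem_Icc.2 hpq.le) hpq
  rw [(hF u (interior_subset hu)).deriv]
  exact hF' u (by rwa [interior_Icc] at hu)

/-- Repeated integration by parts of `v * g6` for a quartic `v` with successive
derivatives `v1, v2, v3, v4`. -/
theorem hasDerivAt_quartic_parts {v v1 v2 v3 g1 g2 g3 g4 g5 : ℝ → ℝ} {v4 g6 u : ℝ}
    (hv : HasDerivAt v (v1 u) u) (hv1 : HasDerivAt v1 (v2 u) u)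
    (hv2 : HasDerivAt v2 (v3 u) u) (hv3 : HasDerivAt v3 v4 u)
    (hg1 : HasDerivAt g1 (g2 u) u) (hg2 : HasDerivAt g2 (g3 u) u)
    (hg3 : HasDerivAt g3 (g4 u) u) (hg4 : HasDerivAt g4 (g5 u) u)
    (hg5 : HasDerivAt g5 g6 u) :
    HasDerivAt (fun s => v s * g5 s - v1 s * g4 s + v2 s * g3 s - v3 s * g2 s + v4 * g1 s)
      (v u * g6) u := by
  refine ((((hv.mul hg5).sub (hv1.mul hg4)).add (hv2.mul hg3)).sub (hv3.mul hg2)).add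
    (hg1.const_mul v4) |>.congr_deriv ?_
  ring

theorem weighted_endpoint_neg {b : ℝ} (hb0 : 0 < b) (hb : b ≤ 1 / 2)
    {g1 g2 g3 g4 g5 g6 : ℝ → ℝ}
    (hg1 : ∀ u ∈ Icc (0 : ℝ) 1, HasDerivAt g1 (g2 u) u)
    (hg2 : ∀ u ∈ Icc (0 : ℝ) 1, HasDerivAt g2 (g3 u) u)
    (hg3 : ∀ u ∈ Icc (0 : ℝ) 1, HasDerivAt g3 (g4 u) u)
    (hg4 : ∀ u ∈ Icc (0 : ℝ) 1, HasDerivAt g4 (g5 u) u)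
    (hg5 : ∀ u ∈ Icc (0 : ℝ) 1, HasDerivAt g5 (g6 u) u)
    (h3 : ∀ u ∈ Icc (0 : ℝ) 1, 0 < g3 u) (h4 : ∀ u ∈ Icc (0 : ℝ) 1, g4 u < 0)
    (h6 : ∀ u ∈ Icc (0 : ℝ) 1, g6 u < 0) :
    (1 - b) ^ 2 * g3 1 - b ^ 2 * g3 0 - 3 * ((1 - b) * g2 1 + b * g2 0)
      + 3 * (g1 1 - g1 0) < 0 := by
  -- `v` and `w` are the double primitives of `K u = -b² + 3bu - (3/2)u²` vanishing to second
  -- order at `0` and at `1`; `w - v` is affine with its zero at `z`.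
  set v : ℝ → ℝ := fun u => -(u ^ 2 * (2 * b - u) ^ 2 / 8) with hv_def
  set v1 : ℝ → ℝ := fun u => -b ^ 2 * u + 3 * b * u ^ 2 / 2 - u ^ 3 / 2 with hv1_def
  set m : ℝ := (1 - b) * (1 / 2 - b) with hm
  set w : ℝ → ℝ := fun u => v u + ((1 / 2 - b) * (b - 3 / 2) / 2 + m * u) with hw_def
  set w1 : ℝ → ℝ := fun u => v1 u + m with hw1_def
  set v2 : ℝ → ℝ := fun u => -b ^ 2 + 3 * b * u - 3 * u ^ 2 / 2 with hv2_def
  set v3 : ℝ → ℝ := fun u => 3 * b - 3 * u with hv3_def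
  have hv (u : ℝ) : HasDerivAt v (v1 u) u := by
    refine ((((hasDerivAt_id u).pow 2).mul
      (((hasDerivAt_id u).const_sub (2 * b)).pow 2)).div_const 8).neg.congr_deriv ?_
    simp [hv1_def]; ring
  have hv1 (u : ℝ) : HasDerivAt v1 (v2 u) u := by
    refine ((((hasDerivAt_id u).const_mul (-b ^ 2)).add
      ((((hasDerivAt_id u).pow 2).const_mul (3 * b)).div_const 2)).sub
      (((hasDerivAt_id u).pow 3).div_const 2)).congr_deriv ?_
    simp [hv2_def]; ring
  have hv2 (u : ℝ) : HasDerivAt v2 (v3 u) u := by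
    refine ((((hasDerivAt_id u).const_mul (3 * b)).const_add (-b ^ 2)).sub
      ((((hasDerivAt_id u).pow 2).const_mul 3).div_const 2)).congr_deriv ?_
    simp [hv3_def]; ring
  have hv3 (u : ℝ) : HasDerivAt v3 (-3) u := by
    refine (((hasDerivAt_id u).const_mul 3).const_sub (3 * b)).congr_deriv ?_
    ring
  have hw (u : ℝ) : HasDerivAt w (w1 u) u := by
    refine ((hv u).add (((hasDerivAt_id u).const_mul m).const_add
      ((1 / 2 - b) * (b - 3 / 2) / 2))).congr_deriv ?_
    simp [hw1_def]
  have hw1 (u : ℝ) : HasDerivAt w1 (v2 u) u := (hv1 u).add_const m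
  have hv_nonpos (u : ℝ) : v u ≤ 0 := by
    simp only [hv_def]
    have : 0 ≤ u ^ 2 * (2 * b - u) ^ 2 / 8 := by positivity
    linarith
  have hw_nonpos (u : ℝ) : w u ≤ 0 := by
    have e : w u = -((1 - u) ^ 2 * ((2 - 4 * b) + (1 - u - 2 * (1 - b)) ^ 2) / 8) := by
      simp only [hw_def, hv_def, hm]; ring
    rw [e]
    have h2 : 0 ≤ 2 - 4 * b := by linarith
    have : 0 ≤ (1 - u) ^ 2 * ((2 - 4 * b) + (1 - u - 2 * (1 - b)) ^ 2) / 8 := by positivity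
    linarith
  set z : ℝ := (3 / 2 - b) / (2 * (1 - b)) with hz
  have hb1 : 0 < 1 - b := by linarith
  have hz_mul : 2 * (1 - b) * z = 3 / 2 - b := by rw [hz]; field_simp
  have hz1 : z ≤ 1 := by rw [hz, div_le_one (by positivity)]; linarith
  have hbz : 2 * b ≤ z := by
    rw [hz, le_div_iff₀ (by positivity)]
    nlinarith
  set E : ℝ → ℝ := fun s =>
    v s * g5 s - v1 s * g4 s + v2 s * g3 s - v3 s * g2 s + (-3) * g1 s with hE
  set G : ℝ → ℝ := fun s =>
    w s * g5 s - w1 s * g4 s + v2 s * g3 s - v3 s * g2 s + (-3) * g1 s with hG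
  have dE (u : ℝ) (hu : u ∈ Icc (0 : ℝ) 1) : HasDerivAt E (v u * g6 u) u :=
    hasDerivAt_quartic_parts (hv u) (hv1 u) (hv2 u) (hv3 u) (hg1 u hu) (hg2 u hu) (hg3 u hu)
      (hg4 u hu) (hg5 u hu)
  have dG (u : ℝ) (hu : u ∈ Icc (0 : ℝ) 1) : HasDerivAt G (w u * g6 u) u :=
    hasDerivAt_quartic_parts (hw u) (hw1 u) (hv2 u) (hv3 u) (hg1 u hu) (hg2 u hu) (hg3 u hu)
      (hg4 u hu) (hg5 u hu)
  have hE1 : E 0 < E (2 * b) := by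
    refine lt_of_hasDerivAt_pos (by linarith)
      (fun u hu => dE u ⟨hu.1, by linarith [hu.2]⟩) (fun u hu => ?_)
    refine mul_pos_of_neg_of_neg ?_ (h6 u ⟨hu.1.le, by linarith [hu.2]⟩)
    have h1 : 0 < u := hu.1
    have h2 : 0 < 2 * b - u := by linarith [hu.2]
    have : 0 < u ^ 2 * (2 * b - u) ^ 2 / 8 := by positivity
    simp only [hv_def]
    linarith
  have hE2 : E (2 * b) ≤ E z :=
    le_of_hasDerivAt_nonneg hbz
      (fun u hu => dE u ⟨by linarith [hu.1], by linarith [hu.2]⟩)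
      (fun u hu => mul_nonneg_of_nonpos_of_nonpos (hv_nonpos u)
        (h6 u ⟨by linarith [hu.1], by linarith [hu.2]⟩).le)
  have hG1 : G z ≤ G 1 :=
    le_of_hasDerivAt_nonneg hz1
      (fun u hu => dG u ⟨by linarith [hu.1], by linarith [hu.2]⟩)
      (fun u hu => mul_nonneg_of_nonpos_of_nonpos (hw_nonpos u)
        (h6 u ⟨by linarith [hu.1], by linarith [hu.2]⟩).le)
  have hEG : E z - G z = m * g4 z := by
    have hwz : w z = v z := by
      simp only [hw_def, hm]
      linear_combination (1 / 2 - b) / 2 * hz_mul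
    simp only [hE, hG, hwz, hw1_def]
    ring
  have hm0 : 0 ≤ m := mul_nonneg hb1.le (by linarith)
  have hmz : m * g4 z ≤ 0 :=
    mul_nonpos_of_nonneg_of_nonpos hm0 (h4 z ⟨by linarith, hz1⟩).le
  have hG_one : G 1 = (-b ^ 2 + 3 * b - 3 / 2) * g3 1 + 3 * (1 - b) * g2 1 - 3 * g1 1 := by
    simp only [hG, hw_def, hw1_def, hv_def, hv1_def, hv2_def, hv3_def, hm]; ring
  have hE_zero : E 0 = -b ^ 2 * g3 0 - 3 * b * g2 0 - 3 * g1 0 := by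
    simp only [hE, hv_def, hv1_def, hv2_def, hv3_def]; ring
  have hb3 : 0 ≤ (1 / 2 - b) * g3 1 :=
    mul_nonneg (by linarith) (h3 1 ⟨zero_le_one, le_rfl⟩).le
  linarith

theorem xR_sub_yR {k : ℕ} (hk : 1 < k) (r : ℝ) :
    xR k r - yR k r = √(((k : ℝ) - 1) * ((k : ℝ) * r - 1)) / ((k : ℝ) - 1) := by
  have hk' : (1 : ℝ) < k := by exact_mod_cast hk
  have h1 : (k : ℝ) - 1 ≠ 0 := by linarith
  have h0 : (k : ℝ) ≠ 0 := by linarith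
  unfold yR xR
  field_simp
  ring

theorem yR_pos_lt_xR_lt_one {k : ℕ} (hk : 1 < k) {r : ℝ} (hr : r ∈ Ioo (1 / (k : ℝ)) 1) :
    0 < yR k r ∧ yR k r < xR k r ∧ xR k r < 1 := by
  have hk' : (1 : ℝ) < k := by exact_mod_cast hk
  have h1 : 0 < (k : ℝ) - 1 := by linarith
  have h0 : 0 < (k : ℝ) := by linarith
  have hr1 : 0 < (k : ℝ) * r - 1 := by
    have := (div_lt_iff₀ h0).1 hr.1
    linarith
  have hs : √(((k : ℝ) - 1) * ((k : ℝ) * r - 1)) < k - 1 := by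
    rw [Real.sqrt_lt' h1, sq]
    have := mul_lt_mul_of_pos_left hr.2 h0
    exact mul_lt_mul_of_pos_left (by linarith) h1
  have hx : xR k r < 1 := by
    unfold xR
    rw [div_lt_one h0]
    linarith
  have hd : 0 < xR k r - yR k r := by
    rw [xR_sub_yR hk]
    exact div_pos (Real.sqrt_pos.2 (mul_pos h1 hr1)) h1
  exact ⟨div_pos (by linarith) h1, by linarith, hx⟩

theorem hasDerivAt_xR {k : ℕ} (hk : 1 < k) {r : ℝ} (hr : r ∈ Ioo (1 / (k : ℝ)) 1) :
    HasDerivAt (xR k) (1 / (2 * (xR k r - yR k r))) r := by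
  have hk' : (1 : ℝ) < k := by exact_mod_cast hk
  have h1 : (k : ℝ) - 1 ≠ 0 := by linarith
  have h0 : (k : ℝ) ≠ 0 := by linarith
  have hd : 0 < xR k r - yR k r := sub_pos.2 (yR_pos_lt_xR_lt_one hk hr).2.1
  rw [xR_sub_yR hk] at hd ⊢
  have hs : √(((k : ℝ) - 1) * ((k : ℝ) * r - 1)) ≠ 0 := by
    rintro h
    simp [h] at hd
  have hs' : ((k : ℝ) - 1) * ((k : ℝ) * r - 1) ≠ 0 := by
    rintro h
    simp [h] at hs
  refine ((((((hasDerivAt_id r).const_mul (k : ℝ)).sub_const 1).const_mul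
    ((k : ℝ) - 1)).sqrt hs').const_add 1).div_const (k : ℝ) |>.congr_deriv ?_
  simp only [id, mul_one]
  field_simp

theorem hasDerivAt_yR {k : ℕ} (hk : 1 < k) {r : ℝ} (hr : r ∈ Ioo (1 / (k : ℝ)) 1) :
    HasDerivAt (yR k) (-(1 / (2 * (xR k r - yR k r))) / ((k : ℝ) - 1)) r :=
  ((hasDerivAt_xR hk hr).const_sub 1).div_const _

/-- On an open interval, `deriv` only depends on the values there. -/
theorem hasDerivAt_deriv_of_eqOn {F F1 : ℝ → ℝ} {p q r F2 : ℝ} (hr : r ∈ Ioo p q)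
    (hF : ∀ s ∈ Ioo p q, deriv F s = F1 s) (hF1 : HasDerivAt F1 F2 r) :
    HasDerivAt (deriv F) F2 r :=
  hF1.congr_of_eventuallyEq (Filter.eventually_of_mem (Ioo_mem_nhds hr.1 hr.2) hF)

/-- If `h` is six times differentiable on `(0,1)` with `h''' > 0`, `h⁗ < 0` and
`h⁽⁶⁾ < 0` pointwise, then `f''' < 0` pointwise on `(1/k, 1)`. -/
theorem f_third_deriv_neg (k : ℕ) (hk : 1 < k) (h h1 h2 h3 h4 h5 h6 : ℝ → ℝ)
    (hd1 : ∀ x ∈ Ioo (0 : ℝ) 1, HasDerivAt h (h1 x) x)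
    (hd2 : ∀ x ∈ Ioo (0 : ℝ) 1, HasDerivAt h1 (h2 x) x)
    (hd3 : ∀ x ∈ Ioo (0 : ℝ) 1, HasDerivAt h2 (h3 x) x)
    (hd4 : ∀ x ∈ Ioo (0 : ℝ) 1, HasDerivAt h3 (h4 x) x)
    (hd5 : ∀ x ∈ Ioo (0 : ℝ) 1, HasDerivAt h4 (h5 x) x)
    (hd6 : ∀ x ∈ Ioo (0 : ℝ) 1, HasDerivAt h5 (h6 x) x)
    (h3pos : ∀ x ∈ Ioo (0 : ℝ) 1, 0 < h3 x)
    (h4neg : ∀ x ∈ Ioo (0 : ℝ) 1, h4 x < 0)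
    (h6neg : ∀ x ∈ Ioo (0 : ℝ) 1, h6 x < 0) :
    ∀ r ∈ Ioo (1 / (k : ℝ)) 1, deriv (deriv (deriv (fFun h k))) r < 0 := by
  intro r hr
  have hk' : (2 : ℝ) ≤ k := by exact_mod_cast hk
  have hk1 : (k : ℝ) - 1 ≠ 0 := by linarith
  have hk0 : (k : ℝ) ≠ 0 := by linarith
  set b : ℝ := 1 / (k : ℝ) with hb
  have hb0 : 0 < b := by positivity
  have hb2 : b ≤ 1 / 2 := one_div_le_one_div_of_le two_pos hk'
  have ha : 1 - b ≠ 0 := by linarith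
  have hkb : (k : ℝ) = 1 / b := by simp [hb]
  have hk1b : (k : ℝ) - 1 = (1 - b) / b := by rw [hkb]; field_simp
  have hX (s : ℝ) (hs : s ∈ Ioo b 1) : xR k s ∈ Ioo (0 : ℝ) 1 := by
    have := yR_pos_lt_xR_lt_one hk hs
    exact ⟨by linarith, this.2.2⟩
  have hY (s : ℝ) (hs : s ∈ Ioo b 1) : yR k s ∈ Ioo (0 : ℝ) 1 := by
    have := yR_pos_lt_xR_lt_one hk hs
    exact ⟨this.1, by linarith⟩
  have hD (s : ℝ) (hs : s ∈ Ioo b 1) : 0 < xR k s - yR k s :=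
    sub_pos.2 (yR_pos_lt_xR_lt_one hk hs).2.1
  have dX (s : ℝ) (hs : s ∈ Ioo b 1) := hasDerivAt_xR hk hs
  have dY (s : ℝ) (hs : s ∈ Ioo b 1) := hasDerivAt_yR hk hs
  have f1 (s : ℝ) (hs : s ∈ Ioo b 1) : deriv (fFun h k) s =
      (h1 (xR k s) - h1 (yR k s)) / (2 * (xR k s - yR k s)) := by
    have hds := (hD s hs).ne'
    refine HasDerivAt.deriv (((hd1 _ (hX s hs)).comp s (dX s hs)).add
      (((hd1 _ (hY s hs)).comp s (dY s hs)).const_mul ((k : ℝ) - 1)) |>.congr_deriv ?_)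
    field_simp
    ring
  have f2 (s : ℝ) (hs : s ∈ Ioo b 1) : deriv (deriv (fFun h k)) s =
      ((xR k s - yR k s) * ((1 - b) * h2 (xR k s) + b * h2 (yR k s))
        - (h1 (xR k s) - h1 (yR k s))) / (4 * (1 - b) * (xR k s - yR k s) ^ 3) := by
    have hds := (hD s hs).ne'
    refine HasDerivAt.deriv (hasDerivAt_deriv_of_eqOn hs f1
      ((((hd2 _ (hX s hs)).comp s (dX s hs)).sub ((hd2 _ (hY s hs)).comp s (dY s hs))).div
        (((dX s hs).sub (dY s hs)).const_mul 2) (mul_ne_zero two_ne_zero hds)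
        |>.congr_deriv ?_))
    simp only [Function.comp_apply, Pi.sub_apply]
    rw [hk1b]
    set d := xR k s - yR k s
    field_simp
    ring
  have f3 : deriv (deriv (deriv (fFun h k))) r =
      ((xR k r - yR k r) ^ 2 * ((1 - b) ^ 2 * h3 (xR k r) - b ^ 2 * h3 (yR k r))
        - 3 * (xR k r - yR k r) * ((1 - b) * h2 (xR k r) + b * h2 (yR k r))
        + 3 * (h1 (xR k r) - h1 (yR k r))) / (8 * (1 - b) ^ 2 * (xR k r - yR k r) ^ 5) := by
    have hds := (hD r hr).ne'
    have dd := (dX r hr).sub (dY r hr)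
    refine HasDerivAt.deriv (hasDerivAt_deriv_of_eqOn hr f2
      (((dd.mul ((((hd3 _ (hX r hr)).comp r (dX r hr)).const_mul (1 - b)).add
        (((hd3 _ (hY r hr)).comp r (dY r hr)).const_mul b))).sub
        (((hd2 _ (hX r hr)).comp r (dX r hr)).sub ((hd2 _ (hY r hr)).comp r (dY r hr)))).div
        ((dd.pow 3).const_mul (4 * (1 - b)))
        (mul_ne_zero (mul_ne_zero four_ne_zero ha) (pow_ne_zero 3 hds))
        |>.congr_deriv ?_))
    simp only [Function.comp_apply, Pi.sub_apply, Pi.mul_apply, Pi.add_apply, Pi.pow_apply]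
    rw [hk1b]
    set d := xR k r - yR k r
    field_simp
    ring
  rw [f3]
  set d := xR k r - yR k r with hd
  have hd0 : 0 < d := hD r hr
  have hmem (u : ℝ) (hu : u ∈ Icc (0 : ℝ) 1) : yR k r + d * u ∈ Ioo (0 : ℝ) 1 := by
    have hdu : d * u ≤ d := mul_le_of_le_one_right hd0.le hu.2
    have hdu0 : 0 ≤ d * u := mul_nonneg hd0.le hu.1
    exact ⟨by linarith [(hY r hr).1], by linarith [(hX r hr).2]⟩
  have chain {p p' : ℝ → ℝ} (hp : ∀ x ∈ Ioo (0 : ℝ) 1, HasDerivAt p (p' x) x) (n : ℕ) :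
      ∀ u ∈ Icc (0 : ℝ) 1, HasDerivAt (fun u => d ^ n * p (yR k r + d * u))
        (d ^ (n + 1) * p' (yR k r + d * u)) u := by
    intro u hu
    refine ((hp _ (hmem u hu)).comp u
      (((hasDerivAt_id u).const_mul d).const_add (yR k r))).const_mul (d ^ n)
      |>.congr_deriv ?_
    ring
  have key := weighted_endpoint_neg hb0 hb2 (chain hd2 0) (chain hd3 1) (chain hd4 2)
    (chain hd5 3) (chain hd6 4) (fun u hu => mul_pos (pow_pos hd0 _) (h3pos _ (hmem u hu)))
    (fun u hu => mul_neg_of_pos_of_neg (pow_pos hd0 _) (h4neg _ (hmem u hu)))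
    (fun u hu => mul_neg_of_pos_of_neg (pow_pos hd0 _) (h6neg _ (hmem u hu)))
  have hyd : yR k r + d = xR k r := by rw [hd]; ring
  simp only [mul_one, mul_zero, add_zero, hyd] at key
  refine div_neg_of_neg_of_pos (lt_of_eq_of_lt ?_ key) (by positivity)
  ring
end

section
/- Let k ≥ 1 be an integer and let ψ : [0,1] → ℝ be continuous on [0,1], three times differentiable on (0,1), with ψ'(1⁻) = −∞ and ψ''' < 0 pointwise on (0,1). Fix γ ∈ (0,k] and let s = (s_1,…,s_k) ∈ [0,1]^k satisfy Σ_{i=1}^k s_i = γ. Then Σ_{i=1}^k ψ(s_i) ≤ max{ m·ψ(0) + (k−m)·ψ(γ/(k−m)) : m real, m ∈ [0, k−γ] }. -/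
open Set Finset Filter

/-- An antitone function on `(a, b)` changes sign at most once, from nonnegative to nonpositive. -/
theorem AntitoneOn.exists_sign_change {g : ℝ → ℝ} {a b : ℝ} (hab : a ≤ b)
    (hg : AntitoneOn g (Ioo a b)) :
    ∃ p ∈ Icc a b, (∀ x ∈ Ioo a p, 0 ≤ g x) ∧ ∀ x ∈ Ioo p b, g x ≤ 0 := by
  set S : Set ℝ := insert a {x | x ∈ Ioo a b ∧ 0 ≤ g x} with hS
  have hSb : ∀ x ∈ S, x ≤ b := by
    rintro x (rfl | hx)
    exacts [hab, hx.1.2.le]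
  have hbdd : BddAbove S := ⟨b, hSb⟩
  have hap : a ≤ sSup S := le_csSup hbdd (mem_insert a _)
  refine ⟨sSup S, ⟨hap, csSup_le ⟨a, mem_insert a _⟩ hSb⟩, fun x hx => ?_, fun x hx => ?_⟩
  · obtain ⟨y, hy, hxy⟩ := exists_lt_of_lt_csSup ⟨a, mem_insert a _⟩ hx.2
    rcases hy with rfl | hy
    · exact absurd hx.1 hxy.not_gt
    · exact hy.2.trans (hg ⟨hx.1, hxy.trans hy.1.2⟩ hy.1 hxy.le)
  · by_contra! h
    exact hx.1.not_ge (le_csSup hbdd (Or.inr ⟨⟨hap.trans_lt hx.1, hx.2⟩, h.le⟩))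

/-- The graph of a concave function lies below its tangent lines. -/
theorem ConcaveOn.le_tangent_of_hasDerivAt {f : ℝ → ℝ} {f' x y : ℝ} {S : Set ℝ}
    (hf : ConcaveOn ℝ S f) (hx : x ∈ S) (hy : y ∈ S) (hf' : HasDerivAt f f' x) :
    f y ≤ f x + f' * (y - x) := by
  rcases lt_trichotomy x y with h | rfl | h
  · have := hf.slope_le_of_hasDerivAt hx hy h hf'
    rw [slope_def_field, div_le_iff₀ (sub_pos.2 h)] at this
    linarith
  · simp
  · have := hf.le_slope_of_hasDerivAt hy hx h hf'
    rw [slope_def_field, le_div_iff₀ (sub_pos.2 h)] at this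
    linarith

/-- A continuous function on `[0, b]` that is convex on an initial segment `[0, p]` lies below one
of its chords issuing from `0`. -/
theorem ConvexOn.exists_chord_ge {f : ℝ → ℝ} {p b : ℝ} (hp : 0 < p) (hpb : p ≤ b)
    (hcont : ContinuousOn f (Icc 0 b)) (hconv : ConvexOn ℝ (Icc 0 p) f) :
    ∃ t ∈ Icc p b, ∀ x ∈ Icc 0 b, f x ≤ f 0 + (f t - f 0) / t * x := by
  have hc : ContinuousOn (fun u => (f u - f 0) / u) (Icc p b) :=
    ((hcont.mono (Icc_subset_Icc_left hp.le)).sub continuousOn_const).div continuousOn_id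
      fun x hx => (hp.trans_le hx.1).ne'
  obtain ⟨t, ht, hmax⟩ := isCompact_Icc.exists_isMaxOn (nonempty_Icc.2 hpb) hc
  refine ⟨t, ht, fun x hx => ?_⟩
  rcases hx.1.eq_or_lt with rfl | h0
  · simp
  have key : (f x - f 0) / x ≤ (f t - f 0) / t := by
    rcases le_total p x with h | h
    · exact hmax ⟨h, hx.2⟩
    · have := hconv.secant_mono (a := 0) (x := x) (y := p) ⟨le_rfl, hp.le⟩ ⟨h0.le, h⟩
        ⟨hp.le, le_rfl⟩ h0.ne' hp.ne' h
      simp only [sub_zero] at this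
      exact this.trans (hmax ⟨le_rfl, hpb⟩)
  rw [div_le_iff₀ h0] at key
  linarith

/-- For a function on `[0, 1]` that is convex and then concave, every interior point either has a
global tangent line lying above the graph, or lies to the left of the endpoint `t` of a chord from
`0` lying above the graph. -/
theorem exists_tangent_or_chord_ge {f f' : ℝ → ℝ} {p a : ℝ} (hp : p ∈ Icc (0 : ℝ) 1)
    (ha : a ∈ Ioo (0 : ℝ) 1) (hcont : ContinuousOn f (Icc 0 1)) (hf' : HasDerivAt f (f' a) a)
    (hconv : ConvexOn ℝ (Icc 0 p) f) (hconc : ConcaveOn ℝ (Icc p 1) f) :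
    (∀ x ∈ Icc (0 : ℝ) 1, f x ≤ f a + f' a * (x - a)) ∨
      ∃ t ∈ Icc a 1, ∀ x ∈ Icc (0 : ℝ) 1, f x ≤ f 0 + (f t - f 0) / t * x := by
  rcases hp.1.eq_or_lt with rfl | hp0
  · exact Or.inl fun x hx => hconc.le_tangent_of_hasDerivAt (Ioo_subset_Icc_self ha) hx hf'
  obtain ⟨t, ht, hchord⟩ := hconv.exists_chord_ge hp0 hp.2 hcont
  rcases le_or_gt a t with hat | hta
  · exact Or.inr ⟨t, ⟨hat, ht.2⟩, hchord⟩
  refine Or.inl fun x hx => ?_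
  have htan : ∀ y ∈ Icc p 1, f y ≤ f a + f' a * (y - a) := fun y hy =>
    hconc.le_tangent_of_hasDerivAt ⟨ht.1.trans hta.le, ha.2.le⟩ hy hf'
  rcases le_total p x with hpx | hxp
  · exact htan x ⟨hpx, hx.2⟩
  have h₁ := hchord x hx
  have h₂ := hchord a (Ioo_subset_Icc_self ha)
  have h₃ := htan t ht
  have h₄ : (f t - f 0) / t * t = f t - f 0 := div_mul_cancel₀ _ (hp0.trans_le ht.1).ne'
  set c := (f t - f 0) / t
  have h₅ : f' a ≤ c := by
    by_contra! h
    nlinarith [mul_pos (sub_pos.2 h) (sub_pos.2 hta)]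
  nlinarith [mul_nonneg (sub_nonneg.2 h₅) (sub_nonneg.2 (hxp.trans ht.1))]

/-- If `ψ` is continuous on `[0,1]`, three times differentiable on `(0,1)` with
`ψ'(1⁻) = -∞` and `ψ''' < 0` pointwise, and `s ∈ [0,1]^k` has `∑ s_i = γ ∈ (0,k]`, then
`∑ ψ(s_i) ≤ max { m ψ(0) + (k-m) ψ(γ/(k-m)) : m ∈ [0, k-γ] }`. -/
theorem simplex_cube_bound (k : ℕ) (hk : 1 ≤ k) (ψ ψ1 ψ2 ψ3 : ℝ → ℝ)
    (hcont : ContinuousOn ψ (Icc 0 1))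
    (hd1 : ∀ x ∈ Ioo (0 : ℝ) 1, HasDerivAt ψ (ψ1 x) x)
    (hd2 : ∀ x ∈ Ioo (0 : ℝ) 1, HasDerivAt ψ1 (ψ2 x) x)
    (hd3 : ∀ x ∈ Ioo (0 : ℝ) 1, HasDerivAt ψ2 (ψ3 x) x)
    (hψ1 : Tendsto ψ1 (nhdsWithin 1 (Iio 1)) atBot)
    (hψ3 : ∀ x ∈ Ioo (0 : ℝ) 1, ψ3 x < 0)
    (γ : ℝ) (hγ₀ : 0 < γ) (hγk : γ ≤ k)
    (s : Fin k → ℝ) (hs : ∀ i, s i ∈ Icc (0 : ℝ) 1) (hsum : ∑ i, s i = γ) :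
    ∃ m : ℝ, m ∈ Icc (0 : ℝ) ((k : ℝ) - γ) ∧
      ∑ i, ψ (s i) ≤ m * ψ 0 + ((k : ℝ) - m) * ψ (γ / ((k : ℝ) - m)) := by
  have hk0 : (0 : ℝ) < k := by exact_mod_cast hk
  have sum_le : ∀ A B : ℝ, (∀ x ∈ Icc (0 : ℝ) 1, ψ x ≤ A + B * x) →
      ∑ i, ψ (s i) ≤ k * A + B * γ := fun A B h => by
    calc ∑ i, ψ (s i) ≤ ∑ i, (A + B * s i) := Finset.sum_le_sum fun i _ => h _ (hs i)
      _ = k * A + B * γ := by rw [Finset.sum_add_distrib, ← Finset.mul_sum, hsum]; simp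
  rcases hγk.eq_or_lt with rfl | hlt
  · have hone : ∀ i, s i = 1 := by
      have h := (Finset.sum_eq_sum_iff_of_le (s := Finset.univ) (f := s) (g := fun _ => (1 : ℝ))
        fun i _ => (hs i).2).1 (by simpa using hsum)
      exact fun i => h i (Finset.mem_univ i)
    exact ⟨0, by simp, by simp [hone, div_self hk0.ne']⟩
  have hanti : AntitoneOn ψ2 (Ioo 0 1) :=
    antitoneOn_of_hasDerivWithinAt_nonpos (f' := ψ3) (convex_Ioo 0 1)
      (fun x hx => (hd3 x hx).continuousAt.continuousWithinAt)
      (fun x hx => (hd3 x (interior_subset hx)).hasDerivWithinAt)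
      fun x hx => (hψ3 x (interior_subset hx)).le
  obtain ⟨p, hp, hnonneg, hnonpos⟩ := hanti.exists_sign_change zero_le_one
  have hconv : ConvexOn ℝ (Icc 0 p) ψ := by
    refine convexOn_of_hasDerivWithinAt2_nonneg (f' := ψ1) (f'' := ψ2) (convex_Icc 0 p)
      (hcont.mono (Icc_subset_Icc_right hp.2)) ?_ ?_ ?_ <;> rw [interior_Icc]
    · exact fun x hx => (hd1 x ⟨hx.1, hx.2.trans_le hp.2⟩).hasDerivWithinAt
    · exact fun x hx => (hd2 x ⟨hx.1, hx.2.trans_le hp.2⟩).hasDerivWithinAt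
    · exact hnonneg
  have hconc : ConcaveOn ℝ (Icc p 1) ψ := by
    refine concaveOn_of_hasDerivWithinAt2_nonpos (f' := ψ1) (f'' := ψ2) (convex_Icc p 1)
      (hcont.mono (Icc_subset_Icc_left hp.1)) ?_ ?_ ?_ <;> rw [interior_Icc]
    · exact fun x hx => (hd1 x ⟨hp.1.trans_lt hx.1, hx.2⟩).hasDerivWithinAt
    · exact fun x hx => (hd2 x ⟨hp.1.trans_lt hx.1, hx.2⟩).hasDerivWithinAt
    · exact hnonpos
  have ha : γ / k ∈ Ioo (0 : ℝ) 1 := ⟨div_pos hγ₀ hk0, (div_lt_one hk0).2 hlt⟩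
  rcases exists_tangent_or_chord_ge hp ha hcont (hd1 _ ha) hconv hconc with htan | ⟨t, ht, hchord⟩
  · refine ⟨0, ⟨le_rfl, by linarith⟩, ?_⟩
    have h := sum_le (ψ (γ / k) - ψ1 (γ / k) * (γ / k)) (ψ1 (γ / k)) fun x hx => by
      linarith [htan x hx]
    refine h.trans_eq ?_
    simp only [zero_mul, zero_add, sub_zero]
    field_simp
    ring
  · have ht0 : 0 < t := ha.1.trans_le ht.1
    refine ⟨k - γ / t, ⟨?_, ?_⟩, ?_⟩
    · rw [sub_nonneg, div_le_iff₀ ht0, ← div_le_iff₀' hk0]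
      exact ht.1
    · rw [sub_le_sub_iff_left, le_div_iff₀ ht0]
      exact mul_le_of_le_one_right hγ₀.le ht.2
    · refine (sum_le _ _ hchord).trans_eq ?_
      rw [sub_sub_cancel, div_div_cancel₀ hγ₀.ne']
      field_simp
      ring
end

section
/- Fix an integer k ≥ 1 and 0 < γ < k. Let ψ : [0,1] → ℝ be continuous on [0,1], three times differentiable on (0,1), with ψ'(1⁻) = −∞ and ψ''' < 0 pointwise on (0,1). Let A = { (a,b,ℓ) ∈ (0,1] × [0,1] × (0,k] : b < a and ℓa + (k−ℓ)b = γ } and define g(a,b,ℓ) = ℓ·ψ(a) + (k−ℓ)·ψ(b) on A. If (a,b,ℓ) ∈ A attains the maximum of g over A, then a = γ/ℓ (equivalently b = 0). -/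
open Set Filter

/-- A function on `[0, 1]` with negative third derivative strictly decreases to the right of an
interior local maximum. -/
theorem IsLocalMax.lt_of_third_deriv_neg {f f1 f2 f3 : ℝ → ℝ} {a b : ℝ}
    (hcont : ContinuousOn f (Icc 0 1))
    (hd1 : ∀ x ∈ Ioo (0 : ℝ) 1, HasDerivAt f (f1 x) x)
    (hd2 : ∀ x ∈ Ioo (0 : ℝ) 1, HasDerivAt f1 (f2 x) x)
    (hd3 : ∀ x ∈ Ioo (0 : ℝ) 1, HasDerivAt f2 (f3 x) x)
    (hf3 : ∀ x ∈ Ioo (0 : ℝ) 1, f3 x < 0)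
    (hmax : IsLocalMax f b) (hb : 0 < b) (hba : b < a) (ha : a ≤ 1) : f a < f b := by
  have hb1 : b ∈ Ioo (0 : ℝ) 1 := ⟨hb, hba.trans_le ha⟩
  have hcrit : f1 b = 0 := hmax.hasDerivAt_eq_zero (hd1 b hb1)
  have hanti2 : StrictAntiOn f2 (Ioo 0 1) := by
    refine strictAntiOn_of_hasDerivWithinAt_neg (f' := f3) (convex_Ioo 0 1)
      (fun x hx => (hd3 x hx).continuousAt.continuousWithinAt) ?_ ?_ <;> rw [interior_Ioo]
    · exact fun x hx => (hd3 x hx).hasDerivWithinAt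
    · exact hf3
  have hf2b : f2 b ≤ 0 := by
    by_contra! hpos
    have hmono1 : StrictMonoOn f1 (Ioc 0 b) := by
      refine strictMonoOn_of_hasDerivWithinAt_pos (f' := f2) (convex_Ioc 0 b)
        (fun x hx => (hd2 x ⟨hx.1, hx.2.trans_lt hb1.2⟩).continuousAt.continuousWithinAt) ?_ ?_ <;>
        rw [interior_Ioc]
      · exact fun x hx => (hd2 x ⟨hx.1, hx.2.trans hb1.2⟩).hasDerivWithinAt
      · exact fun x hx => hpos.trans (hanti2 ⟨hx.1, hx.2.trans hb1.2⟩ hb1 hx.2)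
    have hanti : StrictAntiOn f (Icc 0 b) := by
      refine strictAntiOn_of_hasDerivWithinAt_neg (f' := f1) (convex_Icc 0 b)
        (hcont.mono (Icc_subset_Icc_right hb1.2.le)) ?_ ?_ <;> rw [interior_Icc]
      · exact fun x hx => (hd1 x ⟨hx.1, hx.2.trans hb1.2⟩).hasDerivWithinAt
      · exact fun x hx => hcrit ▸ hmono1 ⟨hx.1, hx.2.le⟩ ⟨hb, le_rfl⟩ hx.2
    obtain ⟨x, hx, hx0, hxb⟩ :=
      ((hmax.filter_mono nhdsWithin_le_nhds).and (Ioo_mem_nhdsLT hb)).exists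
    exact (hanti ⟨hx0.le, hxb.le⟩ ⟨hb.le, le_rfl⟩ hxb).not_ge hx
  have hanti1 : StrictAntiOn f1 (Ico b 1) := by
    refine strictAntiOn_of_hasDerivWithinAt_neg (f' := f2) (convex_Ico b 1)
      (fun x hx => (hd2 x ⟨hb.trans_le hx.1, hx.2⟩).continuousAt.continuousWithinAt) ?_ ?_ <;>
      rw [interior_Ico]
    · exact fun x hx => (hd2 x ⟨hb.trans hx.1, hx.2⟩).hasDerivWithinAt
    · exact fun x hx => (hanti2 hb1 ⟨hb.trans hx.1, hx.2⟩ hx.1).trans_le hf2b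
  have hanti : StrictAntiOn f (Icc b 1) := by
    refine strictAntiOn_of_hasDerivWithinAt_neg (f' := f1) (convex_Icc b 1)
      (hcont.mono (Icc_subset_Icc_left hb.le)) ?_ ?_ <;> rw [interior_Icc]
    · exact fun x hx => (hd1 x ⟨hb.trans hx.1, hx.2⟩).hasDerivWithinAt
    · exact fun x hx => hcrit ▸ hanti1 ⟨le_rfl, hb1.2⟩ ⟨hx.1.le, hx.2⟩ hx.1
  exact hanti ⟨le_rfl, hb1.2.le⟩ ⟨hba.le, ha⟩ hba

/-- Lemma on maximizers over the region
`A = {(a,b,ℓ) ∈ (0,1] × [0,1] × (0,k] : b < a, ℓa + (k-ℓ)b = γ}` of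
`g(a,b,ℓ) = ℓ ψ(a) + (k-ℓ) ψ(b)`: every maximizer has `a = γ/ℓ`. -/
theorem abm_maximizer (k : ℕ) (hk : 1 ≤ k) (γ : ℝ) (hγ₀ : 0 < γ) (hγk : γ < k)
    (ψ ψ1 ψ2 ψ3 : ℝ → ℝ)
    (hcont : ContinuousOn ψ (Icc 0 1))
    (hd1 : ∀ x ∈ Ioo (0 : ℝ) 1, HasDerivAt ψ (ψ1 x) x)
    (hd2 : ∀ x ∈ Ioo (0 : ℝ) 1, HasDerivAt ψ1 (ψ2 x) x)
    (hd3 : ∀ x ∈ Ioo (0 : ℝ) 1, HasDerivAt ψ2 (ψ3 x) x)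
    (hψ1 : Tendsto ψ1 (nhdsWithin 1 (Iio 1)) atBot)
    (hψ3 : ∀ x ∈ Ioo (0 : ℝ) 1, ψ3 x < 0)
    (a b ℓ : ℝ)
    (ha : a ∈ Ioc (0 : ℝ) 1) (hb : b ∈ Icc (0 : ℝ) 1) (hℓ : ℓ ∈ Ioc (0 : ℝ) (k : ℝ))
    (hba : b < a) (habℓ : ℓ * a + ((k : ℝ) - ℓ) * b = γ)
    (hmax : ∀ a' b' ℓ' : ℝ, a' ∈ Ioc (0 : ℝ) 1 → b' ∈ Icc (0 : ℝ) 1 →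
      ℓ' ∈ Ioc (0 : ℝ) (k : ℝ) → b' < a' → ℓ' * a' + ((k : ℝ) - ℓ') * b' = γ →
      ℓ' * ψ a' + ((k : ℝ) - ℓ') * ψ b' ≤ ℓ * ψ a + ((k : ℝ) - ℓ) * ψ b) :
    a = γ / ℓ := by
  rw [eq_div_iff hℓ.1.ne']
  by_contra hne
  have hℓk : 0 < (k : ℝ) - ℓ := by
    refine sub_pos.2 (lt_of_le_of_ne hℓ.2 fun h => hne ?_)
    rw [h, sub_self, zero_mul, add_zero] at habℓ
    rw [h, mul_comm, habℓ]
  have hb0 : 0 < b := by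
    refine lt_of_le_of_ne hb.1 fun h => hne ?_
    rw [← h, mul_zero, add_zero] at habℓ
    rw [mul_comm, habℓ]
  have hbγ : (k : ℝ) * b < γ := by nlinarith [mul_pos hℓ.1 (sub_pos.2 hba)]
  have haγ : γ < (k : ℝ) * a := by nlinarith [mul_pos hℓk (sub_pos.2 hba)]
  have hk0 : (0 : ℝ) < k := hγ₀.trans hγk
  obtain ⟨s, hs⟩ : ∃ s, ψ a - ψ b = s * (a - b) :=
    ⟨(ψ a - ψ b) / (a - b), (div_mul_cancel₀ _ (sub_pos.2 hba).ne').symm⟩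
  have hloc : IsLocalMax (fun x => ψ x - s * x) b := by
    have hbm : b < γ / k := by rwa [lt_div_iff₀' hk0]
    filter_upwards [Ioo_mem_nhds hb0 hbm] with x hx
    have hxγ : (k : ℝ) * x < γ := by rw [← lt_div_iff₀' hk0]; exact hx.2
    have hxa : x < a := lt_of_mul_lt_mul_left (hxγ.trans haγ) hk0.le
    have hax : 0 < a - x := sub_pos.2 hxa
    obtain ⟨t, ht⟩ : ∃ t, t * (a - x) = γ - k * x :=
      ⟨(γ - k * x) / (a - x), div_mul_cancel₀ _ hax.ne'⟩
    have ht0 : 0 < t := pos_of_mul_pos_left (by rw [ht]; linarith) hax.le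
    have htk : 0 < k - t := pos_of_mul_pos_left (b := a - x) (by nlinarith) hax.le
    have h := hmax a x t ha ⟨hx.1.le, hxa.le.trans ha.2⟩ ⟨ht0, by linarith⟩ hxa (by linarith)
    have hψa : ψ a = ψ b + s * (a - b) := by linarith
    refine le_of_mul_le_mul_left ?_ htk
    rw [hψa] at h
    linear_combination h + s * habℓ - s * ht
  have hlt : ψ a - s * a < ψ b - s * b := hloc.lt_of_third_deriv_neg
    (f1 := fun x => ψ1 x - s) (f2 := ψ2) (f3 := ψ3)
    (hcont.sub (by fun_prop))
    (fun x hx => by simpa using (hd1 x hx).sub ((hasDerivAt_id x).const_mul s))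
    (fun x hx => (hd2 x hx).sub_const s) hd3 hψ3 hb0 hba ha.2
  linarith
end
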